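/- Let J ⊆ ∘I be nonempty. (1) For each x ∈ W_J and K ⊊ J, Φ_J^∞(x.Z^K_J) = ∇_J(K, x̄^K, z_x), where z_x is the unique element of W_K with Φ_J((x̄^K)⁻¹x) ∩ Δ_{K+} = Φ_K(z_x). (2) Both Φ_J^∞ : W_J^∞ → 𝔅^∞_J and χ_J : P_J → W_J^∞, χ_J(K, u, y) = (uy).Z^K_J, are bijective, and Φ_J^∞ ∘ χ_J = ∇_J. (3) W_J^∞ is the disjoint union over K ⊊ J of the W_J-orbits W_J.Z^K_J. -/

import Mathlib

open scoped Pointwise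

section

variable {ι V : Type*} [Fintype ι] [Nonempty ι] [AddCommGroup V] [Module ℝ V]

/-- The length of `w` with respect to a generating set `S` of a group. -/
noncomputable def lenG {G : Type*} [Group G] (S : Set G) (w : G) : ℕ :=
  sInf {n | ∃ l : List G, (∀ x ∈ l, x ∈ S) ∧ l.length = n ∧ l.prod = w}

/-- `v` is a nonnegative linear combination of the simple roots `α` of `∘Δ`. -/
def PosoComb (α : ι → V) (v : V) : Prop :=
  ∃ c : ι → ℝ, (∀ i, 0 ≤ c i) ∧ v = ∑ i, c i • α i

/-- The parabolic subgroup `∘W_J = ⟨s_j | j ∈ J⟩` of the finite Weyl group, realized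
inside the group of linear automorphisms of `𝔥* = V`. -/
def WoJ (α : ι → V) (s : V → V ≃ₗ[ℝ] V) (J : Set ι) : Subgroup (V ≃ₗ[ℝ] V) :=
  Subgroup.closure ((fun j => s (α j)) '' J)

/-- `∘Δ_J = ∘W_J(∘Π_J)` (so `∘Δ_∅ = ∅`). -/
def DeloJ (α : ι → V) (s : V → V ≃ₗ[ℝ] V) (J : Set ι) : Set V :=
  {v | ∃ g ∈ WoJ α s J, ∃ j ∈ J, v = g (α j)}

/-- `∘Δ`, the root system of the underlying finite-dimensional simple Lie algebra. -/
def Delo (α : ι → V) (s : V → V ≃ₗ[ℝ] V) : Set V := DeloJ α s Set.univ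

/-- `∘Δ^K_{J+} = (∘Δ_J ∖ ∘Δ_K) ∩ ∘Δ₊`. -/
def DeloKJpos (α : ι → V) (s : V → V ≃ₗ[ℝ] V) (J K : Set ι) : Set V :=
  (DeloJ α s J \ DeloJ α s K) ∩ {v | PosoComb α v}

/-- `∘Δ^K_{J−} = (∘Δ_J ∖ ∘Δ_K) ∩ ∘Δ₋`. -/
def DeloKJneg (α : ι → V) (s : V → V ≃ₗ[ℝ] V) (J K : Set ι) : Set V :=
  (DeloJ α s J \ DeloJ α s K) ∩ {v | PosoComb α (-v)}

/-- The set `∘W^K_J` of minimal-length representatives of the right cosets `∘W_J/∘W_K`. -/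
def MinReps (α : ι → V) (s : V → V ≃ₗ[ℝ] V) (J K : Set ι) : Set (V ≃ₗ[ℝ] V) :=
  {w | w ∈ WoJ α s J ∧ ∀ v ∈ WoJ α s K,
    lenG (Set.range fun i => s (α i)) w ≤ lenG (Set.range fun i => s (α i)) (w * v)}

/-- The affine simple roots `Π = {α₀ = δ − θ} ∪ ∘Π`, indexed by `Option ι`. -/
def alHat (α : ι → V) (δ θ : V) : Option ι → V := fun o => o.elim (δ - θ) α

/-- `v` is a nonnegative linear combination of the affine simple roots. -/
def PosComb (α : ι → V) (δ θ : V) (v : V) : Prop :=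
  ∃ c : Option ι → ℝ, (∀ o, 0 ≤ c o) ∧ v = ∑ o, c o • alHat α δ θ o

/-- The real roots `Δ^re = {mδ + ε | m ∈ ℤ, ε ∈ ∘Δ}`. -/
def DelRe (α : ι → V) (δ : V) (s : V → V ≃ₗ[ℝ] V) : Set V :=
  {v | ∃ m : ℤ, ∃ ε ∈ Delo α s, v = m • δ + ε}

/-- The imaginary roots `Δ^im = {mδ | m ∈ ℤ ∖ {0}}`. -/
def DelIm (δ : V) : Set V := {v | ∃ m : ℤ, m ≠ 0 ∧ v = m • δ}

/-- The affine root system `Δ = Δ^re ∪ Δ^im`. -/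
def Del (α : ι → V) (δ : V) (s : V → V ≃ₗ[ℝ] V) : Set V := DelRe α δ s ∪ DelIm δ

/-- The positive roots `Δ₊` (relative to `Π`). -/
def DelPos (α : ι → V) (δ θ : V) (s : V → V ≃ₗ[ℝ] V) : Set V :=
  {v ∈ Del α δ s | PosComb α δ θ v}

/-- The negative roots `Δ₋ = −Δ₊`. -/
def DelNeg (α : ι → V) (δ θ : V) (s : V → V ≃ₗ[ℝ] V) : Set V :=
  {v | -v ∈ DelPos α δ θ s}

/-- `Δ^re₊ = Δ^re ∩ Δ₊`. -/
def DelRePos (α : ι → V) (δ θ : V) (s : V → V ≃ₗ[ℝ] V) : Set V :=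
  DelRe α δ s ∩ DelPos α δ θ s

/-- `Δ^im₊ = {mδ | m ≥ 1}`. -/
def DelImPos (δ : V) : Set V := {v | ∃ m : ℕ, 0 < m ∧ v = (m : ℤ) • δ}

/-- `⟨ε⟩ = {mδ + ε | m ∈ ℤ≥0} ∩ Δ^re₊`. -/
def brkt (α : ι → V) (δ θ : V) (s : V → V ≃ₗ[ℝ] V) (ε : V) : Set V :=
  {v | ∃ m : ℕ, v = (m : ℤ) • δ + ε} ∩ DelRePos α δ θ s

/-- `⟨P⟩ = ⋃_{ε ∈ P} ⟨ε⟩`. -/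
def brSet (α : ι → V) (δ θ : V) (s : V → V ≃ₗ[ℝ] V) (P : Set V) : Set V :=
  ⋃ ε ∈ P, brkt α δ θ s ε

/-- `Δ^re_J = {mδ + ε | m ∈ ℤ, ε ∈ ∘Δ_J}`. -/
def DelReJ (α : ι → V) (δ : V) (s : V → V ≃ₗ[ℝ] V) (J : Set ι) : Set V :=
  {v | ∃ m : ℤ, ∃ ε ∈ DeloJ α s J, v = m • δ + ε}

/-- `Δ_J = Δ^re_J ∪ Δ^im`. -/
def DelJ (α : ι → V) (δ : V) (s : V → V ≃ₗ[ℝ] V) (J : Set ι) : Set V :=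
  DelReJ α δ s J ∪ DelIm δ

/-- `Δ_{J+} = Δ_J ∩ Δ₊`. -/
def DelJPos (α : ι → V) (δ θ : V) (s : V → V ≃ₗ[ℝ] V) (J : Set ι) : Set V :=
  DelJ α δ s J ∩ DelPos α δ θ s

/-- `Δ_{J+} = ⟨∘Δ_J⟩ ∪ Δ^im₊` (the description used from Section 5 onwards). -/
def DelJPosB (α : ι → V) (δ θ : V) (s : V → V ≃ₗ[ℝ] V) (J : Set ι) : Set V :=
  brSet α δ θ s (DeloJ α s J) ∪ DelImPos δ

/-- The set of highest roots of the irreducible components of `∘Δ_J`, i.e. the maximal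
elements of `∘Δ_{J+}`: the positive roots `ε` of `∘Δ_J` such that no `ε + α_j` is a root. -/
def HighRoots (α : ι → V) (s : V → V ≃ₗ[ℝ] V) (J : Set ι) : Set V :=
  {ε ∈ DeloJ α s J | PosoComb α ε ∧ ∀ j ∈ J, ε + α j ∉ DeloJ α s J}

/-- `Π_J = ∘Π_J ⊔ {δ − θ_{J_c} | c}`. -/
def PiJ (α : ι → V) (δ : V) (s : V → V ≃ₗ[ℝ] V) (J : Set ι) : Set V :=
  (α '' J) ∪ (fun x => δ - x) '' HighRoots α s J

/-- `S_J = {s_α | α ∈ Π_J}`. -/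
def SJ (α : ι → V) (δ : V) (s : V → V ≃ₗ[ℝ] V) (J : Set ι) : Set (V ≃ₗ[ℝ] V) :=
  s '' PiJ α δ s J

/-- `W_J = ⟨S_J⟩` (so `W_∅ = {1}`). -/
def WJ (α : ι → V) (δ : V) (s : V → V ≃ₗ[ℝ] V) (J : Set ι) : Subgroup (V ≃ₗ[ℝ] V) :=
  Subgroup.closure (SJ α δ s J)

/-- `Φ_J(y) = {β ∈ Δ_{J+} | y⁻¹(β) < 0}`, with `Δ_{J+} = Δ_J ∩ Δ₊`. -/
def PhiJ (α : ι → V) (δ θ : V) (s : V → V ≃ₗ[ℝ] V) (J : Set ι) (y : V ≃ₗ[ℝ] V) : Set V :=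
  {β ∈ DelJPos α δ θ s J | y⁻¹ β ∈ DelNeg α δ θ s}

/-- `Φ_J(y) = {β ∈ Δ_{J+} | y⁻¹(β) < 0}`, with `Δ_{J+} = ⟨∘Δ_J⟩ ∪ Δ^im₊`. -/
def PhiJb (α : ι → V) (δ θ : V) (s : V → V ≃ₗ[ℝ] V) (J : Set ι) (y : V ≃ₗ[ℝ] V) : Set V :=
  {β ∈ DelJPosB α δ θ s J | y⁻¹ β ∈ DelNeg α δ θ s}

/-- `Δ^K_J(u, −) = ⟨u∘Δ^K_{J−}⟩`. -/
def DKJm (α : ι → V) (δ θ : V) (s : V → V ≃ₗ[ℝ] V) (J K : Set ι) (u : V ≃ₗ[ℝ] V) : Set V :=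
  brSet α δ θ s (⇑u '' DeloKJneg α s J K)

/-- `Δ^K_J(u, +) = ⟨u∘Δ^K_{J+}⟩`. -/
def DKJp (α : ι → V) (δ θ : V) (s : V → V ≃ₗ[ℝ] V) (J K : Set ι) (u : V ≃ₗ[ℝ] V) : Set V :=
  brSet α δ θ s (⇑u '' DeloKJpos α s J K)

/-- `B` is a convex set in `A`: `B ⊆ A` and `β, γ ∈ B`, `β + γ ∈ A` imply `β + γ ∈ B`. -/
def ConvexIn (A B : Set V) : Prop :=
  B ⊆ A ∧ ∀ x ∈ B, ∀ y ∈ B, x + y ∈ A → x + y ∈ B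

/-- `B` is a biconvex set in `A`: both `B` and `A ∖ B` are convex sets in `A`. -/
def BiconvexIn (A B : Set V) : Prop :=
  ConvexIn A B ∧ ConvexIn A (A \ B)

/-- `P ⊆ ∘Δ` is a closed set. -/
def ClosedIn (Δo P : Set V) : Prop :=
  ∀ ε ∈ P, ∀ η ∈ P, ε + η ∈ Δo → ε + η ∈ P

/-- The coroot `α_j^∨ = 2α_j/(α_j|α_j)`. -/
noncomputable def coroot (α : ι → V) (B : V →ₗ[ℝ] V →ₗ[ℝ] ℝ) (j : ι) : V :=
  (2 / B (α j) (α j)) • α j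

/-- The coroot lattice `∘Q^∨_J = ⊕_{j ∈ J} ℤ α_j^∨`. -/
def QJ (α : ι → V) (B : V →ₗ[ℝ] V →ₗ[ℝ] ℝ) (J : Set ι) : Set V :=
  {lam | ∃ c : ι → ℤ, (∀ j, j ∉ J → c j = 0) ∧ lam = ∑ j, c j • coroot α B j}

/-- `g` acts as the translation `t_λ`: `g(μ) = μ − (μ|λ)δ` for `μ` in the span of `Π`. -/
def IsTransl (α : ι → V) (δ θ : V) (B : V →ₗ[ℝ] V →ₗ[ℝ] ℝ) (lam : V)
    (g : V ≃ₗ[ℝ] V) : Prop :=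
  ∀ μ ∈ Submodule.span ℝ (Set.range (alHat α δ θ)), g μ = μ - B μ lam • δ

/-- The translation subgroup `T_J = {t_λ | λ ∈ ∘Q^∨_J}` of `W_J`. -/
def TJ (α : ι → V) (δ θ : V) (B : V →ₗ[ℝ] V →ₗ[ℝ] ℝ) (s : V → V ≃ₗ[ℝ] V)
    (J : Set ι) : Set (V ≃ₗ[ℝ] V) :=
  {g | g ∈ WJ α δ s J ∧ ∃ lam ∈ QJ α B J, IsTransl α δ θ B lam g}

/-- The hypotheses describing the root datum of an untwisted affine Kac–Moody Lie algebra
over `ℝ`: `α` are the simple roots of the underlying finite-dimensional simple Lie algebra,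
`δ` is the null root, `θ` the highest root of `∘Δ`, `B` the standard invariant bilinear form,
and `s a` the reflection in a (real) root `a`. -/
structure AffineSetup (α : ι → V) (δ θ : V) (B : V →ₗ[ℝ] V →ₗ[ℝ] ℝ)
    (s : V → V ≃ₗ[ℝ] V) : Prop where
  indep : LinearIndependent ℝ (alHat α δ θ)
  Bsymm : ∀ u v : V, B u v = B v u
  Bpos : ∀ v ∈ Delo α s, 0 < B v v
  refl_def : ∀ a : V, B a a ≠ 0 → ∀ v : V, s a v = v - (2 * B v a / B a a) • a
  delta_orth : ∀ i : ι, B δ (α i) = 0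
  delta_null : B δ δ = 0
  theta_high : θ ∈ HighRoots α s Set.univ
  cryst : ∀ i : ι, ∀ v ∈ Delo α s, ∃ m : ℤ, s (α i) v = v - m • α i
  base : ∀ v ∈ Delo α s, Xor' (PosoComb α v) (PosoComb α (-v))
  finite : (Delo α s).Finite
  reduced : ∀ v ∈ Delo α s, (2 : ℝ) • v ∉ Delo α s
  irred : ∀ A : Set ι, (∀ i ∈ A, ∀ j ∈ Aᶜ, s (α i) (α j) = α j) → A = ∅ ∨ A = Set.univ

/-- The partial products `z_s(p) = s(1)⋯s(p)` of an infinite sequence of elements of `Π_J`. -/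
def zwA (s : V → V ≃ₗ[ℝ] V) (f : ℕ → V) (p : ℕ) : V ≃ₗ[ℝ] V :=
  ((List.range p).map fun k => s (f k)).prod

/-- `f` encodes an infinite reduced word of the Coxeter system `(W_J, S_J)`. -/
def IRW (α : ι → V) (δ : V) (s : V → V ≃ₗ[ℝ] V) (J : Set ι) (f : ℕ → V) : Prop :=
  (∀ p, f p ∈ PiJ α δ s J) ∧ ∀ p, lenG (SJ α δ s J) (zwA s f p) = p

/-- The equivalence relation `∼` on infinite reduced words of `(W_J, S_J)`. -/
def relJ (α : ι → V) (δ : V) (s : V → V ≃ₗ[ℝ] V) (J : Set ι) (f g : ℕ → V) : Prop :=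
  ∀ p q : ℕ, ∃ p₀ ≥ p, ∃ q₀ ≥ q,
    lenG (SJ α δ s J) ((zwA s f p)⁻¹ * zwA s g p₀) = p₀ - p ∧
    lenG (SJ α δ s J) ((zwA s g q)⁻¹ * zwA s f q₀) = q₀ - q

/-- `Φ_J^∞([s]) = ⋃_p Φ_J(z_s(p))`. -/
def PhiInfJ (α : ι → V) (δ θ : V) (s : V → V ≃ₗ[ℝ] V) (J : Set ι) (f : ℕ → V) : Set V :=
  ⋃ p : ℕ, PhiJb α δ θ s J (zwA s f p)

/-- `Φ̃^∞(x, s) = {β ∈ Δ^re_{J+} | (x z_s(p))⁻¹(β) < 0 for all sufficiently large p}`,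
i.e. `Φ_J^∞(x.[s])`. -/
def PhiInfXJ (α : ι → V) (δ θ : V) (s : V → V ≃ₗ[ℝ] V) (J : Set ι) (x : V ≃ₗ[ℝ] V)
    (f : ℕ → V) : Set V :=
  {β ∈ brSet α δ θ s (DeloJ α s J) |
    ∃ p₀ : ℕ, ∀ p ≥ p₀, (x * zwA s f p)⁻¹ β ∈ DelNeg α δ θ s}

set_option linter.unusedSectionVars false

/-- Abstract data of a reflection group with a root set `R`, simple roots `Pi`, and a linear
functional `ρ` whose sign determines positivity. -/
structure CoxD (R Pi : Set V) (ρ : V →ₗ[ℝ] ℝ) (s : V → V ≃ₗ[ℝ] V) : Prop where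
  neg : ∀ β ∈ R, -β ∈ R
  ne : ∀ β ∈ R, ρ β ≠ 0
  sub : ∀ a ∈ Pi, a ∈ R
  pos : ∀ a ∈ Pi, 0 < ρ a
  refl : ∀ a ∈ Pi, ∀ β ∈ R, s a β ∈ R
  perm : ∀ a ∈ Pi, ∀ β ∈ R, 0 < ρ β → β ≠ a → 0 < ρ (s a β)
  self : ∀ a ∈ Pi, s a a = -a
  sq : ∀ a ∈ Pi, s a * s a = 1
  conj : ∀ a ∈ Pi, ∀ b ∈ Pi, ∀ w ∈ Subgroup.closure (s '' Pi), w a = b → w * s a * w⁻¹ = s b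

/-- The inversion set. -/
def Nn (R : Set V) (ρ : V →ₗ[ℝ] ℝ) (w : V ≃ₗ[ℝ] V) : Set V :=
  {β | β ∈ R ∧ 0 < ρ β ∧ ρ (w⁻¹ β) < 0}

theorem inv_app (w : V ≃ₗ[ℝ] V) (v : V) : w⁻¹ (w v) = v := w.symm_apply_apply v
theorem app_inv (w : V ≃ₗ[ℝ] V) (v : V) : w (w⁻¹ v) = v := w.apply_symm_apply v

namespace CoxD

variable {R Pi : Set V} {ρ : V →ₗ[ℝ] ℝ} {s : V → V ≃ₗ[ℝ] V}

theorem sinv (D : CoxD R Pi ρ s) {a : V} (ha : a ∈ Pi) : (s a)⁻¹ = s a :=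
  inv_eq_of_mul_eq_one_left (D.sq a ha)

theorem ss (D : CoxD R Pi ρ s) {a : V} (ha : a ∈ Pi) (v : V) : s a (s a v) = v := by
  rw [← LinearEquiv.mul_apply, D.sq a ha]; rfl

theorem mem_gen {a : V} (ha : a ∈ Pi) : s a ∈ Subgroup.closure (s '' Pi) :=
  Subgroup.subset_closure ⟨a, ha, rfl⟩

theorem word_mem {l : List V} (hl : ∀ a ∈ l, a ∈ Pi) :
    (l.map s).prod ∈ Subgroup.closure (s '' Pi) := by
  apply Subgroup.list_prod_mem
  intro x hx
  obtain ⟨a, ha, rfl⟩ := List.mem_map.1 hx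
  exact mem_gen (hl a ha)

theorem exists_word (D : CoxD R Pi ρ s) {w : V ≃ₗ[ℝ] V} (hw : w ∈ Subgroup.closure (s '' Pi)) :
    ∃ l : List V, (∀ a ∈ l, a ∈ Pi) ∧ (l.map s).prod = w := by
  induction hw using Subgroup.closure_induction with
  | mem x hx =>
    obtain ⟨a, ha, rfl⟩ := hx
    exact ⟨[a], by simpa using ha, by simp⟩
  | one => exact ⟨[], by simp, by simp⟩
  | mul x y _ _ hx hy =>
    obtain ⟨l, hl, rfl⟩ := hx
    obtain ⟨l', hl', rfl⟩ := hy
    refine ⟨l ++ l', ?_, by simp⟩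
    intro a ha
    rcases List.mem_append.1 ha with h | h
    exacts [hl a h, hl' a h]
  | inv x _ hx =>
    obtain ⟨l, hl, rfl⟩ := hx
    refine ⟨l.reverse, by simpa using hl, ?_⟩
    rw [List.prod_inv_reverse, List.map_reverse, List.map_map]
    congr 2
    apply List.map_congr_left
    intro a ha
    simp [D.sinv (hl a ha)]

theorem len_le {l : List V} (hl : ∀ a ∈ l, a ∈ Pi) :
    lenG (s '' Pi) (l.map s).prod ≤ l.length := by
  apply Nat.sInf_le
  refine ⟨l.map s, ?_, by simp, rfl⟩
  intro x hx
  obtain ⟨a, ha, rfl⟩ := List.mem_map.1 hx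
  exact ⟨a, hl a ha, rfl⟩

theorem exists_red (D : CoxD R Pi ρ s) {w : V ≃ₗ[ℝ] V} (hw : w ∈ Subgroup.closure (s '' Pi)) :
    ∃ l : List V, (∀ a ∈ l, a ∈ Pi) ∧ (l.map s).prod = w ∧ l.length = lenG (s '' Pi) w := by
  obtain ⟨l0, hl0, rfl⟩ := D.exists_word hw
  have hne : {n | ∃ l : List (V ≃ₗ[ℝ] V), (∀ x ∈ l, x ∈ s '' Pi) ∧ l.length = n ∧
      l.prod = (l0.map s).prod}.Nonempty := by
    refine ⟨_, l0.map s, ?_, rfl, rfl⟩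
    intro x hx
    obtain ⟨a, ha, rfl⟩ := List.mem_map.1 hx
    exact ⟨a, hl0 a ha, rfl⟩
  obtain ⟨l, hl, hlen, hp⟩ := Nat.sInf_mem hne
  have : ∀ l : List (V ≃ₗ[ℝ] V), (∀ x ∈ l, x ∈ s '' Pi) →
      ∃ l' : List V, (∀ a ∈ l', a ∈ Pi) ∧ l'.map s = l := by
    intro l
    induction l with
    | nil => intro _; exact ⟨[], by simp, rfl⟩
    | cons x t ih =>
      intro h
      obtain ⟨t', ht', rfl⟩ := ih (fun y hy => h y (List.mem_cons_of_mem _ hy))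
      obtain ⟨a, ha, rfl⟩ := h x List.mem_cons_self
      refine ⟨a :: t', ?_, rfl⟩
      intro b hb
      rcases List.mem_cons.1 hb with rfl | hb
      exacts [ha, ht' b hb]
  obtain ⟨l', hl', rfl⟩ := this l hl
  refine ⟨l', hl', hp, ?_⟩
  rw [List.length_map] at hlen
  exact hlen

theorem mapR (D : CoxD R Pi ρ s) {w : V ≃ₗ[ℝ] V} (hw : w ∈ Subgroup.closure (s '' Pi)) {β : V}
    (hβ : β ∈ R) : w β ∈ R := by
  obtain ⟨l, hl, rfl⟩ := D.exists_word hw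
  clear hw
  induction l with
  | nil => simpa using hβ
  | cons a t ih =>
    have ht : ∀ b ∈ t, b ∈ Pi := fun b hb => hl b (List.mem_cons_of_mem _ hb)
    rw [List.map_cons, List.prod_cons, LinearEquiv.mul_apply]
    exact D.refl a (hl a List.mem_cons_self) _ (ih ht)

theorem mapR_inv (D : CoxD R Pi ρ s) {w : V ≃ₗ[ℝ] V} (hw : w ∈ Subgroup.closure (s '' Pi)) {β : V}
    (hβ : β ∈ R) : w⁻¹ β ∈ R := D.mapR (Subgroup.inv_mem _ hw) hβ

theorem exchange (D : CoxD R Pi ρ s) {a : V} (ha : a ∈ Pi) :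
    ∀ l : List V, (∀ b ∈ l, b ∈ Pi) → ρ ((l.map s).prod a) < 0 →
    ∃ l' : List V, (∀ b ∈ l', b ∈ Pi) ∧ l'.length + 1 = l.length ∧
      (l.map s).prod * s a = (l'.map s).prod := by
  intro l
  induction l with
  | nil =>
    intro _ h
    have := D.pos a ha
    simp at h
    linarith
  | cons b t ih =>
    intro hl h
    have ht : ∀ b ∈ t, b ∈ Pi := fun b hb => hl b (List.mem_cons_of_mem _ hb)
    have hb : b ∈ Pi := hl b List.mem_cons_self
    rw [List.map_cons, List.prod_cons, LinearEquiv.mul_apply] at h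
    have hR : (t.map s).prod a ∈ R := D.mapR (word_mem ht) (D.sub a ha)
    rcases lt_or_gt_of_ne (D.ne _ hR) with h1 | h1
    · obtain ⟨l', h2, h3, h4⟩ := ih ht h1
      refine ⟨b :: l', ?_, by simp [h3], ?_⟩
      · intro c hc
        rcases List.mem_cons.1 hc with rfl | hc
        exacts [hb, h2 c hc]
      · simp [mul_assoc, h4]
    · have : (t.map s).prod a = b := by
        by_contra hne
        have := D.perm b hb _ hR h1 hne
        linarith
      have hc := D.conj a ha b hb _ (word_mem ht) this
      refine ⟨t, ht, rfl, ?_⟩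
      rw [List.map_cons, List.prod_cons, ← hc]
      simp only [mul_assoc, inv_mul_cancel_left]
      rw [D.sq a ha, mul_one]

theorem Nn_mul (D : CoxD R Pi ρ s) {w : V ≃ₗ[ℝ] V} (hw : w ∈ Subgroup.closure (s '' Pi)) {a : V}
    (ha : a ∈ Pi) (h : 0 < ρ (w a)) :
    Nn R ρ (w * s a) = insert (w a) (Nn R ρ w) ∧ w a ∉ Nn R ρ w := by
  constructor
  · ext β
    simp only [Nn, Set.mem_ofPred_eq, Set.mem_insert_iff, mul_inv_rev, D.sinv ha,
      LinearEquiv.mul_apply]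
    constructor
    · rintro ⟨h1, h2, h3⟩
      by_cases hβ : w⁻¹ β = a
      · left; rw [← hβ, app_inv]
      · right
        refine ⟨h1, h2, ?_⟩
        have hR := D.mapR_inv hw h1
        rcases lt_or_gt_of_ne (D.ne _ hR) with h4 | h4
        · exact h4
        · have := D.perm a ha _ hR h4 hβ
          linarith
    · rintro (rfl | ⟨h1, h2, h3⟩)
      · refine ⟨D.mapR hw (D.sub a ha), h, ?_⟩
        rw [inv_app, D.self a ha, map_neg]
        linarith [D.pos a ha]
      · refine ⟨h1, h2, ?_⟩
        have hR := D.neg _ (D.mapR_inv hw h1)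
        have h4 : 0 < ρ (-(w⁻¹ β)) := by rw [map_neg]; linarith
        have h5 : -(w⁻¹ β) ≠ a := by
          intro h5
          have : w a = -β := by rw [← h5, map_neg, app_inv]
          rw [this, map_neg] at h
          linarith
        have := D.perm a ha _ hR h4 h5
        rw [map_neg, map_neg] at this
        linarith
  · rintro ⟨_, _, h3⟩
    rw [inv_app] at h3
    linarith [D.pos a ha]

theorem Nn_one : Nn R ρ 1 = ∅ := by
  ext β
  simp only [Nn, Set.mem_ofPred_eq, Set.mem_empty_iff_false, iff_false]
  rintro ⟨_, h1, h2⟩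
  simp at h2
  linarith

theorem len_one : lenG (s '' Pi) 1 = 0 := by
  have := len_le (s := s) (Pi := Pi) (l := []) (by simp)
  simpa using this

theorem len_card (D : CoxD R Pi ρ s) : ∀ (n : ℕ) {w : V ≃ₗ[ℝ] V},
    w ∈ Subgroup.closure (s '' Pi) → lenG (s '' Pi) w = n →
    (Nn R ρ w).Finite ∧ (Nn R ρ w).ncard = n := by
  intro n
  induction n with
  | zero =>
    intro w hw h
    obtain ⟨l, hl, rfl, hlen⟩ := D.exists_red hw
    rw [h] at hlen
    rw [List.length_eq_zero_iff.1 hlen]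
    simp [Nn_one]
  | succ n ih =>
    intro w hw h
    obtain ⟨l, hl, rfl, hlen⟩ := D.exists_red hw
    rw [h] at hlen
    rcases List.eq_nil_or_concat l with rfl | ⟨t, a, rfl⟩
    · simp at hlen
    rw [List.concat_eq_append] at *
    have ht : ∀ b ∈ t, b ∈ Pi := fun b hb => hl b (by simp [hb])
    have ha : a ∈ Pi := hl a (by simp)
    have hR : (t.map s).prod a ∈ R := D.mapR (word_mem ht) (D.sub a ha)
    simp only [List.length_append, List.length_singleton, Nat.add_right_cancel_iff] at hlen
    simp only [List.map_append, List.map_singleton, List.prod_append, List.prod_singleton] at h ⊢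
    rcases lt_or_gt_of_ne (D.ne _ hR) with h1 | h1
    · obtain ⟨l', h2, h3, h4⟩ := D.exchange ha t ht h1
      have := len_le (s := s) h2
      rw [← h4, h] at this
      omega
    · have hlt : lenG (s '' Pi) (t.map s).prod = n := by
        have h5 := len_le (s := s) ht
        obtain ⟨l', h2, h3, h4⟩ := D.exists_red (word_mem ht)
        have h6 := len_le (s := s) (l := l' ++ [a]) (Pi := Pi) (by
          intro b hb
          rcases List.mem_append.1 hb with hb | hb
          · exact h2 b hb
          · rw [List.mem_singleton.1 hb]; exact ha)
        simp only [List.map_append, List.map_singleton, List.prod_append, List.prod_singleton,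
          h3, h, List.length_append, List.length_singleton] at h6
        omega
      obtain ⟨hf, hc⟩ := ih (word_mem ht) hlt
      obtain ⟨e1, e2⟩ := D.Nn_mul (word_mem ht) ha h1
      rw [e1]
      exact ⟨hf.insert _, by rw [Set.ncard_insert_of_notMem e2 hf, hc]⟩

theorem Nn_fin (D : CoxD R Pi ρ s) {w : V ≃ₗ[ℝ] V} (hw : w ∈ Subgroup.closure (s '' Pi)) :
    (Nn R ρ w).Finite := (D.len_card _ hw rfl).1

theorem len_eq (D : CoxD R Pi ρ s) {w : V ≃ₗ[ℝ] V} (hw : w ∈ Subgroup.closure (s '' Pi)) :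
    lenG (s '' Pi) w = (Nn R ρ w).ncard := (D.len_card _ hw rfl).2.symm

theorem eq_one (D : CoxD R Pi ρ s) {w : V ≃ₗ[ℝ] V} (hw : w ∈ Subgroup.closure (s '' Pi))
    (h : Nn R ρ w = ∅) : w = 1 := by
  obtain ⟨l, hl, rfl, hlen⟩ := D.exists_red hw
  rw [D.len_eq hw, h, Set.ncard_empty] at hlen
  rw [List.length_eq_zero_iff.1 hlen]
  rfl

theorem Nn_inj (D : CoxD R Pi ρ s) {w w' : V ≃ₗ[ℝ] V} (hw : w ∈ Subgroup.closure (s '' Pi))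
    (hw' : w' ∈ Subgroup.closure (s '' Pi)) (h : Nn R ρ w = Nn R ρ w') : w = w' := by
  have : w⁻¹ * w' = 1 := by
    apply D.eq_one (Subgroup.mul_mem _ (Subgroup.inv_mem _ hw) hw')
    ext γ
    simp only [Set.mem_empty_iff_false, iff_false]
    rintro ⟨h1, h2, h3⟩
    rw [mul_inv_rev, inv_inv, LinearEquiv.mul_apply] at h3
    have hR := D.mapR hw h1
    rcases lt_or_gt_of_ne (D.ne _ hR) with h4 | h4
    · have : -(w γ) ∈ Nn R ρ w := ⟨D.neg _ hR, by rw [map_neg]; linarith, by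
        rw [map_neg, inv_app, map_neg]; linarith⟩
      rw [h] at this
      have := this.2.2
      rw [map_neg, map_neg] at this
      linarith
    · have : w γ ∈ Nn R ρ w' := ⟨hR, h4, h3⟩
      rw [← h] at this
      have := this.2.2
      rw [inv_app] at this
      linarith
  exact (inv_mul_eq_one.1 this)

theorem len_diff (D : CoxD R Pi ρ s) {x y : V ≃ₗ[ℝ] V} (hx : x ∈ Subgroup.closure (s '' Pi))
    (hy : y ∈ Subgroup.closure (s '' Pi)) :
    lenG (s '' Pi) (x⁻¹ * y) =
      (Nn R ρ x \ Nn R ρ y).ncard + (Nn R ρ y \ Nn R ρ x).ncard := by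
  have hxy := Subgroup.mul_mem _ (Subgroup.inv_mem _ hx) hy
  rw [D.len_eq hxy]
  have e1 : Nn R ρ (x⁻¹ * y) =
      (fun v => x⁻¹ (-v)) '' (Nn R ρ x \ Nn R ρ y) ∪ (fun v => x⁻¹ v) '' (Nn R ρ y \ Nn R ρ x) := by
    ext γ
    constructor
    · rintro ⟨h1, h2, h3⟩
      rw [mul_inv_rev, inv_inv, LinearEquiv.mul_apply] at h3
      have hR := D.mapR hx h1
      rcases lt_or_gt_of_ne (D.ne _ hR) with h4 | h4
      · left
        refine ⟨-(x γ), ⟨⟨D.neg _ hR, by rw [map_neg]; linarith, by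
          rw [map_neg, inv_app, map_neg]; linarith⟩, ?_⟩, by simp [inv_app]⟩
        rintro ⟨_, _, h5⟩
        rw [map_neg, map_neg] at h5
        linarith
      · right
        refine ⟨x γ, ⟨⟨hR, h4, h3⟩, ?_⟩, by simp [inv_app]⟩
        rintro ⟨_, _, h5⟩
        rw [inv_app] at h5
        linarith
    · rintro (⟨β, ⟨⟨h1, h2, h3⟩, h4⟩, rfl⟩ | ⟨β, ⟨⟨h1, h2, h3⟩, h4⟩, rfl⟩)
      · have hy' := D.ne _ (D.mapR_inv hy h1)
        have h5 : 0 < ρ (y⁻¹ β) := by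
          rcases lt_or_gt_of_ne hy' with h6 | h6
          · exact absurd ⟨h1, h2, h6⟩ h4
          · exact h6
        refine ⟨D.mapR_inv hx (D.neg _ h1), ?_, ?_⟩
        · simp only [map_neg]; linarith
        · rw [mul_inv_rev, inv_inv, LinearEquiv.mul_apply, app_inv, map_neg, map_neg]; linarith
      · have hy' := D.ne _ (D.mapR_inv hx h1)
        have h5 : 0 < ρ (x⁻¹ β) := by
          rcases lt_or_gt_of_ne hy' with h6 | h6
          · exact absurd ⟨h1, h2, h6⟩ h4
          · exact h6
        refine ⟨D.mapR_inv hx h1, h5, ?_⟩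
        rw [mul_inv_rev, inv_inv, LinearEquiv.mul_apply, app_inv]; exact h3
  rw [e1, Set.ncard_union_eq ?_ (((D.Nn_fin hx).subset Set.sdiff_subset).image _)
    (((D.Nn_fin hy).subset Set.sdiff_subset).image _), Set.ncard_image_of_injective,
    Set.ncard_image_of_injective]
  · exact (x⁻¹).injective
  · intro a b hab
    exact neg_injective ((x⁻¹).injective hab)
  · rw [Set.disjoint_left]
    rintro _ ⟨β, ⟨⟨h1, h2, h3⟩, h4⟩, rfl⟩ ⟨β', ⟨⟨h1', h2', h3'⟩, h4'⟩, h5⟩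
    have := (x⁻¹).injective h5
    rw [this, map_neg] at h2'
    linarith

theorem len_sub_iff (D : CoxD R Pi ρ s) {x y : V ≃ₗ[ℝ] V} (hx : x ∈ Subgroup.closure (s '' Pi))
    (hy : y ∈ Subgroup.closure (s '' Pi)) :
    Nn R ρ x ⊆ Nn R ρ y ↔ lenG (s '' Pi) (x⁻¹ * y) + lenG (s '' Pi) x = lenG (s '' Pi) y := by
  rw [D.len_diff hx hy, D.len_eq hx, D.len_eq hy]
  have fx := D.Nn_fin hx
  have fy := D.Nn_fin hy
  have h1 := Set.ncard_sdiff_add_ncard (Nn R ρ y) (Nn R ρ x) fy fx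
  have h2 := Set.ncard_sdiff_add_ncard (Nn R ρ x) (Nn R ρ y) fx fy
  rw [Set.union_comm] at h2
  constructor
  · intro h
    rw [Set.sdiff_eq_empty.2 h] at h2 ⊢
    simp at h2 ⊢
    omega
  · intro h
    have : (Nn R ρ x \ Nn R ρ y).ncard = 0 := by omega
    rw [Set.ncard_eq_zero (fx.subset Set.sdiff_subset)] at this
    exact Set.sdiff_eq_empty.1 this

theorem orbit (D : CoxD R Pi ρ s) : ∀ l : List V, (∀ b ∈ l, b ∈ Pi) → ∀ β ∈ R, 0 < ρ β →
    ρ ((l.map s).prod⁻¹ β) < 0 → ∃ w ∈ Subgroup.closure (s '' Pi), ∃ a ∈ Pi, β = w a := by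
  intro l
  induction l with
  | nil => intro _ β _ h1 h2; simp at h2; linarith
  | cons b t ih =>
    intro hl β hR h1 h2
    have ht : ∀ b ∈ t, b ∈ Pi := fun b hb => hl b (List.mem_cons_of_mem _ hb)
    have hb : b ∈ Pi := hl b List.mem_cons_self
    rw [List.map_cons, List.prod_cons, mul_inv_rev, LinearEquiv.mul_apply, D.sinv hb] at h2
    by_cases hβ : β = b
    · exact ⟨1, Subgroup.one_mem _, b, hb, by simp [hβ]⟩
    · obtain ⟨w, hw, a, ha, e⟩ := ih ht _ (D.refl b hb β hR) (D.perm b hb β hR h1 hβ) h2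
      refine ⟨s b * w, Subgroup.mul_mem _ (mem_gen hb) hw, a, ha, ?_⟩
      rw [LinearEquiv.mul_apply, ← e, D.ss hb]

end CoxD

/-- Extra data: an ambient set `A` of positive (real and imaginary) roots. -/
structure BicD (R Pi : Set V) (ρ : V →ₗ[ℝ] ℝ) (s : V → V ≃ₗ[ℝ] V) (A : Set V) : Prop
    extends CoxD R Pi ρ s where
  realA : ∀ β ∈ R, 0 < ρ β → β ∈ A
  posA : ∀ x ∈ A, 0 < ρ x
  imA : ∀ x ∈ A, x ∉ R → ∀ a ∈ Pi, s a x = x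
  dec : ∀ β ∈ R, 0 < ρ β → β ∉ Pi → ∃ x ∈ A, ∃ y ∈ A, x + y = β

namespace BicD

variable {R Pi A : Set V} {ρ : V →ₗ[ℝ] ℝ} {s : V → V ≃ₗ[ℝ] V}

theorem exists_simple (D : BicD R Pi ρ s A) {F : Set V} (hf : F.Finite) (hR : F ⊆ R)
    (hb : BiconvexIn A F) (hne : F.Nonempty) : ∃ a ∈ Pi, a ∈ F := by
  obtain ⟨β, hβ, hmin⟩ := Set.exists_min_image F ρ hf hne
  by_cases h : β ∈ Pi
  · exact ⟨β, h, hβ⟩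
  exfalso
  have hA := hb.1.1 hβ
  obtain ⟨x, hx, y, hy, e⟩ := D.dec β (hR hβ) (D.posA _ hA) h
  have px := D.posA _ hx
  have py := D.posA _ hy
  have e' : ρ x + ρ y = ρ β := by rw [← e, map_add]
  have nx : x ∉ F := fun hh => by have := hmin x hh; linarith
  have ny : y ∉ F := fun hh => by have := hmin y hh; linarith
  have := hb.2.2 x ⟨hx, nx⟩ y ⟨hy, ny⟩ (by rw [e]; exact hA)
  rw [e] at this
  exact this.2 hβ

theorem sA (D : BicD R Pi ρ s A) {a x : V} (ha : a ∈ Pi) (hx : x ∈ A) (hne : x ≠ a) :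
    s a x ∈ A ∧ s a x ≠ a := by
  have h1 : s a x ∈ A := by
    by_cases hR : x ∈ R
    · exact D.realA _ (D.refl a ha x hR) (D.perm a ha x hR (D.posA x hx) hne)
    · rw [D.imA x hx hR a ha]; exact hx
  refine ⟨h1, fun h => ?_⟩
  have h2 : x = -a := by rw [← D.ss ha x, h, D.self a ha]
  have := D.posA x hx
  rw [h2, map_neg] at this
  linarith [D.pos a ha]

theorem simple_indec (D : BicD R Pi ρ s A) {a x y : V} (ha : a ∈ Pi) (hx : x ∈ A) (hy : y ∈ A) :
    x + y ≠ a := by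
  intro h
  have pa := D.pos a ha
  have px := D.posA x hx
  have py := D.posA y hy
  have hxa : x ≠ a := by rintro rfl; simp at h; rw [h] at py; simp at py
  have hya : y ≠ a := by rintro rfl; simp at h; rw [h] at px; simp at px
  have h1 := D.posA _ (D.sA ha hx hxa).1
  have h2 := D.posA _ (D.sA ha hy hya).1
  have h3 : ρ (s a x) + ρ (s a y) = - ρ a := by
    rw [← map_add, ← map_add, h, D.self a ha, map_neg]
  linarith

theorem reflect (D : BicD R Pi ρ s A) {F : Set V} (hb : BiconvexIn A F) {a : V} (ha : a ∈ Pi)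
    (haF : a ∈ F) : BiconvexIn A (s a '' (F \ {a})) := by
  have mem : ∀ x, x ∈ s a '' (F \ {a}) ↔ s a x ∈ F ∧ s a x ≠ a := by
    intro x
    constructor
    · rintro ⟨y, ⟨hy, hya⟩, rfl⟩
      rw [D.ss ha]; exact ⟨hy, hya⟩
    · rintro ⟨h1, h2⟩
      exact ⟨s a x, ⟨h1, h2⟩, D.ss ha x⟩
  have pa := D.pos a ha
  refine ⟨⟨?_, ?_⟩, Set.sdiff_subset, ?_⟩
  · intro x hx
    obtain ⟨y, ⟨hy, hya⟩, rfl⟩ := hx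
    exact (D.sA ha (hb.1.1 hy) hya).1
  · intro x hx y hy hA
    rw [mem] at hx hy ⊢
    have hxA : x ∈ A := by
      have := (D.sA ha (hb.1.1 hx.1) hx.2).1
      rwa [D.ss ha] at this
    have hyA : y ∈ A := by
      have := (D.sA ha (hb.1.1 hy.1) hy.2).1
      rwa [D.ss ha] at this
    have h1 := D.sA ha hA (D.simple_indec ha hxA hyA)
    refine ⟨?_, h1.2⟩
    rw [map_add] at h1 ⊢
    exact hb.1.2 _ hx.1 _ hy.1 h1.1
  · intro x hx y hy hA
    refine ⟨hA, fun hF => ?_⟩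
    rw [mem] at hF
    have key : ∀ y, y ∈ A \ s a '' (F \ {a}) → a + y ∈ A → s a (a + y) ∈ F ∧ s a (a + y) ≠ a →
        False := by
      intro y hy hA hF
      have hya : y ≠ a := by
        rintro rfl
        have := D.posA _ (hb.1.1 hF.1)
        rw [map_add, D.self _ ha, map_add, map_neg] at this
        linarith
      have h1 := D.sA ha hy.1 hya
      have h2 : s a (a + y) + a = s a y := by rw [map_add, D.self _ ha]; abel
      have h3 := hb.1.2 _ hF.1 _ haF (by rw [h2]; exact h1.1)
      rw [h2] at h3
      exact hy.2 ((mem y).2 ⟨h3, h1.2⟩)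
    by_cases hxa : x = a
    · subst hxa; exact key y hy hA hF
    by_cases hya : y = a
    · subst hya; rw [add_comm] at hA hF; exact key x hx hA hF
    have h1 := D.sA ha hx.1 hxa
    have h2 := D.sA ha hy.1 hya
    have h3 := D.sA ha hA (D.simple_indec ha hx.1 hy.1)
    have nx : s a x ∉ F := fun h => hx.2 ((mem x).2 ⟨h, h1.2⟩)
    have ny : s a y ∉ F := fun h => hy.2 ((mem y).2 ⟨h, h2.2⟩)
    have := hb.2.2 _ ⟨h1.1, nx⟩ _ ⟨h2.1, ny⟩ (by rw [← map_add]; exact h3.1)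
    rw [← map_add] at this
    exact this.2 hF.1

theorem finite_bic (D : BicD R Pi ρ s A) : ∀ (n : ℕ) (F : Set V), F.Finite → F.ncard = n →
    F ⊆ R → BiconvexIn A F → ∃ w ∈ Subgroup.closure (s '' Pi), Nn R ρ w = F := by
  intro n
  induction n with
  | zero =>
    intro F hf hc _ _
    rw [Set.ncard_eq_zero hf] at hc
    exact ⟨1, Subgroup.one_mem _, by rw [hc, CoxD.Nn_one]⟩
  | succ n ih =>
    intro F hf hc hR hb
    have hne : F.Nonempty := by
      rw [Set.nonempty_iff_ne_empty]; rintro rfl; simp at hc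
    obtain ⟨a, ha, haF⟩ := D.exists_simple hf hR hb hne
    have hfd : (F \ {a}).Finite := hf.subset Set.sdiff_subset
    obtain ⟨w, hw, e⟩ := ih (s a '' (F \ {a})) (hfd.image _) (by
        rw [Set.ncard_image_of_injective _ (s a).injective, Set.ncard_sdiff_singleton_of_mem haF, hc]
        rfl) (by
        rintro _ ⟨y, hy, rfl⟩
        exact D.refl a ha _ (hR hy.1)) (D.reflect hb ha haF)
    refine ⟨s a * w, Subgroup.mul_mem _ (CoxD.mem_gen ha) hw, ?_⟩
    ext β
    constructor
    · rintro ⟨h1, h2, h3⟩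
      by_cases hβ : β = a
      · rw [hβ]; exact haF
      rw [mul_inv_rev, LinearEquiv.mul_apply, D.sinv ha] at h3
      have : s a β ∈ Nn R ρ w := ⟨D.refl a ha β h1, D.perm a ha β h1 h2 hβ, h3⟩
      rw [e] at this
      obtain ⟨y, hy, hy2⟩ := this
      rw [← (s a).injective hy2]; exact hy.1
    · intro hβ
      have hpos := D.posA _ (hb.1.1 hβ)
      refine ⟨hR hβ, hpos, ?_⟩
      rw [mul_inv_rev, LinearEquiv.mul_apply, D.sinv ha]
      by_cases hβa : β = a
      · subst hβa
        rw [D.self _ ha, map_neg, map_neg]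
        have hR' := D.mapR_inv hw (hR hβ)
        rcases lt_or_gt_of_ne (D.ne _ hR') with h4 | h4
        · exfalso
          have : β ∈ Nn R ρ w := ⟨hR hβ, hpos, h4⟩
          rw [e] at this
          obtain ⟨y, hy, hy2⟩ := this
          have h5 : y = -β := by rw [← D.ss ha y, hy2, D.self _ ha]
          have := D.posA _ (hb.1.1 hy.1)
          rw [h5, map_neg] at this
          linarith
        · linarith
      · have : s a β ∈ Nn R ρ w := by rw [e]; exact ⟨β, ⟨hβ, hβa⟩, rfl⟩
        exact this.2.2

theorem half_bic (D : BicD R Pi ρ s A) (φ : V →ₗ[ℝ] ℝ) (hφ : ∀ x ∈ A, x ∉ R → 0 ≤ φ x) :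
    BiconvexIn A {β | β ∈ R ∧ 0 < ρ β ∧ φ β < 0} := by
  refine ⟨⟨fun β h => D.realA _ h.1 h.2.1, ?_⟩, Set.sdiff_subset, ?_⟩
  · rintro x ⟨_, _, hx⟩ y ⟨_, _, hy⟩ hA
    have h1 : φ (x + y) < 0 := by rw [map_add]; linarith
    refine ⟨?_, D.posA _ hA, h1⟩
    by_contra hn
    linarith [hφ _ hA hn]
  · have key : ∀ x ∈ A \ {β | β ∈ R ∧ 0 < ρ β ∧ φ β < 0}, 0 ≤ φ x := by
      rintro x ⟨hx, hn⟩
      by_cases hR : x ∈ R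
      · by_contra h
        exact hn ⟨hR, D.posA _ hx, not_le.1 h⟩
      · exact hφ x hx hR
    intro x hx y hy hA
    refine ⟨hA, ?_⟩
    rintro ⟨_, _, h⟩
    rw [map_add] at h
    linarith [key x hx, key y hy]

theorem fix_im (D : BicD R Pi ρ s A) {w : V ≃ₗ[ℝ] V} (hw : w ∈ Subgroup.closure (s '' Pi))
    {x : V} (hx : x ∈ A) (hn : x ∉ R) : w x = x := by
  obtain ⟨l, hl, rfl⟩ := D.exists_word hw
  clear hw
  induction l with
  | nil => simp
  | cons b t ih =>
    rw [List.map_cons, List.prod_cons, LinearEquiv.mul_apply,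
      ih (fun c hc => hl c (List.mem_cons_of_mem _ hc)), D.imA x hx hn b (hl b List.mem_cons_self)]

theorem Nn_bic (D : BicD R Pi ρ s A) {w : V ≃ₗ[ℝ] V} (hw : w ∈ Subgroup.closure (s '' Pi)) :
    BiconvexIn A (Nn R ρ w) := by
  apply D.half_bic (ρ ∘ₗ (w⁻¹ : V ≃ₗ[ℝ] V).toLinearMap)
  intro x hx hn
  have : w⁻¹ x = x := D.fix_im (Subgroup.inv_mem _ hw) hx hn
  simp only [LinearMap.comp_apply, LinearEquiv.coe_coe, this]
  exact (D.posA x hx).le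

end BicD

namespace CoxD

variable {R Pi : Set V} {ρ : V →ₗ[ℝ] ℝ} {s : V → V ≃ₗ[ℝ] V}

theorem zwA_succ (f : ℕ → V) (p : ℕ) : zwA s f (p + 1) = zwA s f p * s (f p) := by
  simp [zwA, List.range_succ]

theorem zwA_zero (f : ℕ → V) : zwA s f 0 = 1 := by simp [zwA]

theorem zwA_mem {f : ℕ → V} (hf : ∀ p, f p ∈ Pi) (p : ℕ) :
    zwA s f p ∈ Subgroup.closure (s '' Pi) := by
  induction p with
  | zero => rw [zwA_zero]; exact Subgroup.one_mem _
  | succ p ih => rw [zwA_succ]; exact Subgroup.mul_mem _ ih (mem_gen (hf p))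

theorem irw_pos (D : CoxD R Pi ρ s) {f : ℕ → V} (hf : ∀ p, f p ∈ Pi)
    (hl : ∀ p, lenG (s '' Pi) (zwA s f p) = p) (p : ℕ) : 0 < ρ (zwA s f p (f p)) := by
  have hm := zwA_mem hf p (s := s)
  have hR := D.mapR hm (D.sub _ (hf p))
  rcases lt_or_gt_of_ne (D.ne _ hR) with h | h
  · exfalso
    have e : zwA s f (p + 1) * s (f p) = zwA s f p := by
      rw [zwA_succ, mul_assoc, D.sq _ (hf p), mul_one]
    have h1 : 0 < ρ (zwA s f (p + 1) (f p)) := by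
      rw [zwA_succ, LinearEquiv.mul_apply, D.self _ (hf p), map_neg, map_neg]; linarith
    obtain ⟨e1, e2⟩ := D.Nn_mul (zwA_mem hf (p + 1)) (hf p) h1
    rw [e] at e1
    have h2 := D.len_eq hm
    rw [e1, Set.ncard_insert_of_notMem e2 (D.Nn_fin (zwA_mem hf _)), ← D.len_eq (zwA_mem hf _),
      hl, hl] at h2
    omega
  · exact h

theorem irw_mono (D : CoxD R Pi ρ s) {f : ℕ → V} (hf : ∀ p, f p ∈ Pi)
    (hl : ∀ p, lenG (s '' Pi) (zwA s f p) = p) : Monotone (fun p => Nn R ρ (zwA s f p)) := by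
  apply monotone_nat_of_le_succ
  intro p
  rw [zwA_succ, (D.Nn_mul (zwA_mem hf p) (hf p) (D.irw_pos hf hl p)).1]
  exact Set.subset_insert _ _

theorem infinite_word (D : CoxD R Pi ρ s) (w : ℕ → V ≃ₗ[ℝ] V)
    (hw : ∀ n, w n ∈ Subgroup.closure (s '' Pi)) (h0 : w 0 = 1)
    (hmono : ∀ n, Nn R ρ (w n) ⊆ Nn R ρ (w (n + 1))) (hinf : (⋃ n, Nn R ρ (w n)).Infinite) :
    ∃ f : ℕ → V, (∀ p, f p ∈ Pi) ∧ (∀ p, lenG (s '' Pi) (zwA s f p) = p) ∧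
      (⋃ p, Nn R ρ (zwA s f p)) = ⋃ n, Nn R ρ (w n) := by
  have hmon : Monotone (fun n => Nn R ρ (w n)) := monotone_nat_of_le_succ hmono
  choose r hr1 hr2 hr3 using fun n => D.exists_red
    (Subgroup.mul_mem _ (Subgroup.inv_mem _ (hw n)) (hw (n + 1)))
  let L : ℕ → List V := fun n => Nat.rec [] (fun n l => l ++ r n) n
  have L0 : L 0 = [] := rfl
  have L1 : ∀ n, L (n + 1) = L n ++ r n := fun n => rfl
  have Lpi : ∀ n, ∀ a ∈ L n, a ∈ Pi := by
    intro n
    induction n with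
    | zero => simp [L0]
    | succ n ih =>
      intro a ha
      rw [L1] at ha
      rcases List.mem_append.1 ha with h | h
      exacts [ih a h, hr1 n a h]
  have Lprod : ∀ n, ((L n).map s).prod = w n := by
    intro n
    induction n with
    | zero => simp [L0, h0]
    | succ n ih => rw [L1, List.map_append, List.prod_append, ih, hr2]; group
  have Llen : ∀ n, (L n).length = lenG (s '' Pi) (w n) := by
    intro n
    induction n with
    | zero => rw [L0, h0, len_one]; rfl
    | succ n ih =>
      rw [L1, List.length_append, ih, hr3, add_comm]
      exact (D.len_sub_iff (hw n) (hw (n + 1))).1 (hmono n)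
  have Lpre : ∀ m n, m ≤ n → L m <+: L n := by
    intro m n hmn
    induction n, hmn using Nat.le_induction with
    | base => exact List.prefix_rfl
    | succ n _ ih => rw [L1]; exact ih.trans (List.prefix_append _ _)
  have Lbig : ∀ k, ∃ n, k < (L n).length := by
    by_contra hcon
    push Not at hcon
    obtain ⟨k, hk⟩ := hcon
    obtain ⟨T, hT, hTc⟩ := hinf.exists_subset_card_eq (k + 1)
    have : ∃ n, (T : Set V) ⊆ Nn R ρ (w n) := by
      have := DirectedOn.exists_mem_subset_of_finset_subset_biUnion (ι := ℕ) (c := Set.univ)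
        (f := fun n => Nn R ρ (w n)) (s := T) Set.univ_nonempty
        (by
          intro a _ b _
          exact ⟨max a b, Set.mem_univ _, hmon (le_max_left _ _), hmon (le_max_right _ _)⟩)
        (by simpa using hT)
      obtain ⟨n, _, hn⟩ := this
      exact ⟨n, hn⟩
    obtain ⟨n, hn⟩ := this
    have h1 := Set.ncard_le_ncard hn (D.Nn_fin (hw n))
    rw [← D.len_eq (hw n), ← Llen, Set.ncard_coe_finset, hTc] at h1
    have := hk n
    omega
  choose N hN using Lbig
  let f : ℕ → V := fun k => (L (N k))[k]'(hN k)
  have fget : ∀ n k (hk : k < (L n).length), (L n)[k] = f k := by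
    intro n k hk
    rcases le_total n (N k) with h | h
    · exact (Lpre _ _ h).getElem hk
    · exact ((Lpre _ _ h).getElem (hN k)).symm
  have ftake : ∀ n p, p ≤ (L n).length → (List.range p).map f = (L n).take p := by
    intro n p hp
    apply List.ext_getElem
    · simp [hp]
    · intro i h1 h2
      simp only [List.length_map, List.length_range] at h1
      simp only [List.getElem_map, List.getElem_range, List.getElem_take]
      exact (fget n i (by omega)).symm
  have hf : ∀ p, f p ∈ Pi := fun p => Lpi (N p) _ (List.getElem_mem _)
  have zt : ∀ n p, p ≤ (L n).length → zwA s f p = (((L n).take p).map s).prod := by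
    intro n p hp
    rw [← ftake n p hp, List.map_map]; rfl
  have zfull : ∀ n, zwA s f (L n).length = w n := by
    intro n
    rw [zt n _ le_rfl, List.take_length, Lprod]
  have hlen : ∀ p, lenG (s '' Pi) (zwA s f p) = p := by
    intro p
    have hp : p ≤ (L (N p)).length := (hN p).le
    have hle : ∀ q ≤ p, True := fun _ _ => trivial
    rw [zt (N p) p hp]
    apply le_antisymm
    · refine (len_le (s := s) (Pi := Pi) (fun a ha => Lpi (N p) a (List.mem_of_mem_take ha))).trans ?_
      simp
    · obtain ⟨l', h1, h2, h3⟩ := D.exists_red (word_mem (s := s) (l := (L (N p)).take p)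
        (fun a ha => Lpi (N p) a (List.mem_of_mem_take ha)))
      have h4 := len_le (s := s) (Pi := Pi) (l := l' ++ (L (N p)).drop p) (by
        intro a ha
        rcases List.mem_append.1 ha with h | h
        exacts [h1 a h, Lpi (N p) a (List.mem_of_mem_drop h)])
      rw [List.map_append, List.prod_append, h2, ← List.prod_append, ← List.map_append,
        List.take_append_drop, Lprod, ← Llen, List.length_append, List.length_drop, h3] at h4
      omega
  refine ⟨f, hf, hlen, ?_⟩
  have zm := D.irw_mono hf hlen
  apply Set.Subset.antisymm
  · apply Set.iUnion_subset
    intro p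
    refine Set.Subset.trans (zm (hN p).le) ?_
    simp only [zfull]
    exact Set.subset_iUnion (fun n => Nn R ρ (w n)) _
  · apply Set.iUnion_subset
    intro n
    rw [← zfull n]
    exact Set.subset_iUnion (fun p => Nn R ρ (zwA s f p)) _

/-- The equivalence of infinite reduced words is equality of inversion sets. -/
theorem rel_iff (D : CoxD R Pi ρ s) {f g : ℕ → V} (hf : ∀ p, f p ∈ Pi)
    (hl : ∀ p, lenG (s '' Pi) (zwA s f p) = p) (hg : ∀ p, g p ∈ Pi)
    (hl' : ∀ p, lenG (s '' Pi) (zwA s g p) = p) :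
    (∀ p q : ℕ, ∃ p₀ ≥ p, ∃ q₀ ≥ q,
      lenG (s '' Pi) ((zwA s f p)⁻¹ * zwA s g p₀) = p₀ - p ∧
      lenG (s '' Pi) ((zwA s g q)⁻¹ * zwA s f q₀) = q₀ - q) ↔
    (⋃ p, Nn R ρ (zwA s f p)) = ⋃ p, Nn R ρ (zwA s g p) := by
  have key : ∀ f g : ℕ → V, (∀ p, f p ∈ Pi) → (∀ p, lenG (s '' Pi) (zwA s f p) = p) →
      (∀ p, g p ∈ Pi) → (∀ p, lenG (s '' Pi) (zwA s g p) = p) →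
      ∀ p q, p ≤ q → (lenG (s '' Pi) ((zwA s f p)⁻¹ * zwA s g q) = q - p ↔
        Nn R ρ (zwA s f p) ⊆ Nn R ρ (zwA s g q)) := by
    intro f g hf hl hg hl' p q hpq
    rw [D.len_sub_iff (zwA_mem hf p) (zwA_mem hg q), hl, hl']
    omega
  have ex : ∀ f g : ℕ → V, (∀ p, f p ∈ Pi) → (∀ p, g p ∈ Pi) →
      (∀ p, lenG (s '' Pi) (zwA s g p) = p) →
      (⋃ p, Nn R ρ (zwA s f p)) ⊆ (⋃ p, Nn R ρ (zwA s g p)) →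
      ∀ p, ∃ q ≥ p, Nn R ρ (zwA s f p) ⊆ Nn R ρ (zwA s g q) := by
    intro f g hf hg hl' hsub p
    have hmon := D.irw_mono hg hl'
    have hfin := D.Nn_fin (zwA_mem (s := s) hf p)
    have hs : ((hfin.toFinset : Finset V) : Set V) ⊆ ⋃ q ∈ (Set.univ : Set ℕ), Nn R ρ (zwA s g q) := by
      rw [Set.Finite.coe_toFinset]
      simpa using (Set.subset_iUnion (fun p => Nn R ρ (zwA s f p)) p).trans hsub
    obtain ⟨q, _, hq⟩ := DirectedOn.exists_mem_subset_of_finset_subset_biUnion (ι := ℕ)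
      (c := Set.univ) (f := fun n => Nn R ρ (zwA s g n)) Set.univ_nonempty
        (by
          intro a _ b _
          exact ⟨max a b, Set.mem_univ _, hmon (le_max_left _ _), hmon (le_max_right _ _)⟩) hs
    rw [Set.Finite.coe_toFinset] at hq
    exact ⟨max p q, le_max_left _ _, hq.trans (hmon (le_max_right _ _))⟩
  constructor
  · intro h
    apply Set.Subset.antisymm
    · apply Set.iUnion_subset
      intro p
      obtain ⟨p₀, h1, _, _, h2, _⟩ := h p 0
      exact ((key f g hf hl hg hl' p p₀ h1).1 h2).trans
        (Set.subset_iUnion (fun p => Nn R ρ (zwA s g p)) p₀)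
    · apply Set.iUnion_subset
      intro q
      obtain ⟨_, _, q₀, h1, _, h2⟩ := h 0 q
      exact ((key g f hg hl' hf hl q q₀ h1).1 h2).trans
        (Set.subset_iUnion (fun p => Nn R ρ (zwA s f p)) q₀)
  · intro h p q
    obtain ⟨p₀, h1, h2⟩ := ex f g hf hg hl' h.subset p
    obtain ⟨q₀, h3, h4⟩ := ex g f hg hf hl h.symm.subset q
    exact ⟨p₀, h1, q₀, h3, (key f g hf hl hg hl' p p₀ h1).2 h2, (key g f hg hl' hf hl q q₀ h3).2 h4⟩

end CoxD

namespace AffineSetup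

variable {α : ι → V} {δ θ : V} {B : V →ₗ[ℝ] V →ₗ[ℝ] ℝ} {s : V → V ≃ₗ[ℝ] V}

theorem iso (h : AffineSetup α δ θ B s) {a : V} (ha : B a a ≠ 0) (x y : V) :
    B (s a x) (s a y) = B x y := by
  rw [h.refl_def a ha, h.refl_def a ha]
  simp only [map_sub, map_smul, LinearMap.sub_apply, LinearMap.smul_apply, smul_eq_mul]
  rw [h.Bsymm a y]
  field_simp
  ring

theorem self (h : AffineSetup α δ θ B s) {a : V} (ha : B a a ≠ 0) : s a a = -a := by
  rw [h.refl_def a ha, mul_div_assoc, div_self ha, mul_one, two_smul]; abel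

theorem sq (h : AffineSetup α δ θ B s) {a : V} (ha : B a a ≠ 0) : s a * s a = 1 := by
  ext v
  rw [LinearEquiv.mul_apply, h.refl_def a ha v, map_sub, map_smul, h.self ha, h.refl_def a ha v]
  simp

theorem conj_gen (h : AffineSetup α δ θ B s) {g : V ≃ₗ[ℝ] V} (hg : ∀ x y, B (g x) (g y) = B x y)
    {a : V} (ha : B a a ≠ 0) : g * s a * g⁻¹ = s (g a) := by
  ext v
  rw [LinearEquiv.mul_apply, LinearEquiv.mul_apply, h.refl_def a ha,
    h.refl_def (g a) (by rwa [hg]), map_sub, map_smul, app_inv, hg, ← hg (g⁻¹ v) a, app_inv]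

theorem clos_iso (h : AffineSetup α δ θ B s) {X : Set V} (hX : ∀ a ∈ X, B a a ≠ 0)
    {g : V ≃ₗ[ℝ] V} (hg : g ∈ Subgroup.closure (s '' X)) : ∀ x y, B (g x) (g y) = B x y := by
  induction hg using Subgroup.closure_induction with
  | mem x hx => obtain ⟨a, ha, rfl⟩ := hx; exact h.iso (hX a ha)
  | one => intro x y; rfl
  | mul g g' _ _ h1 h2 => intro x y; rw [LinearEquiv.mul_apply, LinearEquiv.mul_apply, h1, h2]
  | inv g _ h1 => intro x y; rw [← h1, app_inv, app_inv]

theorem WoJ_eq (J : Set ι) : WoJ α s J = Subgroup.closure (s '' (α '' J)) := by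
  rw [WoJ, Set.image_image]

theorem WoJ_mono {J K : Set ι} (hK : K ⊆ J) : WoJ α s K ≤ WoJ α s J :=
  Subgroup.closure_mono (Set.image_mono hK)

theorem DeloJ_mono {J K : Set ι} (hK : K ⊆ J) : DeloJ α s K ⊆ DeloJ α s J := by
  rintro v ⟨g, hg, j, hj, rfl⟩
  exact ⟨g, WoJ_mono hK hg, j, hK hj, rfl⟩

theorem DeloJ_sub (J : Set ι) : DeloJ α s J ⊆ Delo α s := DeloJ_mono (Set.subset_univ J)

theorem simple_mem {J : Set ι} {j : ι} (hj : j ∈ J) : α j ∈ DeloJ α s J :=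
  ⟨1, Subgroup.one_mem _, j, hj, rfl⟩

theorem simple_memo (j : ι) : α j ∈ Delo α s := simple_mem (Set.mem_univ j)

theorem WoJ_app {J : Set ι} {g : V ≃ₗ[ℝ] V} (hg : g ∈ WoJ α s J) {v : V} (hv : v ∈ DeloJ α s J) :
    g v ∈ DeloJ α s J := by
  obtain ⟨g', hg', j, hj, rfl⟩ := hv
  exact ⟨g * g', Subgroup.mul_mem _ hg hg', j, hj, rfl⟩

theorem WoJ_gen {J : Set ι} {j : ι} (hj : j ∈ J) : s (α j) ∈ WoJ α s J :=
  Subgroup.subset_closure ⟨j, hj, rfl⟩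

theorem nz (h : AffineSetup α δ θ B s) {v : V} (hv : v ∈ Delo α s) : B v v ≠ 0 := (h.Bpos v hv).ne'

theorem WoJ_iso (h : AffineSetup α δ θ B s) {J : Set ι} {g : V ≃ₗ[ℝ] V} (hg : g ∈ WoJ α s J) :
    ∀ x y, B (g x) (g y) = B x y := by
  rw [WoJ_eq] at hg
  refine h.clos_iso ?_ hg
  rintro _ ⟨j, _, rfl⟩
  exact h.nz (simple_memo j)

theorem neg_mem (h : AffineSetup α δ θ B s) {J : Set ι} {v : V} (hv : v ∈ DeloJ α s J) :
    -v ∈ DeloJ α s J := by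
  obtain ⟨g, hg, j, hj, rfl⟩ := hv
  refine ⟨g * s (α j), Subgroup.mul_mem _ hg (WoJ_gen hj), j, hj, ?_⟩
  rw [LinearEquiv.mul_apply, h.self (h.nz (simple_memo j)), map_neg]

theorem srefl_mem (h : AffineSetup α δ θ B s) {J : Set ι} {v : V} (hv : v ∈ DeloJ α s J) :
    s v ∈ WoJ α s J := by
  obtain ⟨g, hg, j, hj, rfl⟩ := hv
  rw [← h.conj_gen (h.WoJ_iso hg) (h.nz (simple_memo j))]
  exact Subgroup.mul_mem _ (Subgroup.mul_mem _ hg (WoJ_gen hj)) (Subgroup.inv_mem _ hg)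

theorem srefl_app (h : AffineSetup α δ θ B s) {J : Set ι} {v w : V} (hv : v ∈ DeloJ α s J)
    (hw : w ∈ DeloJ α s J) : s v w ∈ DeloJ α s J := WoJ_app (h.srefl_mem hv) hw

theorem expand (h : AffineSetup α δ θ B s) {v : V} (hv : v ∈ Delo α s) :
    ∃ c : ι → ℝ, ((∀ i, 0 ≤ c i) ∨ (∀ i, c i ≤ 0)) ∧ v = ∑ i, c i • α i := by
  rcases Xor.or (h.base v hv) with ⟨c, h1, h2⟩ | ⟨c, h1, h2⟩
  · exact ⟨c, Or.inl h1, h2⟩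
  · refine ⟨fun i => - c i, Or.inr (fun i => by simpa using h1 i), ?_⟩
    rw [← neg_neg v, h2, ← Finset.sum_neg_distrib]
    simp

theorem delta_root (h : AffineSetup α δ θ B s) {v : V} (hv : v ∈ Delo α s) : B δ v = 0 := by
  obtain ⟨c, _, rfl⟩ := h.expand hv
  simp [h.delta_orth]

theorem B_real (h : AffineSetup α δ θ B s) {v : V} (hv : v ∈ Delo α s) (m : ℤ) :
    B (m • δ + v) (m • δ + v) = B v v := by
  have e : (m • δ : V) = (m : ℝ) • δ := (Int.cast_smul_eq_zsmul ℝ m δ).symm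
  rw [e]
  simp only [map_add, map_smul, LinearMap.add_apply, LinearMap.smul_apply, smul_eq_mul,
    h.delta_null, h.delta_root hv, h.Bsymm v δ]
  ring

end AffineSetup

/-- Derived data: coordinate functionals and a positive semidefinite form. -/
structure Ctx (α : ι → V) (δ : V) (s : V → V ≃ₗ[ℝ] V) where
  C : V →ₗ[ℝ] V →ₗ[ℝ] ℝ
  d : V →ₗ[ℝ] ℝ
  e : ι → V →ₗ[ℝ] ℝ
  d_delta : d δ = 1
  d_alpha : ∀ i, d (α i) = 0
  e_delta : ∀ i, e i δ = 0
  e_same : ∀ i, e i (α i) = 1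
  e_diff : ∀ i j, i ≠ j → e i (α j) = 0
  C_symm : ∀ x y, C x y = C y x
  C_nonneg : ∀ x, 0 ≤ C x x
  C_delta : ∀ x, C δ x = 0
  C_pos : ∀ v ∈ Delo α s, 0 < C v v
  refl : ∀ ε ∈ Delo α s, ∀ η ∈ Delo α s, ∀ m n : ℤ, s (m • δ + ε) (n • δ + η) =
    (n • δ + η) - (2 * C η ε / C ε ε) • (m • δ + ε)
  refl_delta : ∀ ε ∈ Delo α s, ∀ m : ℤ, s (m • δ + ε) δ = δ
  refl_gen : ∀ ε ∈ Delo α s, ∀ m : ℤ, ∀ v, ∃ c : ℝ, s (m • δ + ε) v = v - c • (m • δ + ε)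
  sgn : ∀ v ∈ Delo α s, (∀ i, 0 ≤ e i v) ∨ (∀ i, e i v ≤ 0)
  poso : ∀ v ∈ Delo α s, (PosoComb α v ↔ ∀ i, 0 ≤ e i v)
  exp : ∀ v ∈ Delo α s, v = ∑ i, e i v • α i
  ne_zero : ∀ v ∈ Delo α s, v ≠ 0

namespace AffineSetup

variable {α : ι → V} {δ θ : V} {B : V →ₗ[ℝ] V →ₗ[ℝ] ℝ} {s : V → V ≃ₗ[ℝ] V}

theorem exists_fun (h : AffineSetup α δ θ B s) (c : Option ι → ℝ) :
    ∃ φ : V →ₗ[ℝ] ℝ, ∀ o, φ (alHat α δ θ o) = c o := by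
  let b := Module.Basis.span h.indep
  obtain ⟨φ, hφ⟩ := LinearMap.exists_extend (b.constr ℝ c)
  refine ⟨φ, fun o => ?_⟩
  have h1 : (b o : V) = alHat α δ θ o := by
    rw [Module.Basis.span_apply]
  rw [← h1]
  have := LinearMap.congr_fun hφ (b o)
  simp only [LinearMap.comp_apply, Submodule.subtype_apply] at this
  rw [this, Module.Basis.constr_basis]

theorem exists_form (h : AffineSetup α δ θ B s) : ∃ C : V →ₗ[ℝ] V →ₗ[ℝ] ℝ,
    (∀ x y, C x y = C y x) ∧ (∀ x, 0 ≤ C x x) ∧ (∀ x, C δ x = 0) ∧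
    (∀ v ∈ Delo α s, 0 < C v v) ∧
    ∀ ε ∈ Delo α s, ∀ η ∈ Delo α s, 2 * B η ε / B ε ε = 2 * C η ε / C ε ε := by
  classical
  let F := h.finite.toFinset
  have hF : ∀ v, v ∈ F ↔ v ∈ Delo α s := fun v => h.finite.mem_toFinset
  let C : V →ₗ[ℝ] V →ₗ[ℝ] ℝ := LinearMap.mk₂ ℝ (fun x y => ∑ ε ∈ F, B x ε * B y ε)
    (by intros; simp [add_mul, Finset.sum_add_distrib])
    (by intros; simp [mul_assoc, Finset.mul_sum])
    (by intros; simp [mul_add, Finset.sum_add_distrib])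
    (by intros; simp [mul_left_comm, Finset.mul_sum])
  have hC : ∀ x y, C x y = ∑ ε ∈ F, B x ε * B y ε := fun x y => rfl
  have hpos : ∀ v ∈ Delo α s, 0 < C v v := by
    intro v hv
    rw [hC]
    apply Finset.sum_pos'
    · intro ε _; exact mul_self_nonneg _
    · exact ⟨v, (hF v).2 hv, mul_pos (h.Bpos v hv) (h.Bpos v hv)⟩
  refine ⟨C, fun x y => ?_, fun x => ?_, fun x => ?_, hpos, ?_⟩
  · rw [hC, hC]; exact Finset.sum_congr rfl fun _ _ => mul_comm _ _
  · rw [hC]; exact Finset.sum_nonneg fun _ _ => mul_self_nonneg _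
  · rw [hC]; exact Finset.sum_eq_zero fun ε hε => by rw [h.delta_root ((hF ε).1 hε), zero_mul]
  · intro ε hε η hη
    have inv : C (s ε η) (s ε ε) = C η ε := by
      rw [hC, hC]
      refine Finset.sum_nbij' (s ε) (s ε) ?_ ?_ ?_ ?_ ?_
      · intro a ha; exact (hF _).2 (h.srefl_app hε ((hF a).1 ha))
      · intro a ha; exact (hF _).2 (h.srefl_app hε ((hF a).1 ha))
      · intro a _; rw [← LinearEquiv.mul_apply, h.sq (h.nz hε)]; rfl
      · intro a _; rw [← LinearEquiv.mul_apply, h.sq (h.nz hε)]; rfl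
      · intro a _
        have e1 : ∀ x, B (s ε x) a = B x (s ε a) := by
          intro x
          rw [← h.iso (h.nz hε) x (s ε a), ← LinearEquiv.mul_apply, h.sq (h.nz hε)]; rfl
        rw [e1, e1]
    rw [h.self (h.nz hε), h.refl_def ε (h.nz hε) η] at inv
    simp only [map_sub, map_smul, map_neg, LinearMap.sub_apply, LinearMap.smul_apply,
      smul_eq_mul] at inv
    have := hpos ε hε
    generalize 2 * B η ε / B ε ε = c at *
    rw [eq_div_iff this.ne']
    linarith

theorem exists_ctx (h : AffineSetup α δ θ B s) : Nonempty (Ctx α δ s) := by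
  classical
  obtain ⟨C, c1, c2, c3, c4, c5⟩ := h.exists_form
  obtain ⟨t, ht, hθ⟩ := h.theta_high.2.1
  obtain ⟨d, hd⟩ := h.exists_fun (fun o => o.elim 1 (fun _ => 0))
  have he : ∀ i, ∃ φ : V →ₗ[ℝ] ℝ, φ δ = 0 ∧ φ (α i) = 1 ∧ ∀ j, i ≠ j → φ (α j) = 0 := by
    intro i
    obtain ⟨φ, hφ⟩ := h.exists_fun (fun o => o.elim (- t i) (fun j => if i = j then 1 else 0))
    have ha : ∀ j, φ (α j) = if i = j then 1 else 0 := fun j => hφ (some j)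
    refine ⟨φ, ?_, by simp [ha], fun j hj => by simp [ha, hj]⟩
    have h1 : φ (δ - θ) = - t i := hφ none
    have h2 : φ θ = t i := by rw [hθ, map_sum]; simp [ha]
    rw [map_sub, h2] at h1
    linarith
  choose e e1 e2 e3 using he
  have da : ∀ i, d (α i) = 0 := fun i => hd (some i)
  have coef : ∀ c : ι → ℝ, ∀ i, e i (∑ j, c j • α j) = c i := by
    intro c i
    rw [map_sum, Finset.sum_eq_single i]
    · simp [e2]
    · intro j _ hj; simp [e3 i j hj.symm]
    · simp
  have hexp : ∀ v ∈ Delo α s, v = ∑ i, e i v • α i := by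
    intro v hv
    obtain ⟨c, _, h2⟩ := h.expand hv
    conv_rhs => rw [h2]
    simp only [coef]
    exact h2
  exact ⟨{
    C := C
    d := d
    e := e
    d_delta := by
      have h1 : d (δ - θ) = 1 := hd none
      have h2 : d θ = 0 := by rw [hθ, map_sum]; simp [da]
      rw [map_sub, h2, sub_zero] at h1
      exact h1
    d_alpha := da
    e_delta := e1
    e_same := e2
    e_diff := e3
    C_symm := c1
    C_nonneg := c2
    C_delta := c3
    C_pos := c4
    refl := by
      intro ε hε η hη m n
      have hz : B (m • δ + ε) (m • δ + ε) ≠ 0 := by rw [h.B_real hε]; exact h.nz hε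
      rw [h.refl_def _ hz, h.B_real hε, ← c5 ε hε η hη]
      congr 3
      rw [← Int.cast_smul_eq_zsmul ℝ m δ, ← Int.cast_smul_eq_zsmul ℝ n δ]
      simp only [map_add, map_smul, LinearMap.add_apply, LinearMap.smul_apply, smul_eq_mul,
        h.delta_null, h.delta_root hε, h.Bsymm η δ, h.delta_root hη]
      ring
    refl_delta := by
      intro ε hε m
      have hz : B (m • δ + ε) (m • δ + ε) ≠ 0 := by rw [h.B_real hε]; exact h.nz hε
      rw [h.refl_def _ hz, ← Int.cast_smul_eq_zsmul ℝ m δ]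
      simp [h.delta_null, h.delta_root hε]
    refl_gen := by
      intro ε hε m v
      have hz : B (m • δ + ε) (m • δ + ε) ≠ 0 := by rw [h.B_real hε]; exact h.nz hε
      exact ⟨_, h.refl_def _ hz v⟩
    sgn := by
      intro v hv
      obtain ⟨c, h1, rfl⟩ := h.expand hv
      simpa only [coef] using h1
    poso := by
      intro v hv
      constructor
      · rintro ⟨c, h1, rfl⟩
        simpa only [coef] using h1
      · intro h1
        exact ⟨_, h1, hexp v hv⟩
    exp := hexp
    ne_zero := by
      rintro v hv rfl
      have := h.Bpos 0 hv
      simp at this }⟩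

end AffineSetup

namespace AffineSetup

variable {α : ι → V} {δ θ : V} {B : V →ₗ[ℝ] V →ₗ[ℝ] ℝ} {s : V → V ≃ₗ[ℝ] V}

theorem refl0 (X : Ctx α δ s) {ε η : V} (hε : ε ∈ Delo α s) (hη : η ∈ Delo α s) :
    s ε η = η - (2 * X.C η ε / X.C ε ε) • ε := by
  have := X.refl ε hε η hη 0 0
  simpa using this

theorem cart (h : AffineSetup α δ θ B s) (X : Ctx α δ s) {v w : V} (hv : v ∈ Delo α s)
    (hw : w ∈ Delo α s) : ∃ n : ℤ, 2 * X.C v w / X.C w w = n := by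
  have hw0 := X.ne_zero w hw
  have e1 := refl0 X hw hv
  obtain ⟨g, hg, i, hi, rfl⟩ := hw
  have e2 := h.conj_gen (h.WoJ_iso hg) (h.nz (simple_memo i))
  obtain ⟨m, hm⟩ := h.cryst i (g⁻¹ v) (WoJ_app (Subgroup.inv_mem _ hg) hv)
  have e3 : s (g (α i)) v = v - (m : ℝ) • g (α i) := by
    rw [← e2, LinearEquiv.mul_apply, LinearEquiv.mul_apply, hm, map_sub, app_inv, map_zsmul,
      Int.cast_smul_eq_zsmul]
  refine ⟨m, ?_⟩
  rw [e1] at e3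
  have e4 := sub_right_inj.1 e3
  exact smul_left_injective ℝ hw0 e4

theorem Cneg (X : Ctx α δ s) (x y : V) : X.C x (-y) = - X.C x y := by simp

theorem sub_mem (h : AffineSetup α δ θ B s) (X : Ctx α δ s) {J : Set ι} {v w : V}
    (hv : v ∈ DeloJ α s J) (hw : w ∈ DeloJ α s J) (hC : 0 < X.C v w) :
    v = w ∨ v - w ∈ DeloJ α s J := by
  have hv' := DeloJ_sub J hv
  have hw' := DeloJ_sub J hw
  have pv := X.C_pos v hv'
  have pw := X.C_pos w hw'
  obtain ⟨n, hn⟩ := h.cart X hv' hw'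
  obtain ⟨m, hm⟩ := h.cart X hw' hv'
  have e1 := refl0 X hw' hv'
  have e2 := refl0 X hv' hw'
  have hn0 : 0 < n := by
    have : (0 : ℝ) < n := by rw [← hn]; positivity
    exact_mod_cast this
  have hm0 : 0 < m := by
    have : (0 : ℝ) < m := by rw [← hm, X.C_symm]; positivity
    exact_mod_cast this
  rw [hn] at e1
  rw [hm] at e2
  by_cases hn1 : n = 1
  · right
    rw [hn1, Int.cast_one, one_smul] at e1
    rw [← e1]
    exact h.srefl_app hw hv
  by_cases hm1 : m = 1
  · right
    rw [hm1, Int.cast_one, one_smul] at e2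
    have := h.neg_mem (h.srefl_app hv hw)
    rwa [e2, neg_sub] at this
  left
  have hn2 : (2 : ℝ) ≤ n := by exact_mod_cast (by omega : (2 : ℤ) ≤ n)
  have hm2 : (2 : ℝ) ≤ m := by exact_mod_cast (by omega : (2 : ℤ) ≤ m)
  rw [← hn, le_div_iff₀ pw] at hn2
  rw [← hm, le_div_iff₀ pv, X.C_symm w v] at hm2
  have hx := X.C_nonneg (v - w)
  simp only [map_sub, LinearMap.sub_apply, X.C_symm w v] at hx
  have q1 : X.C v w = X.C w w := by linarith
  have q2 : X.C v v = X.C w w := by linarith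
  by_contra hne
  have hx0 : v - w ≠ 0 := sub_ne_zero.2 hne
  have key : ∀ k : ℕ, w + ((2 : ℝ) ^ k) • (v - w) ∈ Delo α s := by
    intro k
    induction k with
    | zero => simpa using hv'
    | succ k ih =>
      set t : ℝ := (2 : ℝ) ^ k
      have c1 : X.C w (w + t • (v - w)) = X.C w w := by
        simp [X.C_symm w v, q1]
      have c2 : X.C (w + t • (v - w)) (w + t • (v - w)) = X.C w w := by
        simp [X.C_symm w v, q1, q2]
      have e3 := refl0 X ih hw'
      rw [c1, c2, mul_div_assoc, div_self pw.ne', mul_one] at e3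
      have e4 := h.neg_mem (h.srefl_app ih hw')
      rw [e3] at e4
      have : -(w - (2 : ℝ) • (w + t • (v - w))) = w + ((2 : ℝ) ^ (k + 1)) • (v - w) := by
        rw [pow_succ]; module
      rwa [this] at e4
  refine Set.infinite_of_injective_forall_mem (f := fun k : ℕ => w + ((2 : ℝ) ^ k) • (v - w))
    ?_ key h.finite
  intro a b hab
  have := smul_left_injective ℝ hx0 (add_left_cancel hab)
  exact (pow_right_injective₀ (by norm_num : (0 : ℝ) < 2) (by norm_num)) this

theorem add_mem (h : AffineSetup α δ θ B s) (X : Ctx α δ s) {J : Set ι} {v w : V}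
    (hv : v ∈ DeloJ α s J) (hw : w ∈ DeloJ α s J) (hC : X.C v w < 0) :
    v = -w ∨ v + w ∈ DeloJ α s J := by
  have := h.sub_mem X hv (h.neg_mem hw) (by rw [Cneg]; linarith)
  rwa [sub_neg_eq_add] at this

theorem integral (h : AffineSetup α δ θ B s) (X : Ctx α δ s) {v : V} (hv : v ∈ Delo α s) (j : ι) :
    ∃ n : ℤ, X.e j v = n := by
  have key : ∀ g ∈ WoJ α s Set.univ, ∀ v ∈ Delo α s,
      ((∃ n : ℤ, X.e j (g v) = n) ↔ ∃ n : ℤ, X.e j v = n) := by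
    intro g hg
    induction hg using Subgroup.closure_induction with
    | mem x hx =>
      obtain ⟨i, _, rfl⟩ := hx
      intro v hv
      obtain ⟨m, hm⟩ := h.cryst i v hv
      obtain ⟨a, ha⟩ : ∃ a : ℤ, X.e j (α i) = a := by
        by_cases hji : j = i
        · exact ⟨1, by rw [hji, X.e_same]; simp⟩
        · exact ⟨0, by rw [X.e_diff j i hji]; simp⟩
      simp only [hm, map_sub, map_zsmul, ha, zsmul_eq_mul]
      constructor
      · rintro ⟨n, hn⟩; exact ⟨n + m * a, by push_cast; linarith⟩
      · rintro ⟨n, hn⟩; exact ⟨n - m * a, by push_cast; linarith⟩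
    | one => intro v _; rfl
    | mul g g' _ hg' h1 h2 =>
      intro v hv
      rw [LinearEquiv.mul_apply, h1 _ (WoJ_app hg' hv), h2 _ hv]
    | inv g hg h1 =>
      intro v hv
      rw [← h1 _ (WoJ_app (Subgroup.inv_mem _ hg) hv), app_inv]
  obtain ⟨g, hg, i, _, rfl⟩ := hv
  rw [key g hg _ (simple_memo i)]
  by_cases hji : j = i
  · exact ⟨1, by rw [hji, X.e_same]; simp⟩
  · exact ⟨0, by rw [X.e_diff j i hji]; simp⟩

theorem inv_fun (X : Ctx α δ s) (φ : V →ₗ[ℝ] ℝ) {Y : Set V}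
    (hY : ∀ a ∈ Y, φ a = 0 ∧ ∃ m : ℤ, ∃ ε ∈ Delo α s, a = m • δ + ε)
    {g : V ≃ₗ[ℝ] V} (hg : g ∈ Subgroup.closure (s '' Y)) : ∀ v, φ (g v) = φ v := by
  induction hg using Subgroup.closure_induction with
  | mem x hx =>
    obtain ⟨a, ha, rfl⟩ := hx
    intro v
    obtain ⟨h0, m, ε, hε, rfl⟩ := hY a ha
    obtain ⟨c, hc⟩ := X.refl_gen ε hε m v
    rw [hc, map_sub, map_smul, h0, smul_zero, sub_zero]
  | one => intro x; rfl
  | mul g g' _ _ h1 h2 => intro x; rw [LinearEquiv.mul_apply, h1, h2]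
  | inv g _ h1 => intro x; rw [← h1, app_inv]

theorem inv_fun_o (X : Ctx α δ s) (φ : V →ₗ[ℝ] ℝ) {K : Set ι}
    (hK : ∀ j ∈ K, φ (α j) = 0) {g : V ≃ₗ[ℝ] V} (hg : g ∈ WoJ α s K) : ∀ v, φ (g v) = φ v := by
  rw [WoJ_eq] at hg
  refine inv_fun X φ ?_ hg
  rintro _ ⟨j, hj, rfl⟩
  exact ⟨hK j hj, 0, α j, simple_memo j, by simp⟩

theorem supp_zero (X : Ctx α δ s) {K : Set ι} {v : V} (hv : v ∈ DeloJ α s K) {i : ι}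
    (hi : i ∉ K) : X.e i v = 0 := by
  obtain ⟨g, hg, j, hj, rfl⟩ := hv
  have hK : ∀ j ∈ K, X.e i (α j) = 0 := fun j hj => X.e_diff i j (by rintro rfl; exact hi hj)
  rw [inv_fun_o X (X.e i) hK hg]
  exact hK j hj

theorem C_exp (X : Ctx α δ s) {v : V} (hv : v = ∑ i, X.e i v • α i) (y : V) :
    X.C y v = ∑ i, X.e i v * X.C y (α i) := by
  conv_lhs => rw [hv]
  simp

theorem pick' (X : Ctx α δ s) {v : V} (hv : v = ∑ i, X.e i v • α i) (hp : ∀ i, 0 ≤ X.e i v)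
    {y : V} (hC : 0 < X.C y v) : ∃ i, 0 < X.e i v ∧ 0 < X.C y (α i) := by
  by_contra hcon
  push Not at hcon
  rw [C_exp X hv] at hC
  have : ∑ i, X.e i v * X.C y (α i) ≤ 0 := by
    apply Finset.sum_nonpos
    intro i _
    rcases (hp i).eq_or_lt with h0 | h0
    · rw [← h0]; simp
    · exact mul_nonpos_of_nonneg_of_nonpos h0.le (hcon i h0)
  linarith

theorem pick (X : Ctx α δ s) {v : V} (hv : v ∈ Delo α s) (hp : ∀ i, 0 ≤ X.e i v) :
    ∃ i, 0 < X.e i v ∧ 0 < X.C v (α i) := pick' X (X.exp v hv) hp (X.C_pos v hv)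

theorem mult (h : AffineSetup α δ θ B s) (X : Ctx α δ s) {v : V} (hv : v ∈ Delo α s) {i : ι}
    (hp : ∀ j, 0 ≤ X.e j v) (hj : ∀ j, j ≠ i → X.e j v = 0) : v = α i := by
  have hi : v = X.e i v • α i := by
    conv_lhs => rw [X.exp v hv]
    apply Finset.sum_eq_single i
    · intro j _ hji; rw [hj j hji, zero_smul]
    · simp
  have ha := simple_memo (α := α) (s := s) i
  have pa := X.C_pos _ ha
  have hc : 0 < X.e i v := by
    rcases (hp i).eq_or_lt with h0 | h0
    · exfalso; rw [← h0, zero_smul] at hi; exact X.ne_zero v hv hi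
    · exact h0
  obtain ⟨n, hn⟩ := h.cart X hv ha
  obtain ⟨m, hm⟩ := h.cart X ha hv
  generalize X.e i v = c at *
  subst hi
  simp only [map_smul, LinearMap.smul_apply, smul_eq_mul] at hn hm
  have hn' : 2 * c = n := by rw [← hn]; field_simp
  have hm' : 2 / c = m := by rw [← hm]; field_simp
  have hmn : (n : ℝ) * m = 4 := by rw [← hn', ← hm']; field_simp; norm_num
  have hmn' : n * m = 4 := by exact_mod_cast hmn
  have n0 : 0 < n := by
    have : (0 : ℝ) < n := by rw [← hn']; positivity
    exact_mod_cast this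
  have m0 : 0 < m := by
    have : (0 : ℝ) < m := by rw [← hm']; positivity
    exact_mod_cast this
  have n4 : n ≤ 4 := by nlinarith
  interval_cases n
  · exfalso
    apply h.reduced _ hv
    have : (2 : ℝ) • c • α i = α i := by rw [smul_smul, hn']; simp
    rw [this]; exact ha
  · have : c = 1 := by push_cast at hn'; linarith
    rw [this, one_smul]
  · omega
  · exfalso
    apply h.reduced _ ha
    have : c = 2 := by push_cast at hn'; linarith
    rwa [this] at hv

/-- The height functional. -/
def ht (X : Ctx α δ s) : V →ₗ[ℝ] ℝ := ∑ i, X.e i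

theorem ht_app (X : Ctx α δ s) (v : V) : ht X v = ∑ i, X.e i v := by simp [ht]

theorem ht_alpha (X : Ctx α δ s) (i : ι) : ht X (α i) = 1 := by
  rw [ht_app, Finset.sum_eq_single i]
  · exact X.e_same i
  · intro j _ hj; exact X.e_diff j i hj
  · simp

theorem ht_pos (X : Ctx α δ s) {v : V} (hv : v ∈ Delo α s) (hp : ∀ i, 0 ≤ X.e i v) :
    0 < ht X v := by
  obtain ⟨i, hi, _⟩ := pick X hv hp
  rw [ht_app]
  exact Finset.sum_pos' (fun i _ => hp i) ⟨i, Finset.mem_univ _, hi⟩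

theorem supp_mem (h : AffineSetup α δ θ B s) (X : Ctx α δ s) {K : Set ι} {v : V}
    (hv : v ∈ Delo α s) (hK : ∀ i, i ∉ K → X.e i v = 0) : v ∈ DeloJ α s K := by
  have main : ∀ v ∈ Delo α s, (∀ i, 0 ≤ X.e i v) → (∀ i, i ∉ K → X.e i v = 0) →
      v ∈ DeloJ α s K := by
    by_contra hcon
    push Not at hcon
    obtain ⟨v0, a0, a1, a2, a3⟩ := hcon
    let S : Set V := {v | v ∈ Delo α s ∧ (∀ i, 0 ≤ X.e i v) ∧ (∀ i, i ∉ K → X.e i v = 0) ∧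
      v ∉ DeloJ α s K}
    have hS : S.Finite := h.finite.subset fun v hv => hv.1
    obtain ⟨v, ⟨hv, hp, hK, hn⟩, hmin⟩ := Set.exists_min_image S (ht X) hS ⟨v0, a0, a1, a2, a3⟩
    obtain ⟨i, hi, hC⟩ := pick X hv hp
    have hiK : i ∈ K := by
      by_contra hiK
      rw [hK i hiK] at hi
      exact lt_irrefl _ hi
    have ha := simple_memo (α := α) (s := s) i
    have pa := X.C_pos _ ha
    have e1 := refl0 X ha hv
    set c := 2 * X.C v (α i) / X.C (α i) (α i) with hc
    have c0 : 0 < c := by positivity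
    have hw : s (α i) v ∈ Delo α s := h.srefl_app ha hv
    have ej : ∀ j, j ≠ i → X.e j (s (α i) v) = X.e j v := by
      intro j hj
      rw [e1, map_sub, map_smul, X.e_diff j i hj]; simp
    rcases X.sgn _ hw with h1 | h1
    · have hw' : s (α i) v ∈ DeloJ α s K := by
        by_contra hw'
        have := hmin (s (α i) v) ⟨hw, h1, fun j hj => by
          rw [ej j (by rintro rfl; exact hj hiK), hK j hj], hw'⟩
        rw [e1, map_sub, map_smul, ht_alpha] at this
        simp at this
        linarith
      apply hn
      have := WoJ_app (WoJ_gen hiK) hw'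
      rwa [← LinearEquiv.mul_apply, h.sq (h.nz ha)] at this
    · apply hn
      rw [h.mult X hv hp (i := i)]
      · exact simple_mem hiK
      · intro j hj
        have := h1 j
        rw [ej j hj] at this
        exact le_antisymm this (hp j)
  rcases X.sgn v hv with h1 | h1
  · exact main v hv h1 hK
  · have := h.neg_mem (main (-v) (h.neg_mem hv) (fun i => by rw [map_neg]; linarith [h1 i])
      (fun i hi => by rw [map_neg, hK i hi, neg_zero]))
    rwa [neg_neg] at this

theorem dec_pos (h : AffineSetup α δ θ B s) (X : Ctx α δ s) {J : Set ι} {v : V}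
    (hv : v ∈ DeloJ α s J) (hp : ∀ i, 0 ≤ X.e i v) (hne : v ∉ α '' J) :
    ∃ j ∈ J, v - α j ∈ DeloJ α s J ∧ ∀ i, 0 ≤ X.e i (v - α j) := by
  have hv' := DeloJ_sub J hv
  obtain ⟨i, hi, hC⟩ := pick X hv' hp
  have hiJ : i ∈ J := by
    by_contra hiJ
    rw [supp_zero X hv hiJ] at hi
    exact lt_irrefl _ hi
  rcases h.sub_mem X hv (simple_mem hiJ) hC with rfl | h1
  · exact absurd ⟨i, hiJ, rfl⟩ hne
  refine ⟨i, hiJ, h1, ?_⟩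
  rcases X.sgn _ (DeloJ_sub J h1) with h2 | h2
  · exact h2
  · exfalso
    apply hne
    refine ⟨i, hiJ, (h.mult X hv' hp ?_).symm⟩
    intro j hj
    have := h2 j
    rw [map_sub, X.e_diff j i hj, sub_zero] at this
    exact le_antisymm this (hp j)

theorem not_neg_simple (X : Ctx α δ s) {v : V} (hp : ∀ i, 0 ≤ X.e i v) (j : ι) : v ≠ - α j := by
  rintro rfl
  have := hp j
  rw [map_neg, X.e_same] at this
  linarith

theorem step (h : AffineSetup α δ θ B s) (X : Ctx α δ s) {J : Set ι} {ε β : V}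
    (hε : ε ∈ DeloJ α s J) (hp : ∀ i, 0 ≤ X.e i ε) (hβ : β ∈ DeloJ α s J)
    (hle : ∀ i, X.e i ε ≤ X.e i β) (hne : ε ≠ β) : ∃ j ∈ J, ε + α j ∈ DeloJ α s J := by
  by_contra hcon
  push Not at hcon
  let S : Set V := {β | β ∈ DeloJ α s J ∧ (∀ i, X.e i ε ≤ X.e i β) ∧ ε ≠ β}
  have hS : S.Finite := h.finite.subset fun v hv => DeloJ_sub J hv.1
  obtain ⟨β, ⟨hβ, hle, hne⟩, hmin⟩ := Set.exists_min_image S (ht X) hS ⟨β, hβ, hle, hne⟩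
  have hε' := DeloJ_sub J hε
  have hβ' := DeloJ_sub J hβ
  have pε := X.C_pos ε hε'
  have pβ := X.C_pos β hβ'
  have hγ : 0 < X.C (β - ε) (β - ε) := by
    by_cases hC : 0 < X.C β ε
    · rcases h.sub_mem X hβ hε hC with h1 | h1
      · exact absurd h1.symm hne
      · exact X.C_pos _ (DeloJ_sub J h1)
    · simp only [map_sub, LinearMap.sub_apply, X.C_symm ε β]
      linarith
  obtain ⟨j, hj1, hj2⟩ := pick' X (v := β - ε) (y := β - ε) (by
      conv_lhs => rw [X.exp β hβ', X.exp ε hε', ← Finset.sum_sub_distrib]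
      exact Finset.sum_congr rfl fun i _ => by rw [map_sub, sub_smul])
    (fun i => by rw [map_sub]; linarith [hle i]) hγ
  have hjJ : j ∈ J := by
    by_contra hjJ
    rw [map_sub, supp_zero X hβ hjJ, supp_zero X hε hjJ] at hj1
    simp at hj1
  have haj := simple_mem (α := α) (s := s) hjJ
  by_cases hC : X.C ε (α j) < 0
  · rcases h.add_mem X hε haj hC with h1 | h1
    · exact not_neg_simple X hp j h1
    · exact hcon j hjJ h1
  rw [map_sub, LinearMap.sub_apply] at hj2
  have hCβ : 0 < X.C β (α j) := by linarith
  rcases h.sub_mem X hβ haj hCβ with h1 | h1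
  · apply hne
    rw [h1]
    apply h.mult X hε' hp
    intro i hi
    have := hle i
    rw [h1, X.e_diff i j hi] at this
    exact le_antisymm this (hp i)
  · have hne' : ε ≠ β - α j := by
      intro he
      apply hcon j hjJ
      rw [he, sub_add_cancel]; exact hβ
    have := hmin (β - α j) ⟨h1, ?_, hne'⟩
    · rw [map_sub, ht_alpha] at this
      linarith
    · intro i
      rw [map_sub]
      by_cases hij : i = j
      · subst hij
        obtain ⟨a, ha⟩ := h.integral X hε' i
        obtain ⟨b, hb⟩ := h.integral X hβ' i
        rw [map_sub] at hj1
        rw [X.e_same, ha, hb]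
        rw [ha, hb] at hj1
        have : a + 1 ≤ b := by
          have : (a : ℝ) < b := by linarith
          exact_mod_cast this
        have : (a : ℝ) + 1 ≤ b := by exact_mod_cast this
        linarith
      · rw [X.e_diff i j hij, sub_zero]; exact hle i

theorem high_pos (X : Ctx α δ s) {J : Set ι} {t : V} (ht : t ∈ HighRoots α s J) :
    ∀ i, 0 ≤ X.e i t := (X.poso t (DeloJ_sub J ht.1)).1 ht.2.1

theorem dom (h : AffineSetup α δ θ B s) (X : Ctx α δ s) {J : Set ι} {t : V}
    (ht : t ∈ HighRoots α s J) {j : ι} (hj : j ∈ J) : 0 ≤ X.C t (α j) := by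
  by_contra hcon
  rcases h.add_mem X ht.1 (simple_mem hj) (not_le.1 hcon) with h1 | h1
  · exact not_neg_simple X (high_pos X ht) j h1
  · exact ht.2.2 j hj h1

theorem dom_sum (h : AffineSetup α δ θ B s) (X : Ctx α δ s) {J : Set ι} {t : V}
    (ht : t ∈ HighRoots α s J) {v : V} (hv : v = ∑ i, X.e i v • α i) (hp : ∀ i, 0 ≤ X.e i v)
    (hz : ∀ i, i ∉ J → X.e i v = 0) : 0 ≤ X.C t v := by
  rw [C_exp X hv]
  apply Finset.sum_nonneg
  intro i _
  by_cases hi : i ∈ J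
  · exact mul_nonneg (hp i) (h.dom X ht hi)
  · rw [hz i hi, zero_mul]

theorem dom_root (h : AffineSetup α δ θ B s) (X : Ctx α δ s) {J : Set ι} {t : V}
    (ht : t ∈ HighRoots α s J) {v : V} (hv : v ∈ DeloJ α s J) (hp : ∀ i, 0 ≤ X.e i v) :
    0 ≤ X.C t v :=
  h.dom_sum X ht (X.exp v (DeloJ_sub J hv)) hp fun _ hi => supp_zero X hv hi

theorem sub_exp (X : Ctx α δ s) {β ε : V} (hβ : β ∈ Delo α s) (hε : ε ∈ Delo α s) :
    β - ε = ∑ i, X.e i (β - ε) • α i := by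
  conv_lhs => rw [X.exp β hβ, X.exp ε hε, ← Finset.sum_sub_distrib]
  exact Finset.sum_congr rfl fun i _ => by rw [map_sub, sub_smul]

theorem climb (h : AffineSetup α δ θ B s) (X : Ctx α δ s) {J : Set ι} {ε : V}
    (hε : ε ∈ DeloJ α s J) (hp : ∀ i, 0 ≤ X.e i ε) :
    ∃ t ∈ HighRoots α s J, ∀ i, X.e i ε ≤ X.e i t := by
  let S : Set V := {β | β ∈ DeloJ α s J ∧ (∀ i, X.e i ε ≤ X.e i β)}
  have hS : S.Finite := h.finite.subset fun v hv => DeloJ_sub J hv.1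
  obtain ⟨t, ⟨h1, h2⟩, hmax⟩ := Set.exists_max_image S (ht X) hS ⟨ε, hε, fun _ => le_rfl⟩
  refine ⟨t, ⟨h1, (X.poso t (DeloJ_sub J h1)).2 fun i => (hp i).trans (h2 i), ?_⟩, h2⟩
  intro j hj hcon
  have := hmax (t + α j) ⟨hcon, fun i => ?_⟩
  · rw [map_add, ht_alpha] at this; linarith
  · rw [map_add]
    have : 0 ≤ X.e i (α j) := by
      by_cases hij : i = j
      · rw [hij, X.e_same]; norm_num
      · rw [X.e_diff i j hij]
    linarith [h2 i]

theorem high_unique (h : AffineSetup α δ θ B s) (X : Ctx α δ s) {J : Set ι} {t t' : V}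
    (ht : t ∈ HighRoots α s J) (ht' : t' ∈ HighRoots α s J) (hC : 0 < X.C t t') : t = t' := by
  by_contra hne
  rcases h.sub_mem X ht.1 ht'.1 hC with h1 | h1
  · exact hne h1
  rcases X.sgn _ (DeloJ_sub J h1) with h2 | h2
  · obtain ⟨j, hj, h3⟩ := h.step X ht'.1 (high_pos X ht') ht.1
      (fun i => by have := h2 i; rw [map_sub] at this; linarith) (Ne.symm hne)
    exact ht'.2.2 j hj h3
  · obtain ⟨j, hj, h3⟩ := h.step X ht.1 (high_pos X ht) ht'.1
      (fun i => by have := h2 i; rw [map_sub] at this; linarith) hne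
    exact ht.2.2 j hj h3

theorem high_le (h : AffineSetup α δ θ B s) (X : Ctx α δ s) {J : Set ι} {t ε : V}
    (ht : t ∈ HighRoots α s J) (hε : ε ∈ DeloJ α s J) (hC : 0 < X.C ε t) :
    ∀ i, X.e i ε ≤ X.e i t := by
  have hp : ∀ i, 0 ≤ X.e i ε := by
    rcases X.sgn _ (DeloJ_sub J hε) with h1 | h1
    · exact h1
    · exfalso
      have := h.dom_root X ht (h.neg_mem hε) (fun i => by rw [map_neg]; linarith [h1 i])
      rw [Cneg, X.C_symm] at this
      linarith
  obtain ⟨t', ht', hle⟩ := h.climb X hε hp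
  have h2 := h.dom_sum X ht (sub_exp X (DeloJ_sub J ht'.1) (DeloJ_sub J hε))
    (fun i => by rw [map_sub]; linarith [hle i])
    (fun i hi => by rw [map_sub, supp_zero X ht'.1 hi, supp_zero X hε hi, sub_zero])
  rw [map_sub, X.C_symm t ε] at h2
  rw [h.high_unique X ht ht' (by linarith)]
  exact hle

theorem ext_root (X : Ctx α δ s) {v w : V} (hv : v ∈ Delo α s) (hw : w ∈ Delo α s)
    (he : ∀ i, X.e i v = X.e i w) : v = w := by
  rw [X.exp v hv, X.exp w hw]
  exact Finset.sum_congr rfl fun i _ => by rw [he i]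

theorem high_one (h : AffineSetup α δ θ B s) (X : Ctx α δ s) {J : Set ι} {t ε : V}
    (ht : t ∈ HighRoots α s J) (hε : ε ∈ DeloJ α s J) (hC : 0 < X.C ε t) (hne : ε ≠ t) :
    2 * X.C ε t / X.C t t = 1 := by
  have ht' := DeloJ_sub J ht.1
  have hε' := DeloJ_sub J hε
  have pt := X.C_pos t ht'
  have hle := h.high_le X ht hε hC
  obtain ⟨n, hn⟩ := h.cart X hε' ht'
  have h2 := h.dom_sum X ht (sub_exp X ht' hε')
    (fun i => by rw [map_sub]; linarith [hle i])
    (fun i hi => by rw [map_sub, supp_zero X ht.1 hi, supp_zero X hε hi, sub_zero])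
  rw [map_sub, X.C_symm t ε] at h2
  have n0 : 0 < n := by
    have : (0 : ℝ) < n := by rw [← hn]; positivity
    exact_mod_cast this
  have n2 : n ≤ 2 := by
    have : (n : ℝ) ≤ 2 := by rw [← hn, div_le_iff₀ pt]; linarith
    exact_mod_cast this
  rw [hn]
  have : n = 1 ∨ n = 2 := by omega
  rcases this with rfl | rfl
  · simp
  exfalso
  have e1 := refl0 X ht' hε'
  have e2 := h.neg_mem (h.srefl_app ht.1 hε)
  rw [e1, hn] at e2
  have hCt : X.C ε t = X.C t t := by
    rw [div_eq_iff pt.ne'] at hn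
    push_cast at hn
    linarith
  have h3 := h.high_le X ht e2 (by
    simp only [map_neg, map_sub, map_smul, LinearMap.neg_apply, LinearMap.sub_apply,
      LinearMap.smul_apply, smul_eq_mul, hCt]
    push_cast
    linarith)
  apply hne
  apply ext_root X hε' ht'
  intro i
  have h4 := h3 i
  simp only [map_neg, map_sub, map_smul, smul_eq_mul] at h4
  push_cast at h4
  have h5 := hle i
  linarith

theorem C_simple (h : AffineSetup α δ θ B s) (X : Ctx α δ s) {i j : ι} (hij : i ≠ j) :
    X.C (α i) (α j) ≤ 0 := by
  by_contra hcon
  have ai := simple_memo (α := α) (s := s) i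
  have aj := simple_memo (α := α) (s := s) j
  rcases h.sub_mem X ai aj (not_le.1 hcon) with h1 | h1
  · have := X.e_same i
    rw [h1, X.e_diff i j hij] at this
    norm_num at this
  · rcases X.sgn _ h1 with h2 | h2
    · have := h2 j
      rw [map_sub, X.e_same, X.e_diff j i hij.symm] at this
      norm_num at this
    · have := h2 i
      rw [map_sub, X.e_same, X.e_diff i j hij] at this
      norm_num at this

theorem theta_full (h : AffineSetup α δ θ B s) (X : Ctx α δ s) (i : ι) : 0 < X.e i θ := by
  have hθ := h.theta_high.1
  have hp := high_pos X h.theta_high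
  have hirr : ∀ k ∈ {i | 0 < X.e i θ}, ∀ j ∈ {i | 0 < X.e i θ}ᶜ, s (α k) (α j) = α j := by
    intro k hk j hj
    have hk : 0 < X.e k θ := hk
    have hj0 : X.e j θ = 0 := le_antisymm (not_lt.1 hj) (hp j)
    have hkj : k ≠ j := by rintro rfl; linarith
    have ak := simple_memo (α := α) (s := s) k
    have aj := simple_memo (α := α) (s := s) j
    have h0 := h.dom X h.theta_high (Set.mem_univ j)
    rw [X.C_symm, C_exp X (X.exp θ hθ)] at h0
    have hterm : ∀ i, X.e i θ * X.C (α j) (α i) ≤ 0 := by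
      intro i
      by_cases hij : j = i
      · rw [← hij, hj0, zero_mul]
      · exact mul_nonpos_of_nonneg_of_nonpos (hp i) (h.C_simple X hij)
    have h1 : X.e k θ * X.C (α j) (α k) = 0 := by
      have := (Finset.sum_eq_zero_iff_of_nonpos (s := Finset.univ)
        (f := fun i => X.e i θ * X.C (α j) (α i)) (fun i _ => hterm i)).1
        (le_antisymm (Finset.sum_nonpos fun i _ => hterm i) h0)
      exact this k (Finset.mem_univ k)
    have h2 : X.C (α j) (α k) = 0 := by
      rcases mul_eq_zero.1 h1 with h2 | h2
      · linarith
      · exact h2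
    rw [refl0 X ak aj, h2]
    simp
  rcases h.irred _ hirr with h1 | h1
  · exfalso
    obtain ⟨k, hk, _⟩ := pick X hθ hp
    have : k ∈ {i | 0 < X.e i θ} := hk
    rw [h1] at this
    exact this
  · have : i ∈ {i | 0 < X.e i θ} := by rw [h1]; trivial
    exact this

theorem theta_max (h : AffineSetup α δ θ B s) (X : Ctx α δ s) {ε : V} (hε : ε ∈ Delo α s) (i : ι) :
    X.e i ε ≤ X.e i θ := by
  rcases X.sgn ε hε with hp | hp
  · obtain ⟨t, ht, hle⟩ := h.climb X hε hp
    have hC : 0 < X.C t θ := by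
      rw [C_exp X (X.exp θ h.theta_high.1)]
      obtain ⟨k, _, hk⟩ := pick X (DeloJ_sub _ ht.1) (high_pos X ht)
      apply Finset.sum_pos'
      · intro j _
        exact mul_nonneg (h.theta_full X j).le (h.dom X ht (Set.mem_univ j))
      · exact ⟨k, Finset.mem_univ _, mul_pos (h.theta_full X k) hk⟩
    rw [h.high_unique X ht h.theta_high hC] at hle
    exact hle i
  · exact (hp i).trans (h.theta_full X i).le

end AffineSetup

/-- A context together with a positivity functional. -/
structure RCtx (α : ι → V) (δ : V) (s : V → V ≃ₗ[ℝ] V) extends Ctx α δ s where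
  ρ : V →ₗ[ℝ] ℝ
  rho_delta : ρ δ = 1
  rho_pos : ∀ ε ∈ Delo α s, (∀ i, 0 ≤ e i ε) → 0 < ρ ε
  rho_small : ∀ ε ∈ Delo α s, |ρ ε| < 1
  rho_e : ∀ v, d v = 0 → (∀ i, 0 ≤ e i v) → 0 ≤ ρ v

namespace AffineSetup

variable {α : ι → V} {δ θ : V} {B : V →ₗ[ℝ] V →ₗ[ℝ] ℝ} {s : V → V ≃ₗ[ℝ] V}

theorem d_root (X : Ctx α δ s) {ε : V} (hε : ε ∈ Delo α s) : X.d ε = 0 := by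
  rw [X.exp ε hε]
  simp [X.d_alpha]

theorem exists_rctx (h : AffineSetup α δ θ B s) : Nonempty (RCtx α δ s) := by
  obtain ⟨X⟩ := h.exists_ctx
  obtain ⟨M, hM⟩ : ∃ M : ℝ, ∀ ε ∈ Delo α s, |ht X ε| ≤ M := by
    obtain ⟨M, hM⟩ := (h.finite.image (fun ε => |ht X ε|)).bddAbove
    exact ⟨M, fun ε hε => hM ⟨ε, hε, rfl⟩⟩
  have hM0 : 0 ≤ M := (abs_nonneg _).trans (hM _ h.theta_high.1)
  have hk : (0 : ℝ) < 1 / (M + 1) := by positivity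
  have ap : ∀ ε ∈ Delo α s, (X.d + (1 / (M + 1)) • ht X) ε = 1 / (M + 1) * ht X ε := by
    intro ε hε
    simp [d_root X hε]
  refine ⟨⟨X, X.d + (1 / (M + 1)) • ht X, ?_, ?_, ?_, ?_⟩⟩
  · simp [X.d_delta, ht_app, X.e_delta]
  · intro ε hε hp
    rw [ap ε hε]
    exact mul_pos hk (ht_pos X hε hp)
  · intro ε hε
    rw [ap ε hε, abs_mul, abs_of_pos hk, one_div, inv_mul_lt_iff₀ (by positivity)]
    have := hM ε hε
    linarith
  · intro v hv hp
    rw [LinearMap.add_apply, hv, zero_add, LinearMap.smul_apply, ht_app]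
    exact mul_nonneg hk.le (Finset.sum_nonneg fun i _ => hp i)

theorem rho_real (X : RCtx α δ s) (m : ℤ) (ε : V) : X.ρ (m • δ + ε) = m + X.ρ ε := by
  rw [map_add, map_zsmul, X.rho_delta]; simp

theorem e_real (X : Ctx α δ s) (m : ℤ) (ε : V) (i : ι) : X.e i (m • δ + ε) = X.e i ε := by
  rw [map_add, map_zsmul, X.e_delta]; simp

theorem rho_ne (h : AffineSetup α δ θ B s) (X : RCtx α δ s) {ε : V} (hε : ε ∈ Delo α s) :
    X.ρ ε ≠ 0 := by
  rcases X.sgn ε hε with hp | hp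
  · exact (X.rho_pos ε hε hp).ne'
  · have := X.rho_pos (-ε) (h.neg_mem hε) (fun i => by rw [map_neg]; linarith [hp i])
    rw [map_neg] at this
    linarith

theorem e_of_rho (h : AffineSetup α δ θ B s) (X : RCtx α δ s) {ε : V} (hε : ε ∈ Delo α s)
    (hp : 0 < X.ρ ε) : ∀ i, 0 ≤ X.e i ε := by
  rcases X.sgn ε hε with hq | hq
  · exact hq
  · have := X.rho_pos (-ε) (h.neg_mem hε) (fun i => by rw [map_neg]; linarith [hq i])
    rw [map_neg] at this
    linarith

theorem pos_iff (X : RCtx α δ s) {ε : V} (hε : ε ∈ Delo α s) (m : ℤ) :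
    0 < X.ρ (m • δ + ε) ↔ 1 ≤ m ∨ (m = 0 ∧ 0 < X.ρ ε) := by
  have := abs_lt.1 (X.rho_small ε hε)
  rw [rho_real]
  constructor
  · intro h1
    rcases lt_trichotomy m 0 with h2 | h2 | h2
    · have : (m : ℝ) ≤ -1 := by exact_mod_cast (by omega : m ≤ -1)
      linarith
    · right; refine ⟨h2, ?_⟩; rw [h2] at h1; simpa using h1
    · left; omega
  · rintro (h1 | ⟨rfl, h1⟩)
    · have : (1 : ℝ) ≤ m := by exact_mod_cast h1
      linarith
    · simpa using h1

theorem real_ne (h : AffineSetup α δ θ B s) (X : RCtx α δ s) {ε : V} (hε : ε ∈ Delo α s) (m : ℤ) :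
    X.ρ (m • δ + ε) ≠ 0 := by
  have := abs_lt.1 (X.rho_small ε hε)
  rw [rho_real]
  intro h0
  have h1 : (-1 : ℝ) < m := by linarith
  have h2 : (m : ℝ) < 1 := by linarith
  have h3 : m = 0 := by
    have h1' : (-1 : ℤ) < m := by exact_mod_cast h1
    have h2' : m < 1 := by exact_mod_cast h2
    omega
  rw [h3] at h0
  exact h.rho_ne X hε (by simpa using h0)

theorem posComb_of (h : AffineSetup α δ θ B s) (X : Ctx α δ s) (m : ℤ) (hm : 0 ≤ m) (v : V)
    (hv : v = ∑ i, X.e i v • α i) (hp : ∀ i, 0 ≤ m * X.e i θ + X.e i v) :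
    PosComb α δ θ (m • δ + v) := by
  refine ⟨fun o => o.elim (m : ℝ) (fun i => m * X.e i θ + X.e i v), ?_, ?_⟩
  · rintro (_ | i)
    · simpa using hm
    · exact hp i
  · rw [Fintype.sum_option]
    simp only [alHat, Option.elim]
    conv_lhs => rw [hv, ← Int.cast_smul_eq_zsmul ℝ]
    simp only [add_smul, Finset.sum_add_distrib, mul_smul, ← Finset.smul_sum, smul_sub]
    rw [← X.exp θ h.theta_high.1]
    abel

theorem rho_comb (h : AffineSetup α δ θ B s) (X : RCtx α δ s) {v : V} (hv : PosComb α δ θ v) :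
    0 ≤ X.ρ v := by
  obtain ⟨c, hc, rfl⟩ := hv
  rw [map_sum]
  apply Finset.sum_nonneg
  rintro (_ | i) _
  · rw [map_smul]
    refine mul_nonneg (hc _) ?_
    have := abs_lt.1 (X.rho_small θ h.theta_high.1)
    simp only [alHat, Option.elim, map_sub, X.rho_delta]
    linarith
  · rw [map_smul]
    refine mul_nonneg (hc _) (X.rho_pos _ (simple_memo i) fun j => ?_).le
    by_cases hj : j = i
    · rw [hj, X.e_same]; norm_num
    · rw [X.e_diff _ _ hj]

theorem del_ne (h : AffineSetup α δ θ B s) (X : RCtx α δ s) {v : V} (hv : v ∈ Del α δ s) :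
    X.ρ v ≠ 0 := by
  rcases hv with ⟨m, ε, hε, rfl⟩ | ⟨m, hm, rfl⟩
  · exact h.real_ne X hε m
  · rw [map_zsmul, X.rho_delta]; simpa using hm

theorem delPos_iff (h : AffineSetup α δ θ B s) (X : RCtx α δ s) {v : V} :
    v ∈ DelPos α δ θ s ↔ v ∈ Del α δ s ∧ 0 < X.ρ v := by
  constructor
  · rintro ⟨h1, h2⟩
    exact ⟨h1, lt_of_le_of_ne (h.rho_comb X h2) (h.del_ne X h1).symm⟩
  · rintro ⟨h1, h2⟩
    refine ⟨h1, ?_⟩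
    have ht0 := fun i => (h.theta_full X.toCtx i).le
    rcases h1 with ⟨m, ε, hε, rfl⟩ | ⟨m, hm, rfl⟩
    · rcases (pos_iff X hε m).1 h2 with h3 | ⟨rfl, h3⟩
      · refine h.posComb_of X.toCtx m (by omega) ε (X.exp ε hε) fun i => ?_
        have h4 := h.theta_max X.toCtx (h.neg_mem hε) i
        rw [map_neg] at h4
        have h5 : (1 : ℝ) ≤ m := by exact_mod_cast h3
        nlinarith [ht0 i]
      · refine h.posComb_of X.toCtx 0 le_rfl ε (X.exp ε hε) fun i => ?_
        simpa using h.e_of_rho X hε h3 i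
    · rw [map_zsmul, X.rho_delta] at h2
      have h5 : (0 : ℝ) < m := by simpa using h2
      have := h.posComb_of X.toCtx m (by exact_mod_cast h5.le) 0 (by simp) fun i => by
        have := mul_nonneg h5.le (ht0 i)
        simpa using this
      simpa using this

theorem del_neg_mem (h : AffineSetup α δ θ B s) {v : V} (hv : v ∈ Del α δ s) : -v ∈ Del α δ s := by
  rcases hv with ⟨m, ε, hε, rfl⟩ | ⟨m, hm, rfl⟩
  · exact Or.inl ⟨-m, -ε, h.neg_mem hε, by rw [neg_smul]; abel⟩
  · exact Or.inr ⟨-m, by omega, by rw [neg_smul]⟩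

theorem delNeg_iff (h : AffineSetup α δ θ B s) (X : RCtx α δ s) {v : V} :
    v ∈ DelNeg α δ θ s ↔ v ∈ Del α δ s ∧ X.ρ v < 0 := by
  rw [DelNeg, Set.mem_ofPred_eq, h.delPos_iff X, map_neg]
  constructor
  · rintro ⟨h1, h2⟩
    exact ⟨by simpa using h.del_neg_mem h1, by linarith⟩
  · rintro ⟨h1, h2⟩
    exact ⟨h.del_neg_mem h1, by linarith⟩

theorem brSet_iff (h : AffineSetup α δ θ B s) (X : RCtx α δ s) {P : Set V} (hP : P ⊆ Delo α s)
    {v : V} : v ∈ brSet α δ θ s P ↔ ∃ m : ℤ, ∃ ε ∈ P, v = m • δ + ε ∧ 0 < X.ρ v := by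
  simp only [brSet, Set.mem_iUnion, brkt, Set.mem_inter_iff, Set.mem_ofPred_eq, DelRePos]
  constructor
  · rintro ⟨ε, hε, ⟨m, rfl⟩, _, h2⟩
    exact ⟨m, ε, hε, rfl, ((h.delPos_iff X).1 h2).2⟩
  · rintro ⟨m, ε, hε, rfl, h2⟩
    have hr : m • δ + ε ∈ DelRe α δ s := ⟨m, ε, hP hε, rfl⟩
    have hm : 0 ≤ m := by
      rcases (pos_iff X (hP hε) m).1 h2 with h3 | h3 <;> omega
    refine ⟨ε, hε, ⟨m.toNat, ?_⟩, hr, (h.delPos_iff X).2 ⟨Or.inl hr, h2⟩⟩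
    rw [Int.toNat_of_nonneg hm]

theorem brJ_iff (h : AffineSetup α δ θ B s) (X : RCtx α δ s) {J : Set ι} {v : V} :
    v ∈ brSet α δ θ s (DeloJ α s J) ↔ v ∈ DelReJ α δ s J ∧ 0 < X.ρ v := by
  rw [h.brSet_iff X (DeloJ_sub J)]
  constructor
  · rintro ⟨m, ε, hε, h1, h2⟩
    exact ⟨⟨m, ε, hε, h1⟩, h2⟩
  · rintro ⟨⟨m, ε, hε, h1⟩, h2⟩
    exact ⟨m, ε, hε, h1, h2⟩

theorem A_iff (h : AffineSetup α δ θ B s) (X : RCtx α δ s) {J : Set ι} {v : V} :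
    v ∈ DelJPosB α δ θ s J ↔
      (v ∈ DelReJ α δ s J ∧ 0 < X.ρ v) ∨ ∃ m : ℤ, 1 ≤ m ∧ v = m • δ := by
  rw [DelJPosB, Set.mem_union, h.brJ_iff X]
  refine or_congr Iff.rfl ⟨?_, ?_⟩
  · rintro ⟨m, hm, rfl⟩
    exact ⟨m, by omega, rfl⟩
  · rintro ⟨m, hm, rfl⟩
    exact ⟨m.toNat, by omega, by rw [Int.toNat_of_nonneg (by omega)]⟩

theorem reJ_sub {J : Set ι} {v : V} (hv : v ∈ DelReJ α δ s J) : v ∈ DelRe α δ s := by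
  obtain ⟨m, ε, hε, rfl⟩ := hv
  exact ⟨m, ε, DeloJ_sub J hε, rfl⟩

theorem rePos_iff (h : AffineSetup α δ θ B s) (X : RCtx α δ s) {v : V} :
    v ∈ DelRePos α δ θ s ↔ v ∈ DelRe α δ s ∧ 0 < X.ρ v := by
  rw [DelRePos, Set.mem_inter_iff, h.delPos_iff X]
  exact ⟨fun hh => ⟨hh.1, hh.2.2⟩, fun hh => ⟨hh.1, Or.inl hh.1, hh.2⟩⟩

theorem im_not_real (X : RCtx α δ s) (m : ℤ) :
    m • δ ∉ DelRe α δ s := by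
  rintro ⟨n, ε, hε, h1⟩
  apply X.ne_zero ε hε
  rw [X.exp ε hε]
  have h2 : ∀ i, X.e i ε = 0 := by
    intro i
    have := congrArg (X.e i) h1
    rw [e_real, map_zsmul, X.e_delta] at this
    simpa using this.symm
  simp [h2]

/-- The inversion sets as given in the statement agree with the general ones. -/
theorem Phi_eq (h : AffineSetup α δ θ B s) (X : RCtx α δ s) {J : Set ι} {y : V ≃ₗ[ℝ] V}
    (hy : ∀ v ∈ DelReJ α δ s J, y⁻¹ v ∈ DelRe α δ s) (hd : y⁻¹ δ = δ) :
    PhiJb α δ θ s J y = Nn (DelReJ α δ s J) X.ρ y := by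
  ext v
  rw [PhiJb, Set.mem_ofPred_eq, h.A_iff X, h.delNeg_iff X]
  constructor
  · rintro ⟨h1 | ⟨m, hm, rfl⟩, h2, h3⟩
    · exact ⟨h1.1, h1.2, h3⟩
    · exfalso
      rw [map_zsmul, hd, map_zsmul, X.rho_delta] at h3
      have : (1 : ℝ) ≤ m := by exact_mod_cast hm
      simp at h3
      linarith
  · rintro ⟨h1, h2, h3⟩
    exact ⟨Or.inl ⟨h1, h2⟩, Or.inl (hy v h1), h3⟩

end AffineSetup

namespace AffineSetup

variable {α : ι → V} {δ θ : V} {B : V →ₗ[ℝ] V →ₗ[ℝ] ℝ} {s : V → V ≃ₗ[ℝ] V}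

theorem simple_pos (X : RCtx α δ s) (j : ι) : 0 < X.ρ (α j) := by
  refine X.rho_pos _ (simple_memo j) fun i => ?_
  by_cases hj : i = j
  · rw [hj, X.e_same]; norm_num
  · rw [X.e_diff _ _ hj]

theorem coxFin (h : AffineSetup α δ θ B s) (X : RCtx α δ s) (J : Set ι) :
    CoxD (DeloJ α s J) (α '' J) X.ρ s := by
  refine ⟨fun β hβ => h.neg_mem hβ, fun β hβ => h.rho_ne X (DeloJ_sub J hβ), ?_, ?_, ?_, ?_, ?_, ?_,
    ?_⟩
  · rintro _ ⟨j, hj, rfl⟩; exact simple_mem hj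
  · rintro _ ⟨j, hj, rfl⟩; exact simple_pos X j
  · rintro _ ⟨j, hj, rfl⟩ β hβ; exact h.srefl_app (simple_mem hj) hβ
  · rintro _ ⟨j, hj, rfl⟩ β hβ hp hne
    have hβ' := DeloJ_sub J hβ
    have hm := DeloJ_sub J (h.srefl_app (simple_mem hj) hβ)
    have hpe := h.e_of_rho X hβ' hp
    apply X.rho_pos _ hm
    obtain ⟨i, hij, hi⟩ : ∃ i, i ≠ j ∧ X.e i β ≠ 0 := by
      by_contra hcon
      push Not at hcon
      exact hne (h.mult X.toCtx hβ' hpe hcon)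
    have hei : X.e i (s (α j) β) = X.e i β := by
      rw [refl0 X.toCtx (simple_memo j) hβ', map_sub, map_smul, X.e_diff _ _ hij]
      simp
    rcases X.sgn _ hm with h1 | h1
    · exact h1
    · have h2 := h1 i
      rw [hei] at h2
      exact absurd (le_antisymm h2 (hpe i)) hi
  · rintro _ ⟨j, hj, rfl⟩; exact h.self (h.nz (simple_memo j))
  · rintro _ ⟨j, hj, rfl⟩; exact h.sq (h.nz (simple_memo j))
  · rintro _ ⟨j, hj, rfl⟩ b hb w hw rfl
    rw [← WoJ_eq] at hw
    exact h.conj_gen (h.WoJ_iso hw) (h.nz (simple_memo j))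

theorem bicFin (h : AffineSetup α δ θ B s) (X : RCtx α δ s) (J : Set ι) :
    BicD (DeloJ α s J) (α '' J) X.ρ s {v | v ∈ DeloJ α s J ∧ 0 < X.ρ v} := by
  refine ⟨h.coxFin X J, fun β h1 h2 => ⟨h1, h2⟩, fun x hx => hx.2, fun x hx hn => absurd hx.1 hn, ?_⟩
  intro β hβ hp hn
  obtain ⟨j, hj, h1, h2⟩ := h.dec_pos X.toCtx hβ (h.e_of_rho X (DeloJ_sub J hβ) hp) hn
  exact ⟨β - α j, ⟨h1, X.rho_pos _ (DeloJ_sub J h1) h2⟩, α j, ⟨simple_mem hj, simple_pos X j⟩, by abel⟩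

theorem real_refl (h : AffineSetup α δ θ B s) (X : Ctx α δ s) {ε η : V} (hε : ε ∈ Delo α s)
    (hη : η ∈ Delo α s) (m n : ℤ) : ∃ c : ℤ, 2 * X.C η ε / X.C ε ε = c ∧
      s ε η = η - (c : ℝ) • ε ∧ s (m • δ + ε) (n • δ + η) = (n - c * m) • δ + s ε η := by
  obtain ⟨c, hc⟩ := h.cart X hη hε
  refine ⟨c, hc, ?_, ?_⟩
  · rw [refl0 X hε hη, hc]
  · rw [X.refl ε hε η hη, refl0 X hε hη, hc]
    rw [Int.cast_smul_eq_zsmul, Int.cast_smul_eq_zsmul, smul_add, sub_smul, mul_smul]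
    abel

theorem PiJ_form (h : AffineSetup α δ θ B s) {J : Set ι} {a : V} (ha : a ∈ PiJ α δ s J) :
    ∃ m : ℤ, ∃ ε ∈ DeloJ α s J, a = m • δ + ε := by
  rcases ha with ⟨j, hj, rfl⟩ | ⟨t, ht, rfl⟩
  · exact ⟨0, α j, simple_mem hj, by simp⟩
  · exact ⟨1, -t, h.neg_mem ht.1, by simp [sub_eq_add_neg]⟩

theorem real_nz (h : AffineSetup α δ θ B s) {a : V} (ha : a ∈ DelRe α δ s) : B a a ≠ 0 := by
  obtain ⟨m, ε, hε, rfl⟩ := ha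
  rw [h.B_real hε]
  exact h.nz hε

theorem perm_aff (h : AffineSetup α δ θ B s) (X : RCtx α δ s) {J : Set ι} {t η : V}
    (ht : t ∈ HighRoots α s J) (hη : η ∈ DeloJ α s J) (n : ℤ) (hp : 0 < X.ρ (n • δ + η))
    (hne : n • δ + η ≠ δ - t) : 0 < X.ρ (s (δ - t) (n • δ + η)) := by
  have ht' := DeloJ_sub J ht.1
  have hnt := h.neg_mem ht'
  have hη' := DeloJ_sub J hη
  have tpos := X.rho_pos t ht' (high_pos X.toCtx ht)
  have e1 : δ - t = (1 : ℤ) • δ + -t := by simp [sub_eq_add_neg]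
  obtain ⟨c, hc, hs, hr⟩ := h.real_refl X.toCtx hnt hη' 1 n
  rw [← e1, mul_one] at hr
  have hsm : s (-t) η ∈ Delo α s := DeloJ_sub J (h.srefl_app (h.neg_mem ht.1) hη)
  have hn := (pos_iff X hη' n).1 hp
  rw [hr, pos_iff X hsm]
  have hCt := X.C_pos t ht'
  have hCt2 : X.C (-t) (-t) = X.C t t := by simp
  rw [hCt2, Cneg] at hc
  rcases lt_trichotomy c 0 with h1 | h1 | h1
  · left; omega
  · rw [h1] at hs ⊢
    simp only [Int.cast_zero, zero_smul, sub_zero] at hs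
    rw [hs]; simpa using hn
  · have h1' : (0 : ℝ) < c := by exact_mod_cast h1
    have hneg : X.C η t < 0 := by
      rw [← hc] at h1'
      by_contra hcon
      push Not at hcon
      have : 2 * -X.C η t / X.C t t ≤ 0 := div_nonpos_of_nonpos_of_nonneg (by linarith) hCt.le
      linarith
    have hnp : ¬ 0 < X.ρ η := by
      intro h2
      have := h.dom_root X.toCtx ht hη (h.e_of_rho X hη' h2)
      rw [X.C_symm] at this
      linarith
    have hn1 : 1 ≤ n := by
      rcases hn with h2 | h2
      · exact h2
      · exact absurd h2.2 hnp
    have hpos : 0 < X.C (-η) t := by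
      rw [X.C_symm, Cneg, X.C_symm]; linarith
    by_cases hηt : -η = t
    · have hη2 : η = -t := by rw [← hηt]; simp
      have hc2 : c = 2 := by
        rw [hη2] at hc
        have : X.C (-t) t = - X.C t t := by rw [X.C_symm, Cneg]
        rw [this, neg_neg, mul_div_assoc, div_self hCt.ne'] at hc
        have : (c : ℝ) = 2 := by linarith
        exact_mod_cast this
      have hn2 : n ≠ 1 := by
        rintro rfl
        apply hne
        rw [e1, hη2]
      have : s (-t) η = t := by
        rw [hs, hc2, hη2]
        push_cast
        rw [two_smul]; abel
      rw [this]
      rcases (by omega : 1 ≤ n - c ∨ n - c = 0) with h3 | h3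
      · exact Or.inl h3
      · exact Or.inr ⟨h3, tpos⟩
    · have h2 := h.high_one X.toCtx ht (h.neg_mem hη) hpos hηt
      have hc1 : c = 1 := by
        have e3 : X.C (-η) t = - X.C η t := by rw [X.C_symm, Cneg, X.C_symm]
        rw [e3, hc] at h2
        exact_mod_cast h2
      have hle := h.high_le X.toCtx ht (h.neg_mem hη) hpos
      have hst : s (-t) η = η + t := by rw [hs, hc1]; simp
      rcases (by omega : 1 ≤ n - c ∨ n - c = 0) with h3 | h3
      · exact Or.inl h3
      · refine Or.inr ⟨h3, lt_of_le_of_ne ?_ (h.rho_ne X hsm).symm⟩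
        apply X.rho_e _ (d_root X.toCtx hsm)
        intro i
        have := hle i
        rw [map_neg] at this
        rw [hst, map_add]
        linarith

theorem coxAff (h : AffineSetup α δ θ B s) (X : RCtx α δ s) (J : Set ι) :
    CoxD (DelReJ α δ s J) (PiJ α δ s J) X.ρ s := by
  have hsub : ∀ a ∈ PiJ α δ s J, a ∈ DelReJ α δ s J := fun a ha => h.PiJ_form ha
  refine ⟨?_, ?_, hsub, ?_, ?_, ?_, ?_, ?_, ?_⟩
  · rintro _ ⟨m, ε, hε, rfl⟩
    exact ⟨-m, -ε, h.neg_mem hε, by rw [neg_smul]; abel⟩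
  · rintro _ ⟨m, ε, hε, rfl⟩
    exact h.real_ne X (DeloJ_sub J hε) m
  · rintro _ (⟨j, hj, rfl⟩ | ⟨t, ht, rfl⟩)
    · exact simple_pos X j
    · have := abs_lt.1 (X.rho_small t (DeloJ_sub J ht.1))
      simp only [map_sub, X.rho_delta]
      linarith
  · rintro a ha _ ⟨n, η, hη, rfl⟩
    obtain ⟨m, ε, hε, rfl⟩ := h.PiJ_form ha
    obtain ⟨c, _, _, h1⟩ := h.real_refl X.toCtx (DeloJ_sub J hε) (DeloJ_sub J hη) m n
    exact ⟨_, _, h.srefl_app hε hη, h1⟩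
  · rintro a ha _ ⟨n, η, hη, rfl⟩ hp hne
    rcases ha with ⟨j, hj, rfl⟩ | ⟨t, ht, rfl⟩
    · obtain ⟨c, _, _, h1⟩ := h.real_refl X.toCtx (simple_memo j) (DeloJ_sub J hη) 0 n
      simp only [zero_smul, zero_add, mul_zero, sub_zero] at h1
      rw [h1, pos_iff X (DeloJ_sub J (h.srefl_app (simple_mem hj) hη))]
      rcases (pos_iff X (DeloJ_sub J hη) n).1 hp with h2 | ⟨rfl, h2⟩
      · exact Or.inl h2
      · refine Or.inr ⟨rfl, ?_⟩
        apply (h.coxFin X J).perm _ ⟨j, hj, rfl⟩ η hη h2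
        simpa using hne
    · exact h.perm_aff X ht hη n hp hne
  · intro a ha; exact h.self (h.real_nz (reJ_sub (hsub a ha)))
  · intro a ha; exact h.sq (h.real_nz (reJ_sub (hsub a ha)))
  · rintro a ha b hb w hw rfl
    exact h.conj_gen (h.clos_iso (fun a ha => h.real_nz (reJ_sub (hsub a ha))) hw)
      (h.real_nz (reJ_sub (hsub a ha)))

theorem A_delta (h : AffineSetup α δ θ B s) (X : RCtx α δ s) (J : Set ι) :
    δ ∈ DelJPosB α δ θ s J := (h.A_iff X).2 (Or.inr ⟨1, le_rfl, by simp⟩)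

theorem bicAff (h : AffineSetup α δ θ B s) (X : RCtx α δ s) (J : Set ι) :
    BicD (DelReJ α δ s J) (PiJ α δ s J) X.ρ s (DelJPosB α δ θ s J) := by
  refine ⟨h.coxAff X J, fun β h1 h2 => (h.A_iff X).2 (Or.inl ⟨h1, h2⟩), ?_, ?_, ?_⟩
  · intro x hx
    rcases (h.A_iff X).1 hx with h1 | ⟨m, hm, rfl⟩
    · exact h1.2
    · rw [map_zsmul, X.rho_delta]
      have : (1 : ℝ) ≤ m := by exact_mod_cast hm
      simp; linarith
  · intro x hx hn a ha
    rcases (h.A_iff X).1 hx with h1 | ⟨m, hm, rfl⟩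
    · exact absurd h1.1 hn
    · obtain ⟨n, ε, hε, rfl⟩ := h.PiJ_form ha
      rw [map_zsmul, X.refl_delta ε (DeloJ_sub J hε)]
  · rintro _ ⟨m, ε, hε, rfl⟩ hp hn
    have hε' := DeloJ_sub J hε
    by_cases h1 : 1 ≤ m ∧ 0 < X.ρ ((m - 1) • δ + ε)
    · refine ⟨δ, h.A_delta X J, (m - 1) • δ + ε,
        (h.A_iff X).2 (Or.inl ⟨⟨_, _, hε, rfl⟩, h1.2⟩), ?_⟩
      rw [sub_smul, one_smul]; abel
    · rw [pos_iff X hε'] at h1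
      rcases (pos_iff X hε' m).1 hp with h2 | ⟨rfl, h2⟩
      · have hm : m = 1 := by
          by_contra hm
          exact h1 ⟨h2, Or.inl (by omega)⟩
        subst hm
        have hneg : ¬ 0 < X.ρ ε := fun h3 => h1 ⟨le_rfl, Or.inr ⟨by norm_num, h3⟩⟩
        have hnp : 0 < X.ρ (-ε) := by
          rw [map_neg]
          have := lt_of_le_of_ne (not_lt.1 hneg) (h.rho_ne X hε')
          linarith
        have hpe := h.e_of_rho X (h.neg_mem hε') hnp
        have hnh : -ε ∉ HighRoots α s J := by
          intro h3
          apply hn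
          right
          exact ⟨-ε, h3, by simp⟩
        have : ∃ j ∈ J, -ε + α j ∈ DeloJ α s J := by
          by_contra hcon
          push Not at hcon
          exact hnh ⟨h.neg_mem hε, (X.poso _ (h.neg_mem hε')).2 hpe, hcon⟩
        obtain ⟨j, hj, hm⟩ := this
        have hm' : ε - α j ∈ DeloJ α s J := by
          have := h.neg_mem hm
          rwa [neg_add, neg_neg, ← sub_eq_add_neg] at this
        refine ⟨(1 : ℤ) • δ + (ε - α j), (h.A_iff X).2 (Or.inl ⟨⟨_, _, hm', rfl⟩, ?_⟩), α j,
          (h.A_iff X).2 (Or.inl ⟨⟨0, α j, simple_mem hj, by simp⟩, simple_pos X j⟩), by abel⟩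
        exact (pos_iff X (DeloJ_sub J hm') 1).2 (Or.inl le_rfl)
      · have hn' : ε ∉ α '' J := by
          intro h3
          apply hn
          left
          simpa using h3
        obtain ⟨x, hx, y, hy, hxy⟩ := (h.bicFin X J).dec ε hε h2 hn'
        refine ⟨x, (h.A_iff X).2 (Or.inl ⟨⟨0, x, hx.1, by simp⟩, hx.2⟩), y,
          (h.A_iff X).2 (Or.inl ⟨⟨0, y, hy.1, by simp⟩, hy.2⟩), by simpa using hxy⟩

end AffineSetup

namespace AffineSetup

variable {α : ι → V} {δ θ : V} {B : V →ₗ[ℝ] V →ₗ[ℝ] ℝ} {s : V → V ≃ₗ[ℝ] V}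

theorem WJ_delta (h : AffineSetup α δ θ B s) (X : RCtx α δ s) {J : Set ι} {x : V ≃ₗ[ℝ] V}
    (hx : x ∈ WJ α δ s J) : x δ = δ := by
  induction hx using Subgroup.closure_induction with
  | mem x hx =>
    obtain ⟨a, ha, rfl⟩ := hx
    obtain ⟨m, ε, hε, rfl⟩ := h.PiJ_form ha
    exact X.refl_delta ε (DeloJ_sub J hε) m
  | one => rfl
  | mul x y _ _ hx hy => rw [LinearEquiv.mul_apply, hy, hx]
  | inv x _ hx => conv_lhs => rw [← hx, inv_app]

theorem WoJ_le (J : Set ι) : WoJ α s J ≤ WJ α δ s J := by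
  rw [WoJ_eq]
  exact Subgroup.closure_mono (Set.image_mono Set.subset_union_left)

theorem WJ_app (h : AffineSetup α δ θ B s) (X : RCtx α δ s) {J : Set ι} {x : V ≃ₗ[ℝ] V}
    (hx : x ∈ WJ α δ s J) {v : V} (hv : v ∈ DelReJ α δ s J) : x v ∈ DelReJ α δ s J :=
  (h.coxAff X J).mapR hx hv

theorem WJ_iapp (h : AffineSetup α δ θ B s) (X : RCtx α δ s) {J : Set ι} {x : V ≃ₗ[ℝ] V}
    (hx : x ∈ WJ α δ s J) {v : V} (hv : v ∈ DelReJ α δ s J) : x⁻¹ v ∈ DelReJ α δ s J :=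
  h.WJ_app X (Subgroup.inv_mem _ hx) hv

theorem Phi_WJ (h : AffineSetup α δ θ B s) (X : RCtx α δ s) {J : Set ι} {y : V ≃ₗ[ℝ] V}
    (hy : y ∈ WJ α δ s J) : PhiJb α δ θ s J y = Nn (DelReJ α δ s J) X.ρ y :=
  h.Phi_eq X (fun _ hv => reJ_sub (h.WJ_iapp X hy hv)) (h.WJ_delta X (Subgroup.inv_mem _ hy))

theorem fin_half (h : AffineSetup α δ θ B s) (X : RCtx α δ s) (J : Set ι) (φ : V →ₗ[ℝ] ℝ)
    (hφ : 0 < φ δ) : {β | β ∈ DelReJ α δ s J ∧ 0 < X.ρ β ∧ φ β < 0}.Finite := by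
  obtain ⟨M, hM⟩ : ∃ M : ℝ, ∀ ε ∈ Delo α s, -φ ε ≤ M := by
    obtain ⟨M, hM⟩ := (h.finite.image (fun ε => -φ ε)).bddAbove
    exact ⟨M, fun ε hε => hM ⟨ε, hε, rfl⟩⟩
  apply (((Set.finite_Icc (0 : ℤ) ⌊M / φ δ⌋).prod h.finite).image
    (fun p : ℤ × V => p.1 • δ + p.2)).subset
  rintro _ ⟨⟨m, ε, hε, rfl⟩, h1, h2⟩
  refine ⟨(m, ε), ⟨⟨?_, ?_⟩, DeloJ_sub J hε⟩, rfl⟩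
  · rcases (pos_iff X (DeloJ_sub J hε) m).1 h1 with h3 | h3 <;> simp only <;> omega
  · simp only
    rw [Int.le_floor, le_div_iff₀ hφ]
    rw [map_add, map_zsmul] at h2
    simp at h2
    have := hM ε (DeloJ_sub J hε)
    linarith

theorem half_word (h : AffineSetup α δ θ B s) (X : RCtx α δ s) (J : Set ι) (φ : V →ₗ[ℝ] ℝ)
    (hφ : 0 < φ δ) : ∃ w ∈ WJ α δ s J, Nn (DelReJ α δ s J) X.ρ w =
      {β | β ∈ DelReJ α δ s J ∧ 0 < X.ρ β ∧ φ β < 0} := by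
  refine (h.bicAff X J).finite_bic _ _ (h.fin_half X J φ hφ) rfl (fun β hβ => hβ.1) ?_
  apply (h.bicAff X J).half_bic
  intro x hx hn
  rcases (h.A_iff X).1 hx with h1 | ⟨m, hm, rfl⟩
  · exact absurd h1.1 hn
  · rw [map_zsmul]
    have : (1 : ℝ) ≤ m := by exact_mod_cast hm
    simp
    exact mul_nonneg (by linarith) hφ.le

theorem s_neg (h : AffineSetup α δ θ B s) {a : V} (ha : B a a ≠ 0) : s (-a) = s a := by
  ext v
  rw [h.refl_def a ha, h.refl_def (-a) (by simpa using ha)]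
  simp [neg_div]

theorem refl_mem (h : AffineSetup α δ θ B s) (X : RCtx α δ s) {J : Set ι} {β : V}
    (hβ : β ∈ DelReJ α δ s J) : s β ∈ WJ α δ s J := by
  have main : ∀ β ∈ DelReJ α δ s J, 0 < X.ρ β → s β ∈ WJ α δ s J := by
    intro β hβ hp
    obtain ⟨m, ε, hε, e⟩ := id hβ
    have hC := X.C_pos ε (DeloJ_sub J hε)
    obtain ⟨w, hw, hN⟩ := h.half_word X J (X.d - ((m + 1) / X.C ε ε) • X.C ε) (by
      simp [X.d_delta, X.C_symm ε δ, X.C_delta])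
    have hmem : β ∈ Nn (DelReJ α δ s J) X.ρ w := by
      rw [hN]
      refine ⟨hβ, hp, ?_⟩
      rw [e, map_add, map_zsmul]
      simp only [LinearMap.sub_apply, LinearMap.smul_apply, X.d_delta, X.C_symm ε δ, X.C_delta,
        d_root X.toCtx (DeloJ_sub J hε), smul_eq_mul]
      rw [div_mul_cancel₀ _ hC.ne']
      simp
    obtain ⟨l, hl, rfl⟩ := (h.coxAff X J).exists_word hw
    obtain ⟨w', hw', a, ha, rfl⟩ := (h.coxAff X J).orbit l hl β hβ hp hmem.2.2
    have hX : ∀ a ∈ PiJ α δ s J, B a a ≠ 0 :=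
      fun a ha => h.real_nz (reJ_sub (h.PiJ_form ha))
    rw [← h.conj_gen (h.clos_iso hX hw') (hX a ha)]
    exact Subgroup.mul_mem _ (Subgroup.mul_mem _ hw' (CoxD.mem_gen ha)) (Subgroup.inv_mem _ hw')
  rcases lt_or_gt_of_ne ((h.coxAff X J).ne β hβ) with h1 | h1
  · rw [← h.s_neg (h.real_nz (reJ_sub hβ))]
    exact main _ ((h.coxAff X J).neg β hβ) (by rw [map_neg]; linarith)
  · exact main β hβ h1

theorem reJ_mono {J K : Set ι} (hK : K ⊆ J) {v : V} (hv : v ∈ DelReJ α δ s K) :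
    v ∈ DelReJ α δ s J := by
  obtain ⟨m, ε, hε, rfl⟩ := hv
  exact ⟨m, ε, DeloJ_mono hK hε, rfl⟩

theorem WJ_mono (h : AffineSetup α δ θ B s) (X : RCtx α δ s) {J K : Set ι} (hK : K ⊆ J) :
    WJ α δ s K ≤ WJ α δ s J := by
  rw [WJ, Subgroup.closure_le]
  rintro _ ⟨a, ha, rfl⟩
  exact h.refl_mem X (reJ_mono hK (h.PiJ_form ha))

theorem proj (h : AffineSetup α δ θ B s) (X : RCtx α δ s) {J : Set ι} {x : V ≃ₗ[ℝ] V}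
    (hx : x ∈ WJ α δ s J) : ∃ w ∈ WoJ α s J, ∀ v ∈ DelReJ α δ s J, ∃ c : ℝ,
      x v = w v + c • δ := by
  suffices H : x ∈ WJ α δ s J ∧ ∃ w ∈ WoJ α s J, ∀ v ∈ DelReJ α δ s J, ∃ c : ℝ,
      x v = w v + c • δ from H.2
  induction hx using Subgroup.closure_induction with
  | mem x hx =>
    refine ⟨Subgroup.subset_closure hx, ?_⟩
    obtain ⟨a, ha, rfl⟩ := hx
    obtain ⟨m, ε, hε, rfl⟩ := h.PiJ_form ha
    refine ⟨s ε, h.srefl_mem hε, ?_⟩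
    rintro _ ⟨n, η, hη, rfl⟩
    obtain ⟨c, _, _, h1⟩ := h.real_refl X.toCtx (DeloJ_sub J hε) (DeloJ_sub J hη) m n
    obtain ⟨c', _, _, h2⟩ := h.real_refl X.toCtx (DeloJ_sub J hε) (DeloJ_sub J hη) 0 n
    refine ⟨((-(c * m) : ℤ) : ℝ), ?_⟩
    rw [zero_smul, zero_add] at h2
    rw [h1, h2, Int.cast_smul_eq_zsmul, mul_zero, sub_zero, sub_smul, neg_smul]
    abel
  | one => exact ⟨Subgroup.one_mem _, 1, Subgroup.one_mem _, fun v _ => ⟨0, by simp⟩⟩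
  | mul x y _ _ hx hy =>
    obtain ⟨mx, w, hw, h1⟩ := hx
    obtain ⟨my, z, hz, h2⟩ := hy
    refine ⟨Subgroup.mul_mem _ mx my, w * z, Subgroup.mul_mem _ hw hz, fun v hv => ?_⟩
    obtain ⟨c, hc⟩ := h1 _ (h.WJ_app X my hv)
    obtain ⟨c', hc'⟩ := h2 v hv
    refine ⟨c' + c, ?_⟩
    rw [LinearEquiv.mul_apply, hc, hc', map_add, map_smul, h.WJ_delta X (WoJ_le J hw), add_smul,
      add_assoc]
    rfl
  | inv x _ hx =>
    obtain ⟨mx, w, hw, h1⟩ := hx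
    refine ⟨Subgroup.inv_mem _ mx, w⁻¹, Subgroup.inv_mem _ hw, fun v hv => ?_⟩
    obtain ⟨c, hc⟩ := h1 _ (h.WJ_iapp X mx hv)
    refine ⟨-c, ?_⟩
    rw [app_inv] at hc
    conv_rhs => rw [hc]
    rw [map_add, map_smul, inv_app, h.WJ_delta X (WoJ_le J (Subgroup.inv_mem _ hw))]
    simp

theorem gen_eq : (Set.range fun i => s (α i)) = s '' (α '' Set.univ) := by
  rw [Set.image_univ, ← Set.range_comp]; rfl

theorem min_simple (h : AffineSetup α δ θ B s) (X : RCtx α δ s) {J K : Set ι} {u : V ≃ₗ[ℝ] V}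
    (hu : u ∈ MinReps α s J K) {k : ι} (hk : k ∈ K) : 0 < X.ρ (u (α k)) := by
  have D := h.coxFin X Set.univ
  have hau : α k ∈ α '' Set.univ := ⟨k, trivial, rfl⟩
  have huu : u ∈ Subgroup.closure (s '' (α '' Set.univ)) := by
    rw [← WoJ_eq]; exact WoJ_mono (Set.subset_univ _) hu.1
  have hum : u * s (α k) ∈ Subgroup.closure (s '' (α '' Set.univ)) :=
    Subgroup.mul_mem _ huu (CoxD.mem_gen hau)
  rcases lt_or_gt_of_ne (D.ne _ (D.mapR huu (simple_memo k))) with h1 | h1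
  · exfalso
    have h2 := D.Nn_mul hum hau (by
      rw [LinearEquiv.mul_apply, D.self _ hau, map_neg, map_neg]; linarith)
    rw [mul_assoc, D.sq _ hau, mul_one] at h2
    have h3 := hu.2 _ (WoJ_gen hk)
    rw [gen_eq, D.len_eq huu, D.len_eq hum, h2.1, Set.ncard_insert_of_notMem h2.2 (D.Nn_fin hum)]
      at h3
    omega
  · exact h1

theorem min_pos (h : AffineSetup α δ θ B s) (X : RCtx α δ s) {J K : Set ι} {u : V ≃ₗ[ℝ] V}
    (hK : K ⊆ J) (hu : u ∈ MinReps α s J K) {γ : V} (hγ : γ ∈ DelReJ α δ s K) (hp : 0 < X.ρ γ) :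
    0 < X.ρ (u γ) := by
  obtain ⟨m, ε, hε, rfl⟩ := hγ
  have hε' := DeloJ_sub K hε
  have hm : u ε ∈ Delo α s := DeloJ_sub J (WoJ_app hu.1 (DeloJ_mono hK hε))
  rw [map_add, map_zsmul, h.WJ_delta X (WoJ_le J hu.1), pos_iff X hm]
  refine ((pos_iff X hε' m).1 hp).imp id fun h1 => ⟨h1.1, ?_⟩
  refine lt_of_le_of_ne ?_ (h.rho_ne X hm).symm
  rw [X.exp ε hε', map_sum, map_sum]
  apply Finset.sum_nonneg
  intro i _
  rw [map_smul, map_smul]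
  by_cases hi : i ∈ K
  · exact mul_nonneg (h.e_of_rho X hε' h1.2 i) (h.min_simple X hu hi).le
  · rw [supp_zero X.toCtx hε hi]; simp

theorem min_pos_iff (h : AffineSetup α δ θ B s) (X : RCtx α δ s) {J K : Set ι} {u : V ≃ₗ[ℝ] V}
    (hK : K ⊆ J) (hu : u ∈ MinReps α s J K) {γ : V} (hγ : γ ∈ DelReJ α δ s K) :
    0 < X.ρ (u γ) ↔ 0 < X.ρ γ := by
  refine ⟨fun h1 => ?_, h.min_pos X hK hu hγ⟩
  by_contra h2
  have D := h.coxAff X K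
  have h3 := h.min_pos X hK hu (D.neg γ hγ) (by
    rw [map_neg]; have := lt_of_le_of_ne (not_lt.1 h2) (D.ne γ hγ); linarith)
  rw [map_neg, map_neg] at h3
  linarith

theorem exists_min {J K : Set ι} (hK : K ⊆ J) {w : V ≃ₗ[ℝ] V} (hw : w ∈ WoJ α s J) :
    ∃ u ∈ MinReps α s J K, u⁻¹ * w ∈ WoJ α s K := by
  obtain ⟨v, hv⟩ : ∃ v0 : WoJ α s K, ∀ v : WoJ α s K,
      lenG (Set.range fun i => s (α i)) (w * (v0 : V ≃ₗ[ℝ] V)) ≤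
        lenG (Set.range fun i => s (α i)) (w * (v : V ≃ₗ[ℝ] V)) :=
    ⟨_, fun v => Function.argmin_le
      (fun v : WoJ α s K => lenG (Set.range fun i => s (α i)) (w * (v : V ≃ₗ[ℝ] V))) v⟩
  refine ⟨w * v, ⟨Subgroup.mul_mem _ hw (WoJ_mono hK v.2), fun v' hv' => ?_⟩, ?_⟩
  · have := hv ⟨v * v', Subgroup.mul_mem _ v.2 hv'⟩
    simpa [mul_assoc] using this
  · simp [mul_assoc]

theorem eq_one_of_pos (h : AffineSetup α δ θ B s) (X : RCtx α δ s) {J : Set ι} {w : V ≃ₗ[ℝ] V}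
    (hw : w ∈ WoJ α s J) (hp : ∀ ε ∈ DeloJ α s J, 0 < X.ρ ε → 0 < X.ρ (w ε)) : w = 1 := by
  have hw' := hw
  rw [WoJ_eq] at hw
  apply (h.coxFin X J).eq_one hw
  ext β
  simp only [Nn, Set.mem_ofPred_eq, Set.mem_empty_iff_false, iff_false]
  rintro ⟨h1, h2, h3⟩
  have := hp _ (h.neg_mem (WoJ_app (Subgroup.inv_mem _ hw') h1)) (by rw [map_neg]; linarith)
  rw [map_neg, app_inv, map_neg] at this
  linarith

open Classical in
/-- The functional vanishing on the roots supported in `K`. -/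
noncomputable def om (X : Ctx α δ s) (K : Set ι) : V →ₗ[ℝ] ℝ :=
  ∑ i, if i ∈ K then 0 else X.e i

theorem om_app (X : Ctx α δ s) (K : Set ι) (v : V) :
    om X K v = ∑ i, (open Classical in if i ∈ K then (0 : ℝ) else X.e i v) := by
  classical
  rw [om, LinearMap.sum_apply]
  exact Finset.sum_congr rfl fun i _ => by split_ifs <;> simp

theorem om_delta (X : Ctx α δ s) (K : Set ι) : om X K δ = 0 := by
  rw [om_app]
  exact Finset.sum_eq_zero fun i _ => by split_ifs <;> simp [X.e_delta]

theorem om_of_mem (X : Ctx α δ s) {K : Set ι} {ε : V} (hε : ε ∈ DeloJ α s K) : om X K ε = 0 := by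
  rw [om_app]
  refine Finset.sum_eq_zero fun i _ => ?_
  split_ifs with hi
  · rfl
  · exact supp_zero X hε hi

theorem om_nonneg (X : Ctx α δ s) (K : Set ι) {v : V} (hp : ∀ i, 0 ≤ X.e i v) : 0 ≤ om X K v := by
  rw [om_app]
  refine Finset.sum_nonneg fun i _ => ?_
  split_ifs with hi
  · exact le_rfl
  · exact hp i

theorem mem_of_om (h : AffineSetup α δ θ B s) (X : Ctx α δ s) {K : Set ι} {ε : V}
    (hε : ε ∈ Delo α s) (ho : om X K ε = 0) : ε ∈ DeloJ α s K := by
  have main : ∀ ε ∈ Delo α s, (∀ i, 0 ≤ X.e i ε) → om X K ε = 0 → ε ∈ DeloJ α s K := by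
    intro ε hε hp ho
    apply h.supp_mem X hε
    intro i hi
    rw [om_app, Finset.sum_eq_zero_iff_of_nonneg] at ho
    · have := ho i (Finset.mem_univ i)
      rwa [if_neg hi] at this
    · intro i _
      split_ifs with hi
      · exact le_rfl
      · exact hp i
  rcases X.sgn ε hε with h1 | h1
  · exact main ε hε h1 ho
  · have := main (-ε) (h.neg_mem hε) (fun i => by rw [map_neg]; linarith [h1 i]) (by
      rw [map_neg, ho, neg_zero])
    simpa using h.neg_mem this

theorem om_pos_rho (X : RCtx α δ s) {K : Set ι} {ε : V}
    (hε : ε ∈ Delo α s) (ho : 0 < om X.toCtx K ε) : 0 < X.ρ ε := by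
  rcases X.sgn ε hε with h1 | h1
  · exact X.rho_pos ε hε h1
  · have := om_nonneg X.toCtx K (v := -ε) (fun i => by rw [map_neg]; linarith [h1 i])
    rw [map_neg] at this
    linarith

theorem om_neg_rho (h : AffineSetup α δ θ B s) (X : RCtx α δ s) {K : Set ι} {ε : V}
    (hε : ε ∈ Delo α s) (ho : om X.toCtx K ε < 0) : X.ρ ε < 0 := by
  have := om_pos_rho X (K := K) (h.neg_mem hε) (by rw [map_neg]; linarith)
  rw [map_neg] at this
  linarith

theorem om_inv (h : AffineSetup α δ θ B s) (X : Ctx α δ s) {K : Set ι} {y : V ≃ₗ[ℝ] V}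
    (hy : y ∈ WJ α δ s K) (v : V) : om X K (y v) = om X K v := by
  refine inv_fun X (om X K) (Y := PiJ α δ s K) ?_ hy v
  intro a ha
  obtain ⟨m, ε, hε, rfl⟩ := h.PiJ_form ha
  refine ⟨?_, m, ε, DeloJ_sub K hε, rfl⟩
  rw [map_add, map_zsmul, om_delta, om_of_mem X hε]; simp

theorem om_simple (X : Ctx α δ s) {K : Set ι} {j : ι} (hj : j ∉ K) : om X K (α j) = 1 := by
  rw [om_app, Finset.sum_eq_single j]
  · rw [if_neg hj, X.e_same]
  · intro i _ hi
    split_ifs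
    · rfl
    · exact X.e_diff i j hi
  · simp

theorem om_real (X : Ctx α δ s) (K : Set ι) (m : ℤ) (ε : V) : om X K (m • δ + ε) = om X K ε := by
  rw [map_add, map_zsmul, om_delta]; simp

end AffineSetup

namespace AffineSetup

variable {α : ι → V} {δ θ : V} {B : V →ₗ[ℝ] V →ₗ[ℝ] ℝ} {s : V → V ≃ₗ[ℝ] V}

/-- The limit inversion set attached to `x` and `K`. -/
def NX (X : RCtx α δ s) (J K : Set ι) (x : V ≃ₗ[ℝ] V) : Set V :=
  {β | β ∈ DelReJ α δ s J ∧ 0 < X.ρ β ∧ (om X.toCtx K (x⁻¹ β) < 0 ∨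
    (om X.toCtx K (x⁻¹ β) = 0 ∧ X.ρ (x⁻¹ β) < 0))}

theorem KJneg_iff (h : AffineSetup α δ θ B s) (X : RCtx α δ s) {J K : Set ι} {η : V} :
    η ∈ DeloKJneg α s J K ↔ η ∈ DeloJ α s J ∧ om X.toCtx K η < 0 := by
  constructor
  · rintro ⟨⟨h1, h2⟩, h3⟩
    refine ⟨h1, ?_⟩
    have h1' := DeloJ_sub J h1
    have h4 := om_nonneg X.toCtx K ((X.poso _ (h.neg_mem h1')).1 h3)
    rw [map_neg] at h4
    exact lt_of_le_of_ne (by linarith) fun h5 => h2 (h.mem_of_om X.toCtx h1' h5)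
  · rintro ⟨h1, h2⟩
    have h1' := DeloJ_sub J h1
    refine ⟨⟨h1, fun h3 => h2.ne (om_of_mem X.toCtx h3)⟩, (X.poso _ (h.neg_mem h1')).2 ?_⟩
    apply h.e_of_rho X (h.neg_mem h1')
    have := h.om_neg_rho X h1' h2
    rw [map_neg]
    linarith

theorem DKJm_iff (h : AffineSetup α δ θ B s) (X : RCtx α δ s) {J K : Set ι} {u : V ≃ₗ[ℝ] V}
    (hu : u ∈ WoJ α s J) {β : V} : β ∈ DKJm α δ θ s J K u ↔
      β ∈ DelReJ α δ s J ∧ 0 < X.ρ β ∧ om X.toCtx K (u⁻¹ β) < 0 := by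
  have hd : u⁻¹ δ = δ := h.WJ_delta X (WoJ_le J (Subgroup.inv_mem _ hu))
  rw [DKJm, h.brSet_iff X]
  · constructor
    · rintro ⟨m, _, ⟨η, hη, rfl⟩, rfl, h2⟩
      obtain ⟨h3, h4⟩ := (h.KJneg_iff X).1 hη
      refine ⟨⟨m, _, WoJ_app hu h3, rfl⟩, h2, ?_⟩
      rw [map_add, map_zsmul, hd, inv_app, om_real]
      exact h4
    · rintro ⟨⟨m, ε, hε, rfl⟩, h2, h3⟩
      rw [map_add, map_zsmul, hd, om_real] at h3
      exact ⟨m, ε, ⟨u⁻¹ ε, (h.KJneg_iff X).2 ⟨WoJ_app (Subgroup.inv_mem _ hu) hε, h3⟩,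
        app_inv _ _⟩, rfl, h2⟩
  · rintro _ ⟨η, hη, rfl⟩
    exact DeloJ_sub J (WoJ_app hu ((h.KJneg_iff X).1 hη).1)

theorem NX_one (h : AffineSetup α δ θ B s) (X : RCtx α δ s) (J K : Set ι) :
    NX X J K 1 = DKJm α δ θ s J K 1 := by
  ext β
  rw [h.DKJm_iff X (Subgroup.one_mem _)]
  simp only [NX, Set.mem_ofPred_eq, inv_one, LinearEquiv.coe_one, id]
  constructor
  · rintro ⟨h1, h2, h3 | h3⟩
    · exact ⟨h1, h2, h3⟩
    · linarith [h3.2]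
  · rintro ⟨h1, h2, h3⟩
    exact ⟨h1, h2, Or.inl h3⟩

theorem PhiInf_eq (h : AffineSetup α δ θ B s) (X : RCtx α δ s) {J : Set ι} {f : ℕ → V}
    (hf : IRW α δ s J f) :
    PhiInfJ α δ θ s J f = ⋃ p, Nn (DelReJ α δ s J) X.ρ (zwA s f p) := by
  rw [PhiInfJ]
  exact Set.iUnion_congr fun p => h.Phi_WJ X (CoxD.zwA_mem hf.1 p)

theorem PX (h : AffineSetup α δ θ B s) (X : RCtx α δ s) {J K : Set ι} {f : ℕ → V}
    (hf : IRW α δ s J f) (hZ : PhiInfJ α δ θ s J f = DKJm α δ θ s J K 1) {x : V ≃ₗ[ℝ] V}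
    (hx : x ∈ WJ α δ s J) : PhiInfXJ α δ θ s J x f = NX X J K x := by
  have D := h.coxAff X J
  rw [h.PhiInf_eq X hf] at hZ
  have hz : ∀ p, zwA s f p ∈ WJ α δ s J := fun p => CoxD.zwA_mem hf.1 p
  have mono := D.irw_mono hf.1 hf.2
  have key : ∀ γ ∈ DelReJ α δ s J, 0 < X.ρ γ → (om X.toCtx K γ < 0 →
      ∃ p₀, ∀ p ≥ p₀, X.ρ ((zwA s f p)⁻¹ γ) < 0) ∧
      (0 ≤ om X.toCtx K γ → ∀ p, 0 < X.ρ ((zwA s f p)⁻¹ γ)) := by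
    intro γ hγ hp
    have h1 : γ ∈ (⋃ p, Nn (DelReJ α δ s J) X.ρ (zwA s f p)) ↔ om X.toCtx K γ < 0 := by
      rw [hZ, h.DKJm_iff X (Subgroup.one_mem _)]
      simp only [inv_one, LinearEquiv.coe_one, id]
      exact ⟨fun hh => hh.2.2, fun hh => ⟨hγ, hp, hh⟩⟩
    constructor
    · intro h2
      obtain ⟨p₀, h3⟩ := Set.mem_iUnion.1 (h1.2 h2)
      exact ⟨p₀, fun p hpp => (mono hpp h3).2.2⟩
    · intro h2 p
      by_contra h3
      have h4 := lt_of_le_of_ne (not_lt.1 h3) (D.ne _ (D.mapR_inv (hz p) hγ))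
      have := h1.1 (Set.mem_iUnion.2 ⟨p, hγ, hp, h4⟩)
      linarith
  ext β
  simp only [PhiInfXJ, NX, Set.mem_ofPred_eq, h.brJ_iff X, and_assoc]
  refine and_congr_right fun hβ => and_congr_right fun hp => ?_
  have hγ := h.WJ_iapp X hx hβ
  set γ := x⁻¹ β with hγdef
  have e : ∀ p, (x * zwA s f p)⁻¹ β ∈ DelNeg α δ θ s ↔ X.ρ ((zwA s f p)⁻¹ γ) < 0 := by
    intro p
    rw [mul_inv_rev, LinearEquiv.mul_apply, ← hγdef, h.delNeg_iff X]
    exact ⟨fun hh => hh.2, fun hh => ⟨Or.inl (reJ_sub (h.WJ_iapp X (hz p) hγ)), hh⟩⟩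
  simp only [e]
  rcases lt_or_gt_of_ne (D.ne γ hγ) with h1 | h1
  · obtain ⟨k1, k2⟩ := key (-γ) (D.neg γ hγ) (by rw [map_neg]; linarith)
    simp only [map_neg] at k1 k2
    constructor
    · rintro ⟨p₀, h2⟩
      have h3 : om X.toCtx K γ ≤ 0 := by
        by_contra h3
        obtain ⟨p₁, h4⟩ := k1 (by linarith)
        have h5 := h2 _ (le_max_left p₀ p₁)
        have h6 := h4 _ (le_max_right p₀ p₁)
        linarith
      exact h3.lt_or_eq.imp id fun h4 => ⟨h4, h1⟩
    · intro h2
      have h3 : om X.toCtx K γ ≤ 0 := by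
        rcases h2 with h2 | h2
        · exact h2.le
        · exact h2.1.le
      exact ⟨0, fun p _ => by linarith [k2 (by linarith) p]⟩
  · obtain ⟨k1, k2⟩ := key γ hγ h1
    constructor
    · rintro ⟨p₀, h2⟩
      left
      by_contra h3
      linarith [k2 (not_lt.1 h3) p₀, h2 p₀ le_rfl]
    · rintro (h2 | h2)
      · exact k1 h2
      · linarith [h2.2]

theorem mem_K (h : AffineSetup α δ θ B s) (X : RCtx α δ s) {J K : Set ι} {γ : V}
    (hγ : γ ∈ DelReJ α δ s J) (ho : om X.toCtx K γ = 0) : γ ∈ DelReJ α δ s K := by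
  obtain ⟨m, ε, hε, rfl⟩ := hγ
  rw [om_real] at ho
  exact ⟨m, ε, h.mem_of_om X.toCtx (DeloJ_sub J hε) ho, rfl⟩

theorem om_K (X : RCtx α δ s) {K : Set ι} {γ : V}
    (hγ : γ ∈ DelReJ α δ s K) : om X.toCtx K γ = 0 := by
  obtain ⟨m, ε, hε, rfl⟩ := hγ
  rw [om_real, om_of_mem X.toCtx hε]

theorem nabla (h : AffineSetup α δ θ B s) (X : RCtx α δ s) {J K : Set ι} (hK : K ⊆ J)
    {u x : V ≃ₗ[ℝ] V} (hu : u ∈ MinReps α s J K)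
    (hx : ∀ β ∈ DelReJ α δ s J, om X.toCtx K (x⁻¹ β) = om X.toCtx K (u⁻¹ β)) :
    NX X J K x = DKJm α δ θ s J K u ∪ ⇑u '' Nn (DelReJ α δ s K) X.ρ (u⁻¹ * x) := by
  have huJ := WoJ_le (δ := δ) J hu.1
  ext β
  rw [Set.mem_union, h.DKJm_iff X hu.1]
  constructor
  · rintro ⟨h1, h2, h3⟩
    rw [hx β h1] at h3
    rcases h3 with h3 | ⟨h3, h4⟩
    · exact Or.inl ⟨h1, h2, h3⟩
    · right
      have hm := h.mem_K X (h.WJ_iapp X huJ h1) h3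
      refine ⟨u⁻¹ β, ⟨hm, ?_, ?_⟩, app_inv _ _⟩
      · rw [← h.min_pos_iff X hK hu hm, app_inv]; exact h2
      · rw [mul_inv_rev, inv_inv, LinearEquiv.mul_apply, app_inv]; exact h4
  · rintro (⟨h1, h2, h3⟩ | ⟨γ, ⟨h1, h2, h3⟩, rfl⟩)
    · exact ⟨h1, h2, Or.inl (by rw [hx β h1]; exact h3)⟩
    · have h4 := h.WJ_app X huJ (reJ_mono hK h1)
      refine ⟨h4, h.min_pos X hK hu h1 h2, Or.inr ⟨?_, ?_⟩⟩
      · rw [hx _ h4, inv_app]; exact om_K X h1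
      · rwa [mul_inv_rev, inv_inv, LinearEquiv.mul_apply] at h3

theorem om_uy (h : AffineSetup α δ θ B s) (X : RCtx α δ s) {K : Set ι}
    {u y : V ≃ₗ[ℝ] V} (hy : y ∈ WJ α δ s K) (β : V) :
    om X.toCtx K ((u * y)⁻¹ β) = om X.toCtx K (u⁻¹ β) := by
  rw [mul_inv_rev, LinearEquiv.mul_apply, h.om_inv X.toCtx (Subgroup.inv_mem _ hy)]

theorem nabla_uy (h : AffineSetup α δ θ B s) (X : RCtx α δ s) {J K : Set ι} (hK : K ⊆ J)
    {u y : V ≃ₗ[ℝ] V} (hu : u ∈ MinReps α s J K) (hy : y ∈ WJ α δ s K) :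
    NX X J K (u * y) = DKJm α δ θ s J K u ∪ ⇑u '' PhiJb α δ θ s K y := by
  rw [h.nabla X hK hu fun β _ => h.om_uy X hy β, inv_mul_cancel_left, h.Phi_WJ X hy]

theorem Phi_inter (h : AffineSetup α δ θ B s) (X : RCtx α δ s) {J K : Set ι} (hK : K ⊆ J)
    {v : V ≃ₗ[ℝ] V} (hv : v ∈ WJ α δ s J) :
    PhiJb α δ θ s J v ∩ DelJPosB α δ θ s K = Nn (DelReJ α δ s K) X.ρ v := by
  rw [h.Phi_WJ X hv]
  ext β
  rw [Set.mem_inter_iff, h.A_iff X]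
  constructor
  · rintro ⟨⟨h1, h2, h3⟩, h4 | ⟨m, _, rfl⟩⟩
    · exact ⟨h4.1, h2, h3⟩
    · exact absurd (reJ_sub h1) (im_not_real X m)
  · rintro ⟨h1, h2, h3⟩
    exact ⟨⟨reJ_mono hK h1, h2, h3⟩, Or.inl ⟨h1, h2⟩⟩

theorem exists_z (h : AffineSetup α δ θ B s) (X : RCtx α δ s) {J : Set ι} (K : Set ι)
    {v : V ≃ₗ[ℝ] V} (hv : v ∈ WJ α δ s J) :
    ∃ z ∈ WJ α δ s K, Nn (DelReJ α δ s K) X.ρ z = Nn (DelReJ α δ s K) X.ρ v := by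
  obtain ⟨z, hz, h1⟩ := h.half_word X K (X.ρ ∘ₗ (v⁻¹ : V ≃ₗ[ℝ] V).toLinearMap) (by
    have : v⁻¹ δ = δ := h.WJ_delta X (Subgroup.inv_mem _ hv)
    change 0 < X.ρ (v⁻¹ δ)
    rw [this, X.rho_delta]
    norm_num)
  exact ⟨z, hz, h1⟩

theorem reJ_span (h : AffineSetup α δ θ B s) (X : RCtx α δ s) {J : Set ι} {v : V}
    (hv : v ∈ DelReJ α δ s J) : v ∈ Submodule.span ℝ (Set.range (alHat α δ θ)) := by
  have ha : ∀ i, α i ∈ Submodule.span ℝ (Set.range (alHat α δ θ)) :=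
    fun i => Submodule.subset_span ⟨some i, rfl⟩
  have hr : ∀ ε ∈ Delo α s, ε ∈ Submodule.span ℝ (Set.range (alHat α δ θ)) := by
    intro ε hε
    rw [X.exp ε hε]
    exact Submodule.sum_mem _ fun i _ => Submodule.smul_mem _ _ (ha i)
  have hd : δ ∈ Submodule.span ℝ (Set.range (alHat α δ θ)) := by
    have h1 : δ - θ ∈ Submodule.span ℝ (Set.range (alHat α δ θ)) :=
      Submodule.subset_span ⟨none, rfl⟩
    have := Submodule.add_mem _ h1 (hr θ h.theta_high.1)
    rwa [sub_add_cancel] at this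
  obtain ⟨m, ε, hε, rfl⟩ := hv
  exact Submodule.add_mem _ (zsmul_mem hd m) (hr ε (DeloJ_sub J hε))

theorem om_w (h : AffineSetup α δ θ B s) (X : RCtx α δ s) {K : Set ι}
    {u w : V ≃ₗ[ℝ] V} (hy : u⁻¹ * w ∈ WoJ α s K) (β : V) :
    om X.toCtx K (w⁻¹ β) = om X.toCtx K (u⁻¹ β) := by
  have := h.om_uy X (u := u) (WoJ_le K hy) β
  rwa [mul_inv_cancel_left] at this

theorem om_transl (h : AffineSetup α δ θ B s) (X : RCtx α δ s) {J K : Set ι}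
    {x u w : V ≃ₗ[ℝ] V} (hx : x ∈ WJ α δ s J) (ht : w⁻¹ * x ∈ TJ α δ θ B s J)
    (hy : u⁻¹ * w ∈ WoJ α s K) {β : V} (hβ : β ∈ DelReJ α δ s J) :
    om X.toCtx K (x⁻¹ β) = om X.toCtx K (u⁻¹ β) := by
  obtain ⟨_, lam, _, h1⟩ := ht
  have h2 := h1 _ (h.reJ_span X (h.WJ_iapp X hx hβ))
  rw [LinearEquiv.mul_apply, app_inv] at h2
  rw [← h.om_w X hy, h2, map_sub, map_smul, om_delta]
  simp

/-- A minimal representative attached to an element of the affine group. -/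
theorem exists_rep (h : AffineSetup α δ θ B s) (X : RCtx α δ s) {J K : Set ι} (hK : K ⊆ J)
    {x : V ≃ₗ[ℝ] V} (hx : x ∈ WJ α δ s J) : ∃ u ∈ MinReps α s J K,
      ∀ β ∈ DelReJ α δ s J, om X.toCtx K (x⁻¹ β) = om X.toCtx K (u⁻¹ β) := by
  obtain ⟨w, hw, h1⟩ := h.proj X (Subgroup.inv_mem _ hx)
  obtain ⟨u, hu, h2⟩ := exists_min hK (Subgroup.inv_mem _ hw)
  refine ⟨u, hu, fun β hβ => ?_⟩
  obtain ⟨c, hc⟩ := h1 β hβ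
  have := h.om_w X h2 β
  rw [inv_inv] at this
  rw [hc, map_add, map_smul, om_delta, ← this]
  simp

theorem NX_inf (h : AffineSetup α δ θ B s) (X : RCtx α δ s) {J K : Set ι} (hK : K ⊂ J)
    {x : V ≃ₗ[ℝ] V} (hx : x ∈ WJ α δ s J) : (NX X J K x).Infinite := by
  obtain ⟨j, hj, hjK⟩ := Set.exists_of_ssubset hK
  obtain ⟨N, hN⟩ := exists_nat_gt (X.ρ (x (α j)))
  have hd := h.WJ_delta X hx
  refine Set.infinite_of_injective_forall_mem (f := fun n : ℕ => x (((n + N : ℕ) : ℤ) • δ + -α j))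
    ?_ ?_
  · intro a b hab
    have h1 := x.injective hab
    have h2 := congrArg X.ρ h1
    rw [rho_real, rho_real] at h2
    have h3 : (((a + N : ℕ) : ℤ) : ℝ) = ((b + N : ℕ) : ℤ) := by linarith
    have h4 : ((a + N : ℕ) : ℤ) = ((b + N : ℕ) : ℤ) := by exact_mod_cast h3
    omega
  · intro n
    refine ⟨h.WJ_app X hx ⟨_, _, h.neg_mem (simple_mem hj), rfl⟩, ?_, Or.inl ?_⟩
    · rw [map_add, map_zsmul, hd, rho_real, map_neg, map_neg]
      push_cast
      have : (0 : ℝ) ≤ n := Nat.cast_nonneg n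
      linarith
    · rw [inv_app, om_real, map_neg, om_simple X.toCtx hjK]
      norm_num

theorem exists_f (h : AffineSetup α δ θ B s) (X : RCtx α δ s) {J K : Set ι} (hK : K ⊂ J)
    {x : V ≃ₗ[ℝ] V} (hx : x ∈ WJ α δ s J) :
    ∃ f : ℕ → V, IRW α δ s J f ∧ PhiInfJ α δ θ s J f = NX X J K x := by
  have D := h.coxAff X J
  have hd : x⁻¹ δ = δ := h.WJ_delta X (Subgroup.inv_mem _ hx)
  obtain ⟨N0, hN0⟩ : ∃ N0 : ℕ, ∀ β ∈ Nn (DelReJ α δ s J) X.ρ x, 0 < om X.toCtx K (x⁻¹ β) →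
      0 ≤ X.ρ (x⁻¹ β) + N0 * om X.toCtx K (x⁻¹ β) := by
    obtain ⟨M, hM⟩ := ((D.Nn_fin hx).image
      (fun β => -X.ρ (x⁻¹ β) / om X.toCtx K (x⁻¹ β))).bddAbove
    obtain ⟨N0, h1⟩ := exists_nat_ge M
    refine ⟨N0, fun β hβ ho => ?_⟩
    have h2 : -X.ρ (x⁻¹ β) / om X.toCtx K (x⁻¹ β) ≤ N0 := (hM ⟨β, hβ, rfl⟩).trans h1
    rw [div_le_iff₀ ho] at h2
    linarith
  have hw : ∀ n : ℕ, ∃ w ∈ WJ α δ s J, Nn (DelReJ α δ s J) X.ρ w =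
      {β | β ∈ DelReJ α δ s J ∧ 0 < X.ρ β ∧
        X.ρ (x⁻¹ β) + (N0 + n : ℕ) * om X.toCtx K (x⁻¹ β) < 0} := by
    intro n
    obtain ⟨w, hw, h1⟩ := h.half_word X J ((X.ρ + ((N0 + n : ℕ) : ℝ) • om X.toCtx K) ∘ₗ
      (x⁻¹ : V ≃ₗ[ℝ] V).toLinearMap) (by
        change 0 < X.ρ (x⁻¹ δ) + ((N0 + n : ℕ) : ℝ) * om X.toCtx K (x⁻¹ δ)
        rw [hd, X.rho_delta, om_delta]
        simp)
    exact ⟨w, hw, h1⟩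
  choose w hw hN using hw
  have hle : ∀ n β, β ∈ Nn (DelReJ α δ s J) X.ρ (w n) → om X.toCtx K (x⁻¹ β) ≤ 0 := by
    intro n β hβ
    rw [hN] at hβ
    obtain ⟨h1, h2, h3⟩ := hβ
    by_contra h4
    push Not at h4
    push_cast at h3
    have hn : (0 : ℝ) ≤ n := Nat.cast_nonneg n
    have hn0 : (0 : ℝ) ≤ N0 := Nat.cast_nonneg N0
    have h6 := mul_nonneg hn h4.le
    have h7 := mul_nonneg hn0 h4.le
    have h5 := hN0 β ⟨h1, h2, by nlinarith⟩ h4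
    nlinarith
  have hunion : (⋃ n, Nn (DelReJ α δ s J) X.ρ (w n)) = NX X J K x := by
    ext β
    rw [Set.mem_iUnion]
    constructor
    · rintro ⟨n, hn⟩
      have h1 := hle n β hn
      rw [hN] at hn
      refine ⟨hn.1, hn.2.1, h1.lt_or_eq.imp id fun h2 => ⟨h2, ?_⟩⟩
      have := hn.2.2
      rw [h2, mul_zero, add_zero] at this
      exact this
    · rintro ⟨h1, h2, h3 | ⟨h3, h4⟩⟩
      · obtain ⟨n, hn⟩ := exists_nat_gt (X.ρ (x⁻¹ β) / (-om X.toCtx K (x⁻¹ β)))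
        refine ⟨n, ?_⟩
        rw [hN]
        refine ⟨h1, h2, ?_⟩
        rw [div_lt_iff₀ (by linarith)] at hn
        have : (0 : ℝ) ≤ N0 := Nat.cast_nonneg N0
        push_cast
        nlinarith
      · refine ⟨0, ?_⟩
        rw [hN]
        refine ⟨h1, h2, ?_⟩
        rw [h3, mul_zero, add_zero]
        exact h4
  let w' : ℕ → V ≃ₗ[ℝ] V := fun n => n.casesOn 1 w
  have hunion' : (⋃ n, Nn (DelReJ α δ s J) X.ρ (w' n)) = NX X J K x := by
    rw [← hunion]
    ext β
    simp only [Set.mem_iUnion]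
    constructor
    · rintro ⟨_ | n, hn⟩
      · have : β ∈ Nn (DelReJ α δ s J) X.ρ (1 : V ≃ₗ[ℝ] V) := hn
        rw [CoxD.Nn_one] at this
        exact absurd this (Set.notMem_empty β)
      · exact ⟨n, hn⟩
    · rintro ⟨n, hn⟩
      exact ⟨n + 1, hn⟩
  obtain ⟨f, h1, h2, h3⟩ := D.infinite_word w' (by
      rintro (_ | n)
      · exact Subgroup.one_mem _
      · exact hw n) rfl (by
      rintro (_ | n)
      · change Nn _ _ 1 ⊆ _
        rw [CoxD.Nn_one]
        exact Set.empty_subset _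
      · intro β hβ
        have h1 := hle n β hβ
        change β ∈ Nn _ _ (w n) at hβ
        change β ∈ Nn _ _ (w (n + 1))
        rw [hN] at hβ ⊢
        refine ⟨hβ.1, hβ.2.1, ?_⟩
        have := hβ.2.2
        push_cast at this ⊢
        linarith) (by rw [hunion']; exact h.NX_inf X hK hx)
  have hf : IRW α δ s J f := ⟨h1, h2⟩
  exact ⟨f, hf, by rw [h.PhiInf_eq X hf, h3, hunion']⟩

end AffineSetup

namespace AffineSetup

variable {α : ι → V} {δ θ : V} {B : V →ₗ[ℝ] V →ₗ[ℝ] ℝ} {s : V → V ≃ₗ[ℝ] V}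

theorem sign_of_NX (h : AffineSetup α δ θ B s) (X : RCtx α δ s) {J K₁ K₂ : Set ι}
    {x₁ x₂ : V ≃ₗ[ℝ] V} (hx₁ : x₁ ∈ WJ α δ s J) (hx₂ : x₂ ∈ WJ α δ s J)
    (hN : NX X J K₁ x₁ ⊆ NX X J K₂ x₂) {ε : V} (hε : ε ∈ DeloJ α s J)
    (ho : om X.toCtx K₁ (x₁⁻¹ ε) < 0) : om X.toCtx K₂ (x₂⁻¹ ε) < 0 := by
  have hd₁ : x₁⁻¹ δ = δ := h.WJ_delta X (Subgroup.inv_mem _ hx₁)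
  have hd₂ : x₂⁻¹ δ = δ := h.WJ_delta X (Subgroup.inv_mem _ hx₂)
  obtain ⟨N, hNat⟩ := exists_nat_gt (|X.ρ ε| + |X.ρ (x₂⁻¹ ε)|)
  have a1 := neg_abs_le (X.ρ ε)
  have a2 := neg_abs_le (X.ρ (x₂⁻¹ ε))
  have a3 := abs_nonneg (X.ρ ε)
  have a4 := abs_nonneg (X.ρ (x₂⁻¹ ε))
  have hmem : (N : ℤ) • δ + ε ∈ NX X J K₁ x₁ := by
    refine ⟨⟨N, ε, hε, rfl⟩, ?_, Or.inl ?_⟩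
    · rw [rho_real]
      push_cast
      linarith
    · rw [map_add, map_zsmul, hd₁, om_real]
      exact ho
  obtain ⟨_, _, h3⟩ := hN hmem
  rw [map_add, map_zsmul, hd₂, om_real, rho_real] at h3
  rcases h3 with h3 | ⟨_, h3⟩
  · exact h3
  · push_cast at h3
    linarith

theorem min_inj (h : AffineSetup α δ θ B s) (X : RCtx α δ s) {J K₁ K₂ : Set ι}
    (hK₁ : K₁ ⊆ J) (hK₂ : K₂ ⊆ J)
    {u₁ u₂ : V ≃ₗ[ℝ] V} (hu₁ : u₁ ∈ MinReps α s J K₁) (hu₂ : u₂ ∈ MinReps α s J K₂)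
    (hN : ∀ ε ∈ DeloJ α s J, (om X.toCtx K₁ (u₁⁻¹ ε) < 0 ↔ om X.toCtx K₂ (u₂⁻¹ ε) < 0)) :
    K₁ = K₂ ∧ u₁ = u₂ := by
  have hv : u₂⁻¹ * u₁ ∈ WoJ α s J := Subgroup.mul_mem _ (Subgroup.inv_mem _ hu₂.1) hu₁.1
  have huu : u₁ = u₂ := by
    have : u₂⁻¹ * u₁ = 1 := by
      apply h.eq_one_of_pos X hv
      intro ε hε hp
      have hm := WoJ_app hu₁.1 hε
      have hm2 : (u₂⁻¹ * u₁) ε ∈ DeloJ α s J := WoJ_app hv hε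
      have k1 := hN _ hm
      have k2 := hN _ (h.neg_mem hm)
      simp only [map_neg, inv_app] at k1 k2
      change 0 < X.ρ (u₂⁻¹ (u₁ ε))
      have h0 := om_nonneg X.toCtx K₁ (h.e_of_rho X (DeloJ_sub J hε) hp)
      rcases h0.lt_or_eq with h1 | h1
      · have h2 := k2.1 (by linarith)
        exact om_pos_rho X (DeloJ_sub J hm2) (show 0 < om X.toCtx K₂ (u₂⁻¹ (u₁ ε)) by linarith)
      · have h2 : om X.toCtx K₂ (u₂⁻¹ (u₁ ε)) = 0 := by
          apply le_antisymm
          · by_contra h3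
            linarith [k2.2 (by linarith)]
          · by_contra h3
            linarith [k1.2 (by linarith)]
        have e1 := h.mem_of_om X.toCtx (DeloJ_sub J hε) h1.symm
        have e2 : u₂⁻¹ (u₁ ε) ∈ DeloJ α s K₂ := h.mem_of_om X.toCtx (DeloJ_sub J hm2) h2
        have f1 := h.min_pos X hK₁ hu₁ (⟨0, ε, e1, by simp⟩ : ε ∈ DelReJ α δ s K₁) hp
        rw [← h.min_pos_iff X hK₂ hu₂
          (⟨0, _, e2, by simp⟩ : u₂⁻¹ (u₁ ε) ∈ DelReJ α δ s K₂), app_inv]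
        exact f1
    exact (inv_mul_eq_one.1 this).symm
  subst huu
  refine ⟨?_, rfl⟩
  have hN' : ∀ j ∈ J, (om X.toCtx K₁ (-α j) < 0 ↔ om X.toCtx K₂ (-α j) < 0) := by
    intro j hj
    have := hN _ (WoJ_app hu₁.1 (h.neg_mem (simple_mem hj)))
    rwa [inv_app] at this
  ext j
  constructor
  · intro hj
    by_contra hj2
    have h1 := (hN' j (hK₁ hj)).2 (by rw [map_neg, om_simple X.toCtx hj2]; norm_num)
    rw [map_neg, om_of_mem X.toCtx (simple_mem hj)] at h1
    simp at h1
  · intro hj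
    by_contra hj2
    have h1 := (hN' j (hK₂ hj)).1 (by rw [map_neg, om_simple X.toCtx hj2]; norm_num)
    rw [map_neg, om_of_mem X.toCtx (simple_mem hj)] at h1
    simp at h1

theorem NX_inj (h : AffineSetup α δ θ B s) (X : RCtx α δ s) {J K₁ K₂ : Set ι}
    (hK₁ : K₁ ⊆ J) (hK₂ : K₂ ⊆ J)
    {u₁ u₂ y₁ y₂ : V ≃ₗ[ℝ] V} (hu₁ : u₁ ∈ MinReps α s J K₁) (hu₂ : u₂ ∈ MinReps α s J K₂)
    (hy₁ : y₁ ∈ WJ α δ s K₁) (hy₂ : y₂ ∈ WJ α δ s K₂)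
    (hN : NX X J K₁ (u₁ * y₁) = NX X J K₂ (u₂ * y₂)) : K₁ = K₂ ∧ u₁ = u₂ ∧ y₁ = y₂ := by
  have m₁ : u₁ * y₁ ∈ WJ α δ s J :=
    Subgroup.mul_mem _ (WoJ_le J hu₁.1) (h.WJ_mono X hK₁ hy₁)
  have m₂ : u₂ * y₂ ∈ WJ α δ s J :=
    Subgroup.mul_mem _ (WoJ_le J hu₂.1) (h.WJ_mono X hK₂ hy₂)
  obtain ⟨rfl, rfl⟩ := h.min_inj X hK₁ hK₂ hu₁ hu₂ (by
    intro ε hε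
    rw [← h.om_uy X hy₁ ε, ← h.om_uy X hy₂ ε]
    exact ⟨h.sign_of_NX X m₁ m₂ hN.subset hε, h.sign_of_NX X m₂ m₁ hN.symm.subset hε⟩)
  refine ⟨rfl, rfl, (h.coxAff X K₁).Nn_inj hy₁ hy₂ ?_⟩
  have key : ∀ y ∈ WJ α δ s K₁, ∀ γ ∈ DelReJ α δ s K₁, 0 < X.ρ γ →
      (u₁ γ ∈ NX X J K₁ (u₁ * y) ↔ X.ρ (y⁻¹ γ) < 0) := by
    intro y hy γ hγ hp
    have e1 : (u₁ * y)⁻¹ (u₁ γ) = y⁻¹ γ := by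
      rw [mul_inv_rev, LinearEquiv.mul_apply, inv_app]
    have e2 : om X.toCtx K₁ (y⁻¹ γ) = 0 := by
      rw [h.om_inv X.toCtx (Subgroup.inv_mem _ hy), om_K X hγ]
    constructor
    · rintro ⟨_, _, h3⟩
      rw [e1, e2] at h3
      rcases h3 with h3 | h3
      · exact absurd h3 (lt_irrefl _)
      · exact h3.2
    · intro h1
      refine ⟨h.WJ_app X (WoJ_le J hu₁.1) (reJ_mono hK₁ hγ), h.min_pos X hK₁ hu₁ hγ hp, Or.inr ?_⟩
      rw [e1]
      exact ⟨e2, h1⟩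
  ext γ
  constructor
  · rintro ⟨h1, h2, h3⟩
    exact ⟨h1, h2, (key y₂ hy₂ γ h1 h2).1 (hN ▸ (key y₁ hy₁ γ h1 h2).2 h3)⟩
  · rintro ⟨h1, h2, h3⟩
    exact ⟨h1, h2, (key y₁ hy₁ γ h1 h2).1 (hN ▸ (key y₂ hy₂ γ h1 h2).2 h3)⟩

theorem K_unique (h : AffineSetup α δ θ B s) (X : RCtx α δ s) {J K₁ K₂ : Set ι}
    (hK₁ : K₁ ⊆ J) (hK₂ : K₂ ⊆ J) {x₁ x₂ : V ≃ₗ[ℝ] V} (hx₁ : x₁ ∈ WJ α δ s J)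
    (hx₂ : x₂ ∈ WJ α δ s J) (hN : NX X J K₁ x₁ = NX X J K₂ x₂) : K₁ = K₂ := by
  obtain ⟨u₁, hu₁, e₁⟩ := h.exists_rep X hK₁ hx₁
  obtain ⟨u₂, hu₂, e₂⟩ := h.exists_rep X hK₂ hx₂
  refine (h.min_inj X hK₁ hK₂ hu₁ hu₂ fun ε hε => ?_).1
  have hε' : ε ∈ DelReJ α δ s J := ⟨0, ε, hε, by simp⟩
  rw [← e₁ ε hε', ← e₂ ε hε']
  exact ⟨h.sign_of_NX X hx₁ hx₂ hN.subset hε, h.sign_of_NX X hx₂ hx₁ hN.symm.subset hε⟩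

/-- Antisymmetric closed and coclosed subsets lying in the negative roots. -/
theorem neg_class (h : AffineSetup α δ θ B s) (X : RCtx α δ s) {J : Set ι} {Q : Set V}
    (hneg : ∀ η ∈ DeloJ α s J, η ∈ Q → X.ρ η < 0)
    (hcl : ∀ ε ∈ DeloJ α s J, ∀ η ∈ DeloJ α s J, ε + η ∈ DeloJ α s J → ε ∈ Q → η ∈ Q →
      ε + η ∈ Q)
    (hco : ∀ ε ∈ DeloJ α s J, ∀ η ∈ DeloJ α s J, ε + η ∈ DeloJ α s J → ε ∉ Q → η ∉ Q →
      ε + η ∉ Q) :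
    ∃ K ⊆ J, ∀ η ∈ DeloJ α s J, (η ∈ Q ↔ om X.toCtx K η < 0) := by
  refine ⟨{j | j ∈ J ∧ -α j ∉ Q}, fun j hj => hj.1, ?_⟩
  set K : Set ι := {j | j ∈ J ∧ -α j ∉ Q} with hKdef
  have hs1 : ∀ j ∈ J, -α j ∈ Q → om X.toCtx K (α j) = 1 := fun j _ hQ =>
    om_simple X.toCtx fun hj => hj.2 hQ
  have hs0 : ∀ j ∈ J, -α j ∉ Q → om X.toCtx K (α j) = 0 := fun j hj hQ =>
    om_of_mem X.toCtx (simple_mem ⟨hj, hQ⟩)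
  have key : ∀ n : ℕ, ∀ η ∈ DeloJ α s J, (∀ i, 0 ≤ X.e i η) → ht X.toCtx η ≤ n →
      (-η ∈ Q ↔ 0 < om X.toCtx K η) := by
    intro n
    induction n with
    | zero =>
      intro η hη hp hn
      have := ht_pos X.toCtx (DeloJ_sub J hη) hp
      push_cast at hn
      linarith
    | succ n ih =>
      intro η hη hp hn
      by_cases hsim : η ∈ α '' J
      · obtain ⟨j, hj, rfl⟩ := hsim
        by_cases hQ : -α j ∈ Q
        · rw [hs1 j hj hQ]
          simp [hQ]
        · rw [hs0 j hj hQ]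
          simp [hQ]
      · obtain ⟨j, hj, hη', hp'⟩ := h.dec_pos X.toCtx hη hp hsim
        have hjm : α j ∈ DeloJ α s J := simple_mem hj
        have hjn := h.neg_mem hjm
        have hηn := h.neg_mem hη
        have hηn' := h.neg_mem hη'
        have ih' := ih _ hη' hp' (by rw [map_sub, ht_alpha]; push_cast at hn; linarith)
        have h0 := om_nonneg X.toCtx K hp'
        have eo : om X.toCtx K η = om X.toCtx K (η - α j) + om X.toCtx K (α j) := by
          rw [← map_add, sub_add_cancel]
        have es : -(η - α j) + -α j = -η := by abel
        have posnot : ∀ ζ ∈ DeloJ α s J, (∀ i, 0 ≤ X.e i ζ) → ζ ∉ Q := fun ζ hζ hpz hQ => by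
          have := hneg ζ hζ hQ
          have := X.rho_pos ζ (DeloJ_sub J hζ) hpz
          linarith
        have hjp : α j ∉ Q := fun hQ => by
          have := hneg _ hjm hQ
          have := simple_pos X j
          linarith
        by_cases q1 : -(η - α j) ∈ Q <;> by_cases q2 : -α j ∈ Q
        · have r1 := ih'.1 q1
          have r2 := hcl _ hηn' _ hjn (by rw [es]; exact hηn) q1 q2
          rw [es] at r2
          exact ⟨fun _ => by rw [eo, hs1 j hj q2]; linarith, fun _ => r2⟩
        · have r1 := ih'.1 q1
          refine ⟨fun _ => by rw [eo, hs0 j hj q2]; linarith, fun _ => ?_⟩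
          by_contra r2
          have e3 : -η + α j = -(η - α j) := by abel
          have r3 := hco _ hηn _ hjm (by rw [e3]; exact hηn') r2 hjp
          rw [e3] at r3
          exact r3 q1
        · refine ⟨fun _ => by rw [eo, hs1 j hj q2]; linarith, fun _ => ?_⟩
          by_contra r2
          have e3 : -η + (η - α j) = -α j := by abel
          have r3 := hco _ hηn _ hη' (by rw [e3]; exact hjn) r2 (posnot _ hη' hp')
          rw [e3] at r3
          exact r3 q2
        · have r1 : ¬ 0 < om X.toCtx K (η - α j) := fun r => q1 (ih'.2 r)
          have r2 := hco _ hηn' _ hjn (by rw [es]; exact hηn) q1 q2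
          rw [es] at r2
          exact ⟨fun r => absurd r r2, fun r => by rw [eo, hs0 j hj q2] at r; linarith⟩
  intro η hη
  have hη' := DeloJ_sub J hη
  have hnη := h.neg_mem hη
  rcases lt_or_gt_of_ne (h.rho_ne X hη') with h1 | h1
  · obtain ⟨n, hn⟩ := exists_nat_ge (ht X.toCtx (-η))
    have := key n (-η) hnη (h.e_of_rho X (DeloJ_sub J hnη) (by rw [map_neg]; linarith)) hn
    rw [neg_neg, map_neg] at this
    rw [this]
    constructor <;> intro <;> linarith
  · have h2 := om_nonneg X.toCtx K (h.e_of_rho X hη' h1)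
    exact ⟨fun hQ => by linarith [hneg η hη hQ], fun hh => by linarith⟩

theorem fin_class (h : AffineSetup α δ θ B s) (X : RCtx α δ s) {J : Set ι} {P : Set V}
    (hanti : ∀ η ∈ DeloJ α s J, η ∈ P → -η ∉ P)
    (hcl : ∀ ε ∈ DeloJ α s J, ∀ η ∈ DeloJ α s J, ε + η ∈ DeloJ α s J → ε ∈ P → η ∈ P →
      ε + η ∈ P)
    (hco : ∀ ε ∈ DeloJ α s J, ∀ η ∈ DeloJ α s J, ε + η ∈ DeloJ α s J → ε ∉ P → η ∉ P →
      ε + η ∉ P) :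
    ∃ K ⊆ J, ∃ u ∈ MinReps α s J K,
      ∀ η ∈ DeloJ α s J, (η ∈ P ↔ om X.toCtx K (u⁻¹ η) < 0) := by
  have D := h.bicFin X J
  set F : Set V := {v | v ∈ DeloJ α s J ∧ 0 < X.ρ v ∧ v ∈ P} with hF
  have hfin : F.Finite := h.finite.subset fun v hv => DeloJ_sub J hv.1
  obtain ⟨w, hw, hN⟩ := D.finite_bic _ F hfin rfl (fun v hv => hv.1) (by
    refine ⟨⟨fun v hv => ⟨hv.1, hv.2.1⟩, ?_⟩, Set.sdiff_subset, ?_⟩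
    · intro x hx y hy hA
      exact ⟨hA.1, hA.2, hcl x hx.1 y hy.1 hA.1 hx.2.2 hy.2.2⟩
    · rintro x ⟨hx, hx'⟩ y ⟨hy, hy'⟩ hA
      refine ⟨hA, fun hh => ?_⟩
      exact hco x hx.1 y hy.1 hA.1 (fun q => hx' ⟨hx.1, hx.2, q⟩)
        (fun q => hy' ⟨hy.1, hy.2, q⟩) hh.2.2)
  rw [← WoJ_eq] at hw
  have hi := Subgroup.inv_mem _ hw
  have hmem : ∀ ε ∈ DeloJ α s J, 0 < X.ρ ε → (ε ∈ P ↔ X.ρ (w⁻¹ ε) < 0) := by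
    intro ε hε hp
    constructor
    · intro hP
      have : ε ∈ Nn (DeloJ α s J) X.ρ w := by rw [hN]; exact ⟨hε, hp, hP⟩
      exact this.2.2
    · intro hr
      have : ε ∈ F := by rw [← hN]; exact ⟨hε, hp, hr⟩
      exact this.2.2
  obtain ⟨K, hK, hQ⟩ := h.neg_class X (J := J) (Q := {η | w η ∈ P}) (by
      intro η hη hP
      have hP' : w η ∈ P := hP
      have hm := WoJ_app hw hη
      rcases lt_or_gt_of_ne (h.rho_ne X (DeloJ_sub J hm)) with h1 | h1
      · have h2 := (hmem _ (h.neg_mem hm) (by rw [map_neg]; linarith)).not.1 (hanti _ hm hP')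
        rw [map_neg, inv_app, map_neg] at h2
        exact lt_of_le_of_ne (by linarith) (h.rho_ne X (DeloJ_sub J hη))
      · have := (hmem _ hm h1).1 hP'
        rwa [inv_app] at this)
    (by
      intro ε hε η hη hs h1 h2
      change w (ε + η) ∈ P
      rw [map_add]
      exact hcl _ (WoJ_app hw hε) _ (WoJ_app hw hη)
        (by rw [← map_add]; exact WoJ_app hw hs) h1 h2)
    (by
      intro ε hε η hη hs h1 h2
      change w (ε + η) ∉ P
      rw [map_add]
      exact hco _ (WoJ_app hw hε) _ (WoJ_app hw hη)
        (by rw [← map_add]; exact WoJ_app hw hs) h1 h2)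
  obtain ⟨u, hu, h1⟩ := exists_min hK hw
  refine ⟨K, hK, u, hu, fun η hη => ?_⟩
  rw [← h.om_w X h1, ← hQ _ (WoJ_app hi hη)]
  change _ ↔ w (w⁻¹ η) ∈ P
  rw [app_inv]

end AffineSetup

namespace AffineSetup

variable {α : ι → V} {δ θ : V} {B : V →ₗ[ℝ] V →ₗ[ℝ] ℝ} {s : V → V ≃ₗ[ℝ] V}

theorem classify (h : AffineSetup α δ θ B s) (X : RCtx α δ s) {J : Set ι} {Bs : Set V}
    (hinf : Bs.Infinite) (hbic : BiconvexIn (DelJPosB α δ θ s J) Bs)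
    (hreal : Bs ⊆ DelRe α δ s) :
    ∃ K ⊂ J, ∃ u ∈ MinReps α s J K, ∃ y ∈ WJ α δ s K, Bs = NX X J K (u * y) := by
  obtain ⟨⟨hsub, hcl⟩, -, hco⟩ := hbic
  have hre : ∀ β ∈ Bs, β ∈ DelReJ α δ s J ∧ 0 < X.ρ β := by
    intro β hβ
    rcases (h.A_iff X).1 (hsub hβ) with h1 | ⟨m, _, rfl⟩
    · exact h1
    · exact absurd (hreal hβ) (im_not_real X m)
  have hAr : ∀ m : ℤ, ∀ ε ∈ DeloJ α s J, 0 < X.ρ (m • δ + ε) →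
      m • δ + ε ∈ DelJPosB α δ θ s J := fun m ε hε hp =>
    (h.A_iff X).2 (Or.inl ⟨⟨m, ε, hε, rfl⟩, hp⟩)
  have hAi : ∀ m : ℤ, 1 ≤ m → m • δ ∈ DelJPosB α δ θ s J := fun m hm =>
    (h.A_iff X).2 (Or.inr ⟨m, hm, rfl⟩)
  have hni : ∀ m : ℤ, m • δ ∉ Bs := fun m hm => im_not_real X m (hreal hm)
  have hone : ∀ m : ℤ, 1 ≤ m → ∀ ε ∈ DeloJ α s J, 0 < X.ρ (m • δ + ε) := fun m hm ε hε =>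
    (pos_iff X (DeloJ_sub J hε) m).2 (Or.inl hm)
  have hge : ∀ m : ℤ, ∀ ε ∈ DeloJ α s J, 0 < X.ρ (m • δ + ε) → 0 ≤ m := by
    intro m ε hε hp
    rcases (pos_iff X (DeloJ_sub J hε) m).1 hp with h1 | h1 <;> omega
  have hup : ∀ m n : ℤ, ∀ ε ∈ DeloJ α s J, 0 < X.ρ (m • δ + ε) → m • δ + ε ∉ Bs → m ≤ n →
      n • δ + ε ∉ Bs := by
    intro m n ε hε hp hB hmn
    rcases hmn.eq_or_lt with rfl | hlt
    · exact hB
    · have e1 : (m • δ + ε) + (n - m) • δ = n • δ + ε := by rw [sub_smul]; abel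
      have hpn : 0 < X.ρ (n • δ + ε) := hone n (by have := hge m ε hε hp; omega) ε hε
      have := hco _ ⟨hAr m ε hε hp, hB⟩ _ ⟨hAi (n - m) (by omega), hni _⟩
        (by rw [e1]; exact hAr n ε hε hpn)
      rw [e1] at this
      exact this.2
  set P : Set V := {ε | ∀ m : ℤ, 0 < X.ρ (m • δ + ε) → m • δ + ε ∈ Bs} with hP
  have hnP : ∀ ε ∈ DeloJ α s J, ε ∉ P → ∃ m : ℤ, 0 < X.ρ (m • δ + ε) ∧ m • δ + ε ∉ Bs := by
    intro ε _ hne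
    by_contra hc
    push Not at hc
    exact hne hc
  have hopp : ∀ ε ∈ DeloJ α s J, ε ∈ P → ∀ m : ℤ, m • δ + -ε ∉ Bs := by
    intro ε hε hεP m hB
    have h1 := hge m _ (h.neg_mem hε) (hre _ hB).2
    have h2 := hεP 1 (hone 1 le_rfl ε hε)
    have e1 : (m • δ + -ε) + ((1 : ℤ) • δ + ε) = (m + 1) • δ := by rw [add_smul]; abel
    have := hcl _ hB _ h2 (by rw [e1]; exact hAi _ (by omega))
    rw [e1] at this
    exact hni _ this
  have hfinS : ∀ S : Set V, S ⊆ DeloJ α s J → (∀ ε ∈ S, ε ∉ P) →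
      {β | β ∈ Bs ∧ ∃ m : ℤ, ∃ ε ∈ S, β = m • δ + ε}.Finite := by
    intro S hS hSP
    have hSf : S.Finite := h.finite.subset fun v hv => DeloJ_sub J (hS hv)
    have hex : ∀ ε, ∃ M : ℤ, ε ∈ S → 0 < X.ρ (M • δ + ε) ∧ M • δ + ε ∉ Bs := by
      intro ε
      by_cases hε : ε ∈ S
      · obtain ⟨M, hM⟩ := hnP ε (hS hε) (hSP ε hε)
        exact ⟨M, fun _ => hM⟩
      · exact ⟨0, fun hh => absurd hh hε⟩
    choose M hM using hex
    refine (hSf.biUnion fun ε _ =>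
      (Set.finite_Icc (0 : ℤ) (M ε)).image fun m : ℤ => m • δ + ε).subset ?_
    rintro β ⟨hB, m, ε, hε, rfl⟩
    refine Set.mem_biUnion hε ⟨m, ⟨hge m ε (hS hε) (hre _ hB).2, ?_⟩, rfl⟩
    by_contra hlt
    push Not at hlt
    exact hup (M ε) m ε (hS hε) (hM ε hε).1 (hM ε hε).2 hlt.le hB
  obtain ⟨K, hK, u, hu, hPK⟩ := h.fin_class X (J := J) (P := P)
    (by
      intro η hη hηP hc
      exact hopp η hη hηP 1 (hc 1 (hone 1 le_rfl _ (h.neg_mem hη))))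
    (by
      intro ε hε η hη hs h1 h2 m hp
      by_contra hB
      have h0 := hge m _ hs hp
      have h3 := hup m (1 + (m + 1)) _ hs hp hB (by omega)
      have e1 : ((1 : ℤ) • δ + ε) + ((m + 1) • δ + η) = (1 + (m + 1)) • δ + (ε + η) := by
        rw [add_smul 1 (m + 1)]; abel
      have h4 := hcl _ (h1 1 (hone 1 le_rfl ε hε)) _ (h2 (m + 1) (hone _ (by omega) η hη))
        (by rw [e1]; exact hAr _ _ hs (hone _ (by omega) _ hs))
      rw [e1] at h4
      exact h3 h4)
    (by
      intro ε hε η hη hs h1 h2 h3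
      obtain ⟨m, hm, hmB⟩ := hnP ε hε h1
      obtain ⟨n, hn, hnB⟩ := hnP η hη h2
      have e1 : (m • δ + ε) + (n • δ + η) = (m + n) • δ + (ε + η) := by
        rw [add_smul]; abel
      have hp : 0 < X.ρ ((m + n) • δ + (ε + η)) := by rw [← e1, map_add]; linarith
      have h4 := hco _ ⟨hAr m ε hε hm, hmB⟩ _ ⟨hAr n η hη hn, hnB⟩
        (by rw [e1]; exact hAr _ _ hs hp)
      rw [e1] at h4
      exact h4.2 (h3 _ hp))
  have hKJ : K ⊂ J := by
    refine lt_of_le_of_ne hK ?_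
    rintro rfl
    apply hinf
    refine (hfinS (DeloJ α s K) subset_rfl ?_).subset fun β hβ => ⟨hβ, (hre β hβ).1⟩
    intro ε hε hεP
    have := (hPK ε hε).1 hεP
    rw [om_of_mem X.toCtx (WoJ_app (Subgroup.inv_mem _ hu.1) hε)] at this
    exact lt_irrefl _ this
  have huJ := WoJ_le (δ := δ) J hu.1
  have hd : u δ = δ := h.WJ_delta X huJ
  have hd' : u⁻¹ δ = δ := h.WJ_delta X (Subgroup.inv_mem _ huJ)
  have huA : ∀ x ∈ DelJPosB α δ θ s K, u x ∈ DelJPosB α δ θ s J := by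
    intro x hx
    rcases (h.A_iff X).1 hx with ⟨h1, h2⟩ | ⟨m, hm, rfl⟩
    · exact (h.A_iff X).2 (Or.inl ⟨h.WJ_app X huJ (reJ_mono hK h1), h.min_pos X hK hu h1 h2⟩)
    · rw [map_zsmul, hd]
      exact hAi m hm
  have hFr : ∀ x ∈ DelJPosB α δ θ s K, u x ∈ Bs → x ∈ DelReJ α δ s K := by
    intro x hx hB
    rcases (h.A_iff X).1 hx with ⟨h1, h2⟩ | ⟨m, hm, rfl⟩
    · exact h1
    · rw [map_zsmul, hd] at hB
      exact absurd hB (hni m)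
  set F : Set V := {x | x ∈ DelJPosB α δ θ s K ∧ u x ∈ Bs} with hF
  have hFfin : F.Finite := by
    have h1 := hfinS {ε | ε ∈ DeloJ α s J ∧ om X.toCtx K (u⁻¹ ε) = 0} (fun ε hε => hε.1) (by
      intro ε hε hεP
      have := (hPK ε hε.1).1 hεP
      rw [hε.2] at this
      exact lt_irrefl _ this)
    refine Set.Finite.of_finite_image (f := u) (h1.subset ?_) u.injective.injOn
    rintro _ ⟨x, ⟨hx, hB⟩, rfl⟩
    obtain ⟨m, ε, hε, rfl⟩ := hFr x hx hB
    refine ⟨hB, m, u ε, ⟨WoJ_app hu.1 (DeloJ_mono hK hε), ?_⟩, ?_⟩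
    · rw [inv_app, om_of_mem X.toCtx hε]
    · rw [map_add, map_zsmul, hd]
  obtain ⟨y, hy, hN⟩ := (h.bicAff X K).finite_bic _ F hFfin rfl (fun x hx => hFr x hx.1 hx.2) (by
    refine ⟨⟨fun v hv => hv.1, ?_⟩, Set.sdiff_subset, ?_⟩
    · intro x hx z hz hA
      refine ⟨hA, ?_⟩
      have := hcl _ hx.2 _ hz.2 (by rw [← map_add]; exact huA _ hA)
      rwa [← map_add] at this
    · rintro x ⟨hx, hx'⟩ z ⟨hz, hz'⟩ hA
      refine ⟨hA, fun hh => ?_⟩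
      have := hco _ ⟨huA x hx, fun q => hx' ⟨hx, q⟩⟩ _ ⟨huA z hz, fun q => hz' ⟨hz, q⟩⟩
        (by rw [← map_add]; exact huA _ hA)
      rw [← map_add] at this
      exact this.2 hh.2)
  refine ⟨K, hKJ, u, hu, y, hy, ?_⟩
  have key : ∀ β ∈ DelReJ α δ s J, 0 < X.ρ β → (β ∈ Bs ↔ om X.toCtx K ((u * y)⁻¹ β) < 0 ∨
      (om X.toCtx K ((u * y)⁻¹ β) = 0 ∧ X.ρ ((u * y)⁻¹ β) < 0)) := by
    intro β hβ hp
    rw [h.om_uy X hy]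
    obtain ⟨m, ε, hε, rfl⟩ := hβ
    have eo : om X.toCtx K (u⁻¹ (m • δ + ε)) = om X.toCtx K (u⁻¹ ε) := by
      rw [map_add, map_zsmul, hd', om_real]
    rcases lt_trichotomy (om X.toCtx K (u⁻¹ ε)) 0 with h1 | h1 | h1
    · exact ⟨fun _ => Or.inl (by rw [eo]; exact h1), fun _ => (hPK ε hε).2 h1 m hp⟩
    · have hm : u⁻¹ (m • δ + ε) ∈ DelReJ α δ s K :=
        h.mem_K X (h.WJ_iapp X huJ ⟨m, ε, hε, rfl⟩) (by rw [eo, h1])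
      have hρ : 0 < X.ρ (u⁻¹ (m • δ + ε)) := by
        rw [← h.min_pos_iff X hK hu hm, app_inv]; exact hp
      have e1 : (u * y)⁻¹ (m • δ + ε) = y⁻¹ (u⁻¹ (m • δ + ε)) := by
        rw [mul_inv_rev, LinearEquiv.mul_apply]
      rw [eo, h1, e1]
      constructor
      · intro hB
        have : u⁻¹ (m • δ + ε) ∈ Nn (DelReJ α δ s K) X.ρ y := by
          rw [hN]
          exact ⟨(h.A_iff X).2 (Or.inl ⟨hm, hρ⟩), by rw [app_inv]; exact hB⟩
        exact Or.inr ⟨rfl, this.2.2⟩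
      · rintro (h2 | h2)
        · exact absurd h2 (lt_irrefl _)
        · have : u⁻¹ (m • δ + ε) ∈ F := by
            rw [← hN]
            exact ⟨hm, hρ, h2.2⟩
          have h3 := this.2
          rwa [app_inv] at h3
    · constructor
      · intro hB
        have := hopp (-ε) (h.neg_mem hε)
          ((hPK _ (h.neg_mem hε)).2 (by rw [map_neg, map_neg]; linarith)) m
        rw [neg_neg] at this
        exact absurd hB this
      · rw [eo]
        rintro (h2 | h2)
        · linarith
        · linarith [h2.1]
  ext β
  constructor
  · intro hB
    obtain ⟨h1, h2⟩ := hre β hB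
    exact ⟨h1, h2, (key β h1 h2).1 hB⟩
  · rintro ⟨h1, h2, h3⟩
    exact (key β h1 h2).2 h3

theorem classify_word (h : AffineSetup α δ θ B s) (X : RCtx α δ s) {J : Set ι} {g : ℕ → V}
    (hg : IRW α δ s J g) :
    ∃ K ⊂ J, ∃ u ∈ MinReps α s J K, ∃ y ∈ WJ α δ s K,
      PhiInfJ α δ θ s J g = NX X J K (u * y) := by
  have D := h.bicAff X J
  have hz : ∀ p, zwA s g p ∈ WJ α δ s J := fun p => CoxD.zwA_mem hg.1 p
  have mono := D.toCoxD.irw_mono hg.1 hg.2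
  rw [h.PhiInf_eq X hg]
  refine h.classify X ?_ ⟨⟨?_, ?_⟩, Set.sdiff_subset, ?_⟩ ?_
  · intro hfin
    obtain ⟨n, hn⟩ : ∃ n, n = (⋃ p, Nn (DelReJ α δ s J) X.ρ (zwA s g p)).ncard := ⟨_, rfl⟩
    have h1 := Set.ncard_le_ncard
      (Set.subset_iUnion (fun p => Nn (DelReJ α δ s J) X.ρ (zwA s g p)) (n + 1)) hfin
    have h2 := D.toCoxD.len_eq (hz (n + 1))
    have h3 : lenG (s '' PiJ α δ s J) (zwA s g (n + 1)) = n + 1 := hg.2 (n + 1)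
    rw [← hn] at h1
    omega
  · intro β hβ
    obtain ⟨p, hp⟩ := Set.mem_iUnion.1 hβ
    exact (D.Nn_bic (hz p)).1.1 hp
  · intro x hx y hy hA
    obtain ⟨p, hp⟩ := Set.mem_iUnion.1 hx
    obtain ⟨q, hq⟩ := Set.mem_iUnion.1 hy
    exact Set.mem_iUnion.2 ⟨max p q, (D.Nn_bic (hz (max p q))).1.2 _
      (mono (le_max_left p q) hp) _ (mono (le_max_right p q) hq) hA⟩
  · rintro x ⟨hx, hx'⟩ y ⟨hy, hy'⟩ hA
    refine ⟨hA, fun hc => ?_⟩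
    obtain ⟨p, hp⟩ := Set.mem_iUnion.1 hc
    exact ((D.Nn_bic (hz p)).2.2 x ⟨hx, fun q => hx' (Set.mem_iUnion.2 ⟨p, q⟩)⟩ y
      ⟨hy, fun q => hy' (Set.mem_iUnion.2 ⟨p, q⟩)⟩ hA).2 hp
  · intro β hβ
    obtain ⟨p, hp⟩ := Set.mem_iUnion.1 hβ
    exact reJ_sub hp.1

end AffineSetup

/-- Theorem 7.4, stated on representatives of the classes in `W_J^∞` (the injection
`Φ_J^∞` identifies an equivalence class of infinite reduced words with the corresponding
infinite real biconvex set; `Z^K_J` is represented by any `f` with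
`Φ_J^∞(f) = Δ^K_J(1,−)`, and `x.Z^K_J` by `Φ̃^∞(x, f)`):
(1) `Φ_J^∞(x.Z^K_J) = ∇_J(K, x̄^K, z_x)`, where `z_x ∈ W_K` is unique with
`Φ_J((x̄^K)⁻¹x) ∩ Δ_{K+} = Φ_K(z_x)`;
(2) `Φ_J^∞` and `χ_J` are bijections with `Φ_J^∞ ∘ χ_J = ∇_J`;
(3) `W_J^∞ = ∐_{K ⊊ J} W_J.Z^K_J`. -/
theorem statement19 (α : ι → V) (δ θ : V) (B : V →ₗ[ℝ] V →ₗ[ℝ] ℝ) (s : V → V ≃ₗ[ℝ] V)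
    (h : AffineSetup α δ θ B s) (J : Set ι) (hJ : J.Nonempty) :
    -- the classes Z^K_J exist for every K ⊊ J
    (∀ K : Set ι, K ⊂ J → ∃ f : ℕ → V,
      IRW α δ s J f ∧ PhiInfJ α δ θ s J f = DKJm α δ θ s J K 1) ∧
    -- (1)
    (∀ x ∈ WJ α δ s J, ∀ K : Set ι, K ⊂ J →
      ∀ f : ℕ → V, IRW α δ s J f → PhiInfJ α δ θ s J f = DKJm α δ θ s J K 1 →
      ∀ w ∈ WoJ α s J, w⁻¹ * x ∈ TJ α δ θ B s J →
      ∀ u ∈ MinReps α s J K, u⁻¹ * w ∈ WoJ α s K →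
        (∃! z : V ≃ₗ[ℝ] V, z ∈ WJ α δ s K ∧
          PhiJb α δ θ s J (u⁻¹ * x) ∩ DelJPosB α δ θ s K = PhiJb α δ θ s K z) ∧
        (∀ z ∈ WJ α δ s K,
          PhiJb α δ θ s J (u⁻¹ * x) ∩ DelJPosB α δ θ s K = PhiJb α δ θ s K z →
          PhiInfXJ α δ θ s J x f = DKJm α δ θ s J K u ∪ ⇑u '' PhiJb α δ θ s K z)) ∧
    -- (2): Φ_J^∞ ∘ χ_J = ∇_J
    (∀ (K : Set ι) (u y : V ≃ₗ[ℝ] V), K ⊂ J → u ∈ MinReps α s J K → y ∈ WJ α δ s K →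
      ∀ f : ℕ → V, IRW α δ s J f → PhiInfJ α δ θ s J f = DKJm α δ θ s J K 1 →
        PhiInfXJ α δ θ s J (u * y) f = DKJm α δ θ s J K u ∪ ⇑u '' PhiJb α δ θ s K y) ∧
    -- (2): Φ_J^∞ is well defined and injective on W_J^∞
    (∀ f g : ℕ → V, IRW α δ s J f → IRW α δ s J g →
      (relJ α δ s J f g ↔ PhiInfJ α δ θ s J f = PhiInfJ α δ θ s J g)) ∧
    -- (2): Φ_J^∞ is surjective onto 𝔅^∞_J
    (∀ Bs : Set V, Bs.Infinite → BiconvexIn (DelJPosB α δ θ s J) Bs →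
      Bs ⊆ DelRePos α δ θ s → ∃ f : ℕ → V, IRW α δ s J f ∧ PhiInfJ α δ θ s J f = Bs) ∧
    -- (2): χ_J is injective
    (∀ (K₁ K₂ : Set ι) (u₁ u₂ y₁ y₂ : V ≃ₗ[ℝ] V),
      K₁ ⊂ J → u₁ ∈ MinReps α s J K₁ → y₁ ∈ WJ α δ s K₁ →
      K₂ ⊂ J → u₂ ∈ MinReps α s J K₂ → y₂ ∈ WJ α δ s K₂ →
      ∀ f₁ f₂ : ℕ → V,
        IRW α δ s J f₁ → PhiInfJ α δ θ s J f₁ = DKJm α δ θ s J K₁ 1 →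
        IRW α δ s J f₂ → PhiInfJ α δ θ s J f₂ = DKJm α δ θ s J K₂ 1 →
        PhiInfXJ α δ θ s J (u₁ * y₁) f₁ = PhiInfXJ α δ θ s J (u₂ * y₂) f₂ →
        K₁ = K₂ ∧ u₁ = u₂ ∧ y₁ = y₂) ∧
    -- (2): χ_J is surjective
    (∀ g : ℕ → V, IRW α δ s J g →
      ∃ (K : Set ι) (u y : V ≃ₗ[ℝ] V), K ⊂ J ∧ u ∈ MinReps α s J K ∧ y ∈ WJ α δ s K ∧
        ∃ f : ℕ → V, IRW α δ s J f ∧ PhiInfJ α δ θ s J f = DKJm α δ θ s J K 1 ∧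
          PhiInfJ α δ θ s J g = PhiInfXJ α δ θ s J (u * y) f) ∧
    -- (3): W_J^∞ decomposes into the disjoint union of the orbits W_J.Z^K_J, K ⊊ J
    (∀ g : ℕ → V, IRW α δ s J g →
      ∃! K : Set ι, K ⊂ J ∧ ∃ x ∈ WJ α δ s J, ∃ f : ℕ → V,
        IRW α δ s J f ∧ PhiInfJ α δ θ s J f = DKJm α δ θ s J K 1 ∧
        PhiInfJ α δ θ s J g = PhiInfXJ α δ θ s J x f) := by
  obtain ⟨X⟩ := h.exists_rctx
  have exZ : ∀ K : Set ι, K ⊂ J → ∃ f : ℕ → V,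
      IRW α δ s J f ∧ PhiInfJ α δ θ s J f = DKJm α δ θ s J K 1 := by
    intro K hK
    obtain ⟨f, hf, h1⟩ := h.exists_f X hK (Subgroup.one_mem _)
    exact ⟨f, hf, by rw [h1, h.NX_one X]⟩
  have huy : ∀ (K : Set ι) (u y : V ≃ₗ[ℝ] V), K ⊂ J → u ∈ MinReps α s J K → y ∈ WJ α δ s K →
      u * y ∈ WJ α δ s J := fun K u y hK hu hy =>
    Subgroup.mul_mem _ (AffineSetup.WoJ_le J hu.1) (h.WJ_mono X hK.subset hy)
  refine ⟨exZ, ?_, ?_, ?_, ?_, ?_, ?_, ?_⟩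
  · intro x hx K hK f hf hZ w hw ht u hu huw
    have hv : u⁻¹ * x ∈ WJ α δ s J :=
      Subgroup.mul_mem _ (Subgroup.inv_mem _ (AffineSetup.WoJ_le J hu.1)) hx
    rw [h.Phi_inter X hK.subset hv]
    refine ⟨?_, ?_⟩
    · obtain ⟨z, hz, h1⟩ := h.exists_z X K hv
      refine ⟨z, ⟨hz, by rw [h.Phi_WJ X hz, h1]⟩, ?_⟩
      rintro z' ⟨hz', h2⟩
      rw [h.Phi_WJ X hz'] at h2
      exact (h.coxAff X K).Nn_inj hz' hz (by rw [h1, h2])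
    · intro z hz h1
      rw [h.PX X hf hZ hx, h.nabla X hK.subset hu fun β hβ => h.om_transl X hx ht huw hβ, h1]
  · intro K u y hK hu hy f hf hZ
    rw [h.PX X hf hZ (huy K u y hK hu hy), h.nabla_uy X hK.subset hu hy]
  · intro f g hf hg
    rw [h.PhiInf_eq X hf, h.PhiInf_eq X hg]
    exact (h.coxAff X J).rel_iff hf.1 hf.2 hg.1 hg.2
  · intro Bs hinf hbic hsub
    obtain ⟨K, hK, u, hu, y, hy, h1⟩ := h.classify X hinf hbic fun β hβ => (hsub hβ).1
    obtain ⟨f, hf, h2⟩ := h.exists_f X hK (huy K u y hK hu hy)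
    exact ⟨f, hf, by rw [h2, h1]⟩
  · intro K₁ K₂ u₁ u₂ y₁ y₂ hK₁ hu₁ hy₁ hK₂ hu₂ hy₂ f₁ f₂ hf₁ hZ₁ hf₂ hZ₂ he
    rw [h.PX X hf₁ hZ₁ (huy _ _ _ hK₁ hu₁ hy₁), h.PX X hf₂ hZ₂ (huy _ _ _ hK₂ hu₂ hy₂)] at he
    exact h.NX_inj X hK₁.subset hK₂.subset hu₁ hu₂ hy₁ hy₂ he
  · intro g hg
    obtain ⟨K, hK, u, hu, y, hy, h1⟩ := h.classify_word X hg
    obtain ⟨f, hf, hZ⟩ := exZ K hK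
    exact ⟨K, u, y, hK, hu, hy, f, hf, hZ, by rw [h1, h.PX X hf hZ (huy K u y hK hu hy)]⟩
  · intro g hg
    obtain ⟨K, hK, u, hu, y, hy, h1⟩ := h.classify_word X hg
    obtain ⟨f, hf, hZ⟩ := exZ K hK
    refine ⟨K, ⟨hK, u * y, huy K u y hK hu hy, f, hf, hZ, by
      rw [h1, h.PX X hf hZ (huy K u y hK hu hy)]⟩, ?_⟩
    rintro K' ⟨hK', x, hx, f', hf', hZ', h2⟩
    rw [h1, h.PX X hf' hZ' hx] at h2
    exact h.K_unique X hK'.subset hK.subset hx (huy K u y hK hu hy) h2.symm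

end
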